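/- For each ε > 0 there exists an integer c_ε such that the following holds. Let P be a set of m distinct points and L a set of n distinct lines in ℝ⁴, and let q, s ≤ n be parameters such that (i) for any nonzero polynomial f ∈ ℝ[x,y,z,w] of degree at most c_ε, the zero set Z(f) does not contain more than q lines of L, and (ii) no 2-plane contains more than s lines of L. Then I(P,L) ≤ A_ε·(m^{2/5+ε}·n^{4/5} + m^{1/2+ε}·n^{2/3}·q^{1/12} + m^{2/3+ε}·n^{4/9}·s^{2/9}) + A·(m + n), where A_ε is a constant depending on ε and A is an absolute constant. -/

import Mathlib

attribute [local instance] Classical.propDecidable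

noncomputable section

/-- The number of incidences between a finite set of points and a finite set of
curves (subsets of `ℝ^d`): the number of pairs `(p, γ)` with `p ∈ γ`. -/
def Incidences {d : ℕ} (P : Finset (Fin d → ℝ)) (C : Finset (Set (Fin d → ℝ))) : ℕ :=
  ((P ×ˢ C).filter fun pc => pc.1 ∈ pc.2).card

/-- A line in `ℝ^d`. -/
def IsLine {d : ℕ} (ℓ : Set (Fin d → ℝ)) : Prop :=
  ∃ a b : Fin d → ℝ, b ≠ 0 ∧ ℓ = {x | ∃ t : ℝ, x = a + t • b}

/-- The real zero set of a polynomial in `d` variables. -/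
def zeroSet {d : ℕ} (f : MvPolynomial (Fin d) ℝ) : Set (Fin d → ℝ) :=
  {x | MvPolynomial.eval x f = 0}

/-- A 2-flat in `ℝ^d`: a two-dimensional affine subspace. -/
def Is2Flat {d : ℕ} (F : Set (Fin d → ℝ)) : Prop :=
  ∃ a b c : Fin d → ℝ, LinearIndependent ℝ ![b, c] ∧
    F = {x | ∃ t u : ℝ, x = a + t • b + u • c}

section Part1
namespace BU
set_option linter.unusedSectionVars false

/-- Coboundary on functions of lists with values in `ZMod 2`. -/
def cob {X : Type*} (φ : List X → ZMod 2) : List X → ZMod 2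
  | [] => 0
  | x :: l => φ l + cob (fun m => φ (x :: m)) l

lemma zadd (a : ZMod 2) : a + a = 0 := CharTwo.add_self_eq_zero a

lemma cob_add {X : Type*} (φ ψ : List X → ZMod 2) (l : List X) :
    cob (fun m => φ m + ψ m) l = cob φ l + cob ψ l := by
  induction l generalizing φ ψ with
  | nil => simp [cob]
  | cons x l ih => simp only [cob, ih]; ring

lemma cob_congr {X : Type*} (φ ψ : List X → ZMod 2) (l : List X)
    (h : ∀ m, m.Sublist l → m.length + 1 = l.length → φ m = ψ m) : cob φ l = cob ψ l := by
  induction l generalizing φ ψ with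
  | nil => simp [cob]
  | cons x l ih =>
    simp only [cob]
    rw [h l (List.sublist_cons_self x l) rfl]
    congr 1
    apply ih
    intro m hm hl
    exact h _ (hm.cons_cons x) (by simp [← hl])

lemma cob_cob {X : Type*} (φ : List X → ZMod 2) (l : List X) : cob (cob φ) l = 0 := by
  induction l generalizing φ with
  | nil => simp [cob]
  | cons x l ih =>
    simp only [cob, cob_add, ih, add_zero]
    exact zadd _

lemma cob_map {X Y : Type*} (f : X → Y) (φ : List Y → ZMod 2) (l : List X) :
    cob (fun m => φ (m.map f)) l = cob φ (l.map f) := by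
  induction l generalizing φ with
  | nil => simp [cob]
  | cons x l ih => simp only [cob, List.map_cons]; rw [← ih]

lemma cob_perm {X : Type*} (φ : List X → ZMod 2) (hφ : ∀ l l', l.Perm l' → φ l = φ l')
    {l l' : List X} (h : l.Perm l') : cob φ l = cob φ l' := by
  induction h generalizing φ with
  | nil => rfl
  | cons x h ih =>
    simp only [cob]
    rw [hφ _ _ h, ih _ (fun a b hab => hφ _ _ (hab.cons x))]
  | swap x y l =>
    simp only [cob]
    rw [show (fun m => φ (x :: y :: m)) = (fun m => φ (y :: x :: m)) from
      funext fun m => hφ _ _ (List.Perm.swap _ _ _)]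
    ring
  | trans h1 h2 ih1 ih2 => rw [ih1 φ hφ, ih2 φ hφ]

/-! alternating labels -/

abbrev Lab (n : ℕ) := Fin n ×ₗ Bool

def alt {n : ℕ} : Bool → List (Lab n) → ZMod 2
  | _, [] => 1
  | s, x :: l => if (ofLex x).2 = s then alt (!s) l else 0

lemma cob_alt {n : ℕ} (s : Bool) (l : List (Lab n)) (hl : l ≠ []) :
    cob (alt s) l = alt true l + alt false l := by
  induction l generalizing s with
  | nil => exact absurd rfl hl
  | cons x l ih =>
    have h0 : cob (fun m => alt s (x :: m)) l = if (ofLex x).2 = s then cob (alt (!s)) l else 0 := by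
      by_cases h : (ofLex x).2 = s
      · simp only [alt, h, if_true]
      · simp only [alt, h, if_false]
        have := cob_add (fun _ : List (Lab n) => (0 : ZMod 2)) (fun _ => 0) l
        simpa using this
    simp only [cob]
    rw [h0]
    rcases l with _ | ⟨y, l⟩
    · simp only [cob, alt]
      cases s <;> cases (ofLex x).2 <;> simp
    · rw [ih _ (by simp)]
      generalize hm : y :: l = m
      simp only [alt]
      have z1 := zadd (alt true m)
      have z2 := zadd (alt false m)
      cases s <;> cases (ofLex x).2 <;> simp <;>
        first | done | linear_combination z1 | linear_combination z2

def flip {n : ℕ} (x : Lab n) : Lab n := toLex ((ofLex x).1, !(ofLex x).2)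

def A {n : ℕ} (s : Bool) (l : List (Lab n)) : ZMod 2 := alt s (l.insertionSort (· ≤ ·))

lemma A_perm {n : ℕ} (s : Bool) (l l' : List (Lab n)) (h : l.Perm l') : A s l = A s l' := by
  unfold A
  congr 1
  apply List.Perm.eq_of_pairwise (le := (· ≤ ·))
  · intro a b _ _ h1 h2; exact le_antisymm h1 h2
  · exact List.pairwise_insertionSort _ _
  · exact List.pairwise_insertionSort _ _
  · exact ((List.perm_insertionSort _ l).trans h).trans (List.perm_insertionSort _ l').symm

lemma A_sorted {n : ℕ} (s : Bool) (l : List (Lab n)) (h : l.Pairwise (· ≤ ·)) : A s l = alt s l := by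
  unfold A; rw [List.Pairwise.insertionSort_eq h]

lemma cob_A {n : ℕ} (s : Bool) (l : List (Lab n)) (hl : l ≠ []) :
    cob (A s) l = A true l + A false l := by
  have hp := List.perm_insertionSort (· ≤ ·) l
  rw [← cob_perm (A s) (A_perm s) hp, ← A_perm _ _ _ hp, ← A_perm false _ _ hp]
  have hs := List.pairwise_insertionSort (· ≤ ·) l
  have hne : l.insertionSort (· ≤ ·) ≠ [] := by
    intro h; rw [h] at hp; exact hl (List.nil_perm.mp hp)
  generalize l.insertionSort (· ≤ ·) = m at *
  rw [A_sorted _ _ hs, A_sorted _ _ hs, ← cob_alt s m hne]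
  apply cob_congr
  intro m' hm' _
  exact A_sorted _ _ (hs.sublist hm')

def Compat {n : ℕ} (l : List (Lab n)) : Prop :=
  ∀ x ∈ l, ∀ y ∈ l, (ofLex x).1 = (ofLex y).1 → (ofLex x).2 = (ofLex y).2

lemma A_flip {n : ℕ} (s : Bool) (l : List (Lab n)) (h : Compat l) :
    A s (l.map flip) = A (!s) l := by
  have hp := List.perm_insertionSort (· ≤ ·) l
  have hs := List.pairwise_insertionSort (· ≤ ·) l
  rw [← A_perm _ _ _ (hp.map flip), ← A_perm _ _ _ hp]
  have hc : Compat (l.insertionSort (· ≤ ·)) := fun x hx y hy => h x (hp.mem_iff.1 hx) y (hp.mem_iff.1 hy)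
  generalize l.insertionSort (· ≤ ·) = m at *
  rw [A_sorted _ _ hs, A_sorted]
  · clear hs hc hp
    induction m generalizing s with
    | nil => rfl
    | cons x m ih =>
      simp only [List.map_cons, alt]
      rw [ih]
      simp only [flip, ofLex_toLex]
      exact if_congr (by cases s <;> simp) rfl rfl
  · rw [List.pairwise_map]
    apply hs.imp_of_mem
    intro a b ha hb hab
    rw [Prod.Lex.le_iff] at hab ⊢
    rcases hab with hab | ⟨hab, _⟩
    · left; exact hab
    · right; refine ⟨hab, ?_⟩
      simp only [flip, ofLex_toLex]
      rw [hc a ha b hb hab]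

lemma alt_strict {n : ℕ} (s : Bool) (l : List (Lab n)) (h : Compat l) (hs : l.Pairwise (· ≤ ·))
    (ha : alt s l ≠ 0) : (l.map fun x => (ofLex x).1).Pairwise (· < ·) := by
  induction l generalizing s with
  | nil => simp
  | cons x l ih =>
    simp only [alt, ne_eq, ite_eq_right_iff, not_forall] at ha
    obtain ⟨hx, ha⟩ := ha
    have hc : Compat l := fun a ha b hb => h a (by simp [ha]) b (by simp [hb])
    have ih' := ih _ hc (List.pairwise_cons.1 hs).2 ha
    rcases l with _ | ⟨y, l⟩
    · simp
    · simp only [List.map_cons] at ih' ⊢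
      rw [List.pairwise_cons]
      refine ⟨?_, ih'⟩
      have hy : (ofLex x).1 < (ofLex y).1 := by
        have := (List.pairwise_cons.1 hs).1 y (by simp)
        rw [Prod.Lex.le_iff] at this
        rcases this with h1 | ⟨h1, _⟩
        · exact h1
        · exfalso
          have h2 := h x (by simp) y (by simp) h1
          simp only [alt, ite_eq_right_iff, not_forall] at ha
          obtain ⟨hy, _⟩ := ha
          rw [hx, hy] at h2
          cases s <;> simp at h2
      intro a ha'
      rcases List.mem_cons.1 ha' with rfl | ha'
      · exact hy
      · exact hy.trans ((List.pairwise_cons.1 ih').1 a ha')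

lemma A_top {n : ℕ} (s : Bool) (l : List (Lab n)) (h : Compat l) (hl : n < l.length) : A s l = 0 := by
  have hp := List.perm_insertionSort (· ≤ ·) l
  have hs := List.pairwise_insertionSort (· ≤ ·) l
  rw [← A_perm _ _ _ hp]
  have hc : Compat (l.insertionSort (· ≤ ·)) := fun x hx y hy => h x (hp.mem_iff.1 hx) y (hp.mem_iff.1 hy)
  have hlen := hp.length_eq
  generalize l.insertionSort (· ≤ ·) = m at *
  rw [A_sorted _ _ hs]
  by_contra hne
  have := alt_strict s m hc hs hne
  have hnd : (m.map fun x => (ofLex x).1).Nodup := this.imp (fun h => ne_of_lt h)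
  have := hnd.length_le_card
  simp at this
  omega

/-! subdivision -/

variable {V : Type*} [NormedAddCommGroup V] [NormedSpace ℝ V]

def bary (l : List V) : V := ((l.length : ℝ)⁻¹) • l.sum

def S : ℕ → (List V → ZMod 2) → List V → ZMod 2
  | 0, φ, l => φ l
  | k + 1, φ, l => cob (S k (fun m => φ (bary l :: m))) l

lemma S_add (k : ℕ) (φ ψ : List V → ZMod 2) (l : List V) :
    S k (fun m => φ m + ψ m) l = S k φ l + S k ψ l := by
  induction k generalizing φ ψ l with
  | zero => rfl
  | succ k ih =>
    simp only [S]
    rw [← cob_add]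
    congr 1
    funext m
    exact ih _ _ _

lemma S_cob (k : ℕ) (φ : List V → ZMod 2) (l : List V) (hl : l.length = k + 1) :
    S (k + 1) (cob φ) l = cob (S k φ) l := by
  induction k generalizing φ l with
  | zero =>
    simp only [S, cob]
    rw [cob_add]
    have : cob (fun m => cob (fun m => φ (bary l :: m)) m) l = 0 := cob_cob _ _
    rw [this, add_zero]
  | succ k ih =>
    rw [S]
    simp only [cob]
    have h1 : cob (S (k + 1) fun m => φ m + cob (fun m => φ (bary l :: m)) m) l =
        cob (fun m => S (k+1) φ m + S (k+1) (cob (fun m => φ (bary l :: m))) m) l := by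
      congr 1; funext m; exact S_add _ _ _ _
    rw [h1, cob_add]
    have h2 : cob (fun m => S (k+1) (cob (fun m => φ (bary l :: m))) m) l =
        cob (cob (S k (fun m => φ (bary l :: m)))) l := by
      apply cob_congr
      intro m _ hm
      exact ih _ _ (by omega)
    rw [h2, cob_cob, add_zero]

lemma bary_neg (l : List V) : bary (l.map (fun x => -x)) = - bary l := by
  unfold bary
  rw [List.length_map, ← smul_neg]
  congr 1
  induction l with
  | nil => simp
  | cons x l ih => simp [ih]; abel

lemma S_neg (k : ℕ) (φ : List V → ZMod 2) (l : List V) :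
    S k (fun m => φ (m.map fun x => -x)) l = S k φ (l.map fun x => -x) := by
  induction k generalizing φ l with
  | zero => rfl
  | succ k ih =>
    simp only [S, List.map_cons, bary_neg]
    rw [← cob_map]
    congr 1
    funext m
    exact ih (fun m => φ (-bary l :: m)) m

def T (φ : List V → ZMod 2) (l : List V) : ZMod 2 := S l.length φ l

lemma T_add (φ ψ : List V → ZMod 2) (l : List V) :
    T (fun m => φ m + ψ m) l = T φ l + T ψ l := S_add _ _ _ _

lemma T_neg (φ : List V → ZMod 2) (l : List V) :
    T (fun m => φ (m.map fun x => -x)) l = T φ (l.map fun x => -x) := by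
  unfold T; rw [S_neg, List.length_map]

lemma T_cob (φ : List V → ZMod 2) (l : List V) : T (cob φ) l = cob (T φ) l := by
  rcases hl : l.length with _ | k
  · rw [List.length_eq_zero_iff] at hl
    subst hl
    simp [T, S, cob]
  · unfold T
    rw [hl, S_cob k φ l hl]
    apply cob_congr
    intro m _ hm
    have : m.length = k := by omega
    rw [this]

lemma bary_mem (l : List V) (hl : l ≠ []) : bary l ∈ convexHull ℝ {x | x ∈ l} := by
  have hpos : (0 : ℝ) < l.length := by
    have := List.length_pos_iff.2 hl
    exact_mod_cast this
  have h : bary l = ∑ i : Fin l.length, ((l.length : ℝ)⁻¹) • l.get i := by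
    unfold bary
    rw [← Finset.smul_sum]
    congr 1
    rw [← List.sum_ofFn, List.ofFn_get]
  rw [h]
  apply (convex_convexHull ℝ _).sum_mem
  · intro i _; positivity
  · simp; field_simp
  · intro i _
    exact subset_convexHull ℝ _ (List.get_mem l i)

lemma bary_dist (l : List V) (k : ℕ) (hl : l.length = k + 1) (d : ℝ)
    (hd : ∀ x ∈ l, ∀ y ∈ l, dist x y ≤ d) (y : V) (hy : y ∈ convexHull ℝ {x | x ∈ l}) :
    dist y (bary l) ≤ k / (k + 1 : ℝ) * d := by
  have hsub : convexHull ℝ {x | x ∈ l} ⊆ Metric.closedBall (bary l) (k / (k + 1 : ℝ) * d) := by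
    apply convexHull_min _ (convex_closedBall _ _)
    intro v hv
    simp only [Set.mem_ofPred_eq] at hv
    rw [Metric.mem_closedBall, dist_eq_norm]
    have e : v - bary l = ((k + 1 : ℝ)⁻¹) • (l.map fun w => v - w).sum := by
      have h2 : (l.map fun w => v - w).sum = (l.length : ℝ) • v - l.sum := by
        clear hd hv hl hy
        induction l with
        | nil => simp
        | cons x l ih =>
          simp only [List.map_cons, List.sum_cons, ih, List.length_cons]
          push_cast
          rw [add_smul, one_smul]; abel
      rw [h2, smul_sub, smul_smul, hl]
      unfold bary
      rw [hl]
      push_cast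
      rw [inv_mul_cancel₀ (by positivity), one_smul]
    have h3 : ‖(l.map fun w => v - w).sum‖ ≤ k * d := by
      obtain ⟨l1, l2, rfl⟩ := List.append_of_mem hv
      have hb : ∀ m : List V, (∀ w ∈ m, dist v w ≤ d) →
          ‖(m.map fun w => v - w).sum‖ ≤ m.length * d := by
        intro m hm
        induction m with
        | nil => simp
        | cons x m ih =>
          simp only [List.map_cons, List.sum_cons, List.length_cons]
          push_cast
          have h1 := hm x (by simp)
          rw [dist_eq_norm] at h1
          have h2 := ih (fun w hw => hm w (by simp [hw]))
          have h3 := norm_add_le (v - x) (m.map fun w => v - w).sum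
          linarith
      have hb' := hb (l1 ++ l2) (fun w hw => hd v hv w (by
        simp only [List.mem_append, List.mem_cons] at hw ⊢; tauto))
      have e1 : (List.map (fun w => v - w) (l1 ++ v :: l2)).sum =
          (List.map (fun w => v - w) (l1 ++ l2)).sum := by simp
      rw [e1]
      have e2 : (l1 ++ l2).length = k := by simp at hl ⊢; omega
      rwa [e2] at hb'
    rw [e, norm_smul, norm_inv, Real.norm_of_nonneg (by positivity)]
    rw [div_mul_eq_mul_div, inv_mul_eq_div]
    gcongr
  exact hsub hy

def Near (l : List V) (d : ℝ) (m : List V) : Prop :=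
  (∀ x ∈ m, x ∈ convexHull ℝ {x | x ∈ l}) ∧ ∀ x ∈ m, ∀ y ∈ m, dist x y ≤ d

lemma S_congr (n : ℕ) (k : ℕ) (hk : k ≤ n + 1) (φ ψ : List V → ZMod 2) (l : List V) (hl : l.length = k)
    (d : ℝ) (hd0 : 0 ≤ d)
    (hd : ∀ x ∈ l, ∀ y ∈ l, dist x y ≤ d)
    (h : ∀ m, m.length = k → Near l (n / (n + 1 : ℝ) * d) m → φ m = ψ m) : S k φ l = S k ψ l := by
  induction k generalizing φ ψ l with
  | zero =>
    rw [List.length_eq_zero_iff] at hl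
    subst hl
    exact h [] rfl ⟨by simp, by simp⟩
  | succ k ih =>
    simp only [S]
    apply cob_congr
    intro m hm hml
    apply ih (by omega) _ _ _ (by omega)
    · intro x hx y hy; exact hd x (hm.subset hx) y (hm.subset hy)
    · intro m' hm' hN
      apply h
      · simp [hm']
      have hne : l ≠ [] := by rintro rfl; simp at hl
      have hsub : ∀ x ∈ m', x ∈ convexHull ℝ {x | x ∈ l} := fun x hx =>
        convexHull_mono (fun y hy => hm.subset hy) (hN.1 x hx)
      have hkn : (k : ℝ) / (k + 1) * d ≤ n / (n + 1 : ℝ) * d := by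
        apply mul_le_mul_of_nonneg_right _ hd0
        have : (k : ℝ) ≤ n := by exact_mod_cast (by omega : k ≤ n)
        rw [div_le_div_iff₀ (by positivity) (by positivity)]
        nlinarith
      have hb : ∀ x ∈ m', dist x (bary l) ≤ n / (n + 1 : ℝ) * d := fun x hx =>
        (bary_dist l k hl d hd x (hsub x hx)).trans hkn
      refine ⟨?_, ?_⟩
      · intro x hx
        rcases List.mem_cons.1 hx with rfl | hx
        · exact bary_mem l hne
        · exact hsub x hx
      · intro x hx y hy
        rcases List.mem_cons.1 hx with rfl | hx <;> rcases List.mem_cons.1 hy with rfl | hy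
        · rw [dist_self]; positivity
        · rw [dist_comm]; exact hb _ hy
        · exact hb _ hx
        · exact hN.2 x hx y hy

lemma T_iter_congr (n N : ℕ) (φ ψ : List V → ZMod 2) (l : List V) (hl : l.length ≤ n + 1)
    (d : ℝ) (hd0 : 0 ≤ d) (hd : ∀ x ∈ l, ∀ y ∈ l, dist x y ≤ d)
    (h : ∀ m, m.length = l.length → Near l ((n / (n + 1 : ℝ)) ^ N * d) m → φ m = ψ m) :
    (T^[N]) φ l = (T^[N]) ψ l := by
  induction N generalizing l d with
  | zero =>
    simp only [Function.iterate_zero, id]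
    apply h l rfl
    exact ⟨fun x hx => subset_convexHull ℝ _ hx, by simpa using hd⟩
  | succ N ih =>
    rw [Function.iterate_succ_apply', Function.iterate_succ_apply']
    unfold T
    apply S_congr n _ hl _ _ _ rfl d hd0 hd
    intro m hm hN
    apply ih m (by omega) (n / (n + 1 : ℝ) * d) (by positivity) hN.2
    intro m' hm' hN'
    apply h m' (by omega)
    refine ⟨fun x hx => ?_, ?_⟩
    · exact convexHull_min (fun y hy => hN.1 y hy) (convex_convexHull ℝ _) (hN'.1 x hx)
    · rw [pow_succ, mul_assoc]; exact hN'.2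

lemma Ti_add (N : ℕ) (φ ψ : List V → ZMod 2) (l : List V) :
    (T^[N]) (fun m => φ m + ψ m) l = (T^[N]) φ l + (T^[N]) ψ l := by
  induction N generalizing l with
  | zero => rfl
  | succ N ih =>
    simp only [Function.iterate_succ_apply']
    rw [← T_add]; congr 1; funext m; exact ih m

lemma Ti_neg (N : ℕ) (φ : List V → ZMod 2) (l : List V) :
    (T^[N]) (fun m => φ (m.map fun x => -x)) l = (T^[N]) φ (l.map fun x => -x) := by
  induction N generalizing l with
  | zero => rfl
  | succ N ih =>
    simp only [Function.iterate_succ_apply']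
    rw [← T_neg]; congr 1; funext m; exact ih m

lemma Ti_cob (N : ℕ) (φ : List V → ZMod 2) (l : List V) :
    (T^[N]) (cob φ) l = cob ((T^[N]) φ) l := by
  induction N generalizing l with
  | zero => rfl
  | succ N ih =>
    simp only [Function.iterate_succ_apply']
    rw [← T_cob]; congr 1; funext m; exact ih m

lemma Ti_nil (N : ℕ) (φ : List V → ZMod 2) : (T^[N]) φ [] = φ [] := by
  induction N with
  | zero => rfl
  | succ N ih => rw [Function.iterate_succ_apply']; simpa [T, S] using ih

/-! spheres -/

def Sph (e : ℕ → V) : ℕ → (List V → ZMod 2) → ZMod 2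
  | 0, φ => φ []
  | k + 1, φ => Sph e k (fun m => φ (e k :: m)) + Sph e k (fun m => φ (-e k :: m))

def IsFace (e : ℕ → V) (k : ℕ) (l : List V) : Prop :=
  l.length = k ∧ ∃ s : ℕ → ℝ, (∀ i, s i = 1 ∨ s i = -1) ∧ ∀ x ∈ l, ∃ i < k, x = s i • e i

lemma IsFace.cons (e : ℕ → V) (k : ℕ) (c : ℝ) (hc : c = 1 ∨ c = -1) (l : List V)
    (h : IsFace e k l) : IsFace e (k+1) (c • e k :: l) := by
  obtain ⟨hl, s, hs, hx⟩ := h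
  refine ⟨by simp [hl], Function.update s k c, ?_, ?_⟩
  · intro i
    by_cases hi : i = k
    · subst hi; simpa using hc
    · simpa [Function.update_of_ne hi] using hs i
  · intro x hxl
    rcases List.mem_cons.1 hxl with rfl | hxl
    · exact ⟨k, by omega, by simp⟩
    · obtain ⟨i, hi, rfl⟩ := hx x hxl
      exact ⟨i, by omega, by rw [Function.update_of_ne (by omega)]⟩

lemma Sph_congr (e : ℕ → V) (k : ℕ) (φ ψ : List V → ZMod 2)
    (h : ∀ l, IsFace e k l → φ l = ψ l) : Sph e k φ = Sph e k ψ := by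
  induction k generalizing φ ψ with
  | zero => exact h [] ⟨rfl, fun _ => 1, by simp, by simp⟩
  | succ k ih =>
    simp only [Sph]
    congr 1
    · apply ih; intro l hl; apply h; simpa using IsFace.cons e k 1 (by simp) l hl
    · apply ih; intro l hl; apply h; simpa using IsFace.cons e k (-1) (by simp) l hl

lemma Sph_add (e : ℕ → V) (k : ℕ) (φ ψ : List V → ZMod 2) :
    Sph e k (fun m => φ m + ψ m) = Sph e k φ + Sph e k ψ := by
  induction k generalizing φ ψ with
  | zero => rfl
  | succ k ih => simp only [Sph, ih]; ring

lemma Sph_neg (e : ℕ → V) (k : ℕ) (φ : List V → ZMod 2) :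
    Sph e k (fun m => φ (m.map fun x => -x)) = Sph e k φ := by
  induction k generalizing φ with
  | zero => rfl
  | succ k ih =>
    simp only [Sph, List.map_cons, neg_neg]
    rw [ih (fun m => φ (-e k :: m)), ih (fun m => φ (e k :: m))]; ring

lemma Sph_cob (e : ℕ → V) (k : ℕ) (φ : List V → ZMod 2) : Sph e k (cob φ) = 0 := by
  induction k generalizing φ with
  | zero => rfl
  | succ k ih =>
    simp only [Sph, cob, Sph_add, ih, add_zero]
    exact zadd _

lemma hemi_cob (e : ℕ → V) (k : ℕ) (φ : List V → ZMod 2) :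
    Sph e k (fun m => cob φ (e k :: m)) = Sph e k φ := by
  simp only [cob, Sph_add, Sph_cob, add_zero]

lemma Sph_succ (e : ℕ → V) (k : ℕ) (φ : List V → ZMod 2) :
    Sph e (k + 1) φ = Sph e k (fun m => φ (e k :: m) + φ ((e k :: m).map fun x => -x)) := by
  rw [Sph_add]
  simp only [Sph, List.map_cons]
  rw [Sph_neg e k (fun m => φ (-e k :: m))]

def bv (n : ℕ) (i : ℕ) : Fin (n + 1) → ℝ := if h : i < n + 1 then Pi.single ⟨i, h⟩ 1 else 0

lemma face_hull (n k : ℕ) (hk : k ≤ n + 1) (l : List (Fin (n + 1) → ℝ)) (h : IsFace (bv n) k l)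
    (x : Fin (n + 1) → ℝ) (hx : x ∈ convexHull ℝ {x | x ∈ l}) : ∑ i, |x i| = 1 := by
  obtain ⟨hl, s, hs, hx'⟩ := h
  have hsq : ∀ i, s i * s i = 1 := by intro i; rcases hs i with h | h <;> rw [h] <;> norm_num
  have hsub : convexHull ℝ {x | x ∈ l} ⊆ {x : Fin (n + 1) → ℝ |
      (∀ i : Fin (n + 1), 0 ≤ s i * x i) ∧ ∑ i : Fin (n + 1), s i * x i = 1} := by
    apply convexHull_min
    · intro y hy
      obtain ⟨i, hi, rfl⟩ := hx' y hy
      have hi' : i < n + 1 := by omega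
      refine ⟨fun j => ?_, ?_⟩
      · simp only [bv, hi', dif_pos, Pi.smul_apply, smul_eq_mul, Pi.single_apply]
        split_ifs with hj
        · subst hj; simp [hsq]
        · simp
      · simp only [bv, hi', dif_pos, Pi.smul_apply, smul_eq_mul, Pi.single_apply]
        rw [Finset.sum_eq_single (⟨i, hi'⟩ : Fin (n+1))]
        · simp [hsq]
        · intro b _ hb; simp [hb]
        · simp
    · rintro y ⟨hy1, hy2⟩ z ⟨hz1, hz2⟩ a b ha hb hab
      refine ⟨fun i => ?_, ?_⟩
      · have h1 := mul_nonneg ha (hy1 i)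
        have h2 := mul_nonneg hb (hz1 i)
        simp only [Pi.add_apply, Pi.smul_apply, smul_eq_mul]
        nlinarith
      · have : ∑ i : Fin (n+1), s i * (a • y + b • z) i =
            a * ∑ i : Fin (n+1), s i * y i + b * ∑ i : Fin (n+1), s i * z i := by
          rw [Finset.mul_sum, Finset.mul_sum, ← Finset.sum_add_distrib]
          apply Finset.sum_congr rfl
          intro i _
          simp only [Pi.add_apply, Pi.smul_apply, smul_eq_mul]; ring
        rw [this, hy2, hz2]; linarith
  obtain ⟨h1, h2⟩ := hsub hx
  rw [← h2]
  apply Finset.sum_congr rfl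
  intro i _
  rw [← abs_of_nonneg (h1 i), abs_mul]
  rcases hs i with h | h <;> rw [h] <;> simp

lemma norm_le_of_sum (n : ℕ) (x : Fin (n + 1) → ℝ) (hx : ∑ i, |x i| = 1) : ‖x‖ ≤ 1 := by
  rw [pi_norm_le_iff_of_nonneg (by norm_num)]
  intro i
  rw [← hx, Real.norm_eq_abs]
  exact Finset.single_le_sum (f := fun i => |x i|) (fun i _ => abs_nonneg _) (Finset.mem_univ i)

theorem borsuk_ulam (n : ℕ) (F : (Fin (n + 1) → ℝ) → (Fin n → ℝ)) (hc : Continuous F)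
    (hodd : ∀ x, F (-x) = - F x) : ∃ x : Fin (n + 1) → ℝ, ∑ i, |x i| = 1 ∧ F x = 0 := by
  by_contra hcon
  push Not at hcon
  set K : Set (Fin (n + 1) → ℝ) := {x | ∑ i, |x i| = 1} with hK
  have hKc : IsCompact K := by
    apply (isCompact_closedBall (0 : Fin (n + 1) → ℝ) 1).of_isClosed_subset
    · exact isClosed_eq (by fun_prop) continuous_const
    · intro x hx
      simpa using norm_le_of_sum n x hx
  have hKne : K.Nonempty := ⟨Pi.single 0 1, by
    simp only [hK, Set.mem_ofPred_eq]
    rw [Finset.sum_eq_single 0] <;> simp +contextual [Pi.single_apply]⟩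
  obtain ⟨x0, hx0, hmin⟩ := hKc.exists_isMinOn hKne (hc.norm.continuousOn)
  set η := ‖F x0‖ with hη
  have hηpos : 0 < η := norm_pos_iff.2 (hcon x0 hx0)
  have hex : ∀ x ∈ K, ∃ j, η ≤ |F x j| := by
    intro x hx
    by_contra hno
    push Not at hno
    have h1 : η ≤ ‖F x‖ := hmin hx
    have h2 : ‖F x‖ < η := by
      rw [pi_norm_lt_iff hηpos]
      intro j; exact hno j
    linarith
  obtain ⟨j0, -⟩ := hex x0 hx0
  have hU := hKc.uniformContinuousOn_of_continuous hc.continuousOn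
  rw [Metric.uniformContinuousOn_iff] at hU
  obtain ⟨δ, hδ, hU⟩ := hU η hηpos
  have hcn : (n / (n + 1 : ℝ)) < 1 := by rw [div_lt_one (by positivity)]; linarith
  obtain ⟨N, hN⟩ := exists_pow_lt_of_lt_one (show 0 < δ / 2 by positivity) hcn
  have hN2 : (n / (n + 1 : ℝ)) ^ N * 2 < δ := by linarith
  let jof : (Fin n → ℝ) → Fin n := fun v => if h : ∃ j, η ≤ v j then h.choose else j0
  let lab : (Fin (n + 1) → ℝ) → Lab n := fun x =>
    toLex (jof (fun j => |F x j|), decide (0 < F x (jof (fun j => |F x j|))))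
  have hjof : ∀ x ∈ K, η ≤ |F x (jof (fun j => |F x j|))| := by
    intro x hx
    have h := hex x hx
    simp only [jof]
    rw [dif_pos h]
    exact h.choose_spec
  have hflip : ∀ x ∈ K, lab (-x) = flip (lab x) := by
    intro x hx
    have e : (fun j => |F (-x) j|) = fun j => |F x j| := by
      funext j; rw [hodd]; simp
    simp only [lab, flip, ofLex_toLex, e]
    congr 2
    have h1 := hjof x hx
    rw [hodd]
    simp only [Pi.neg_apply]
    have ha : F x (jof fun j => |F x j|) ≠ 0 := by
      intro h0
      rw [h0] at h1; simp at h1; linarith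
    rcases lt_or_gt_of_ne ha with h | h
    · simp [h, h.le]
    · simp [h, h.le]
  have hcompat : ∀ k ≤ n + 1, ∀ l, IsFace (bv n) k l → ∀ m, Near l ((n / (n + 1 : ℝ)) ^ N * 2) m →
      (∀ x ∈ m, x ∈ K) ∧ Compat (m.map lab) := by
    intro k hk l hl m hm
    have hmK : ∀ x ∈ m, x ∈ K := fun x hx => face_hull n k hk l hl x (hm.1 x hx)
    refine ⟨hmK, ?_⟩
    intro a ha b hb hab
    obtain ⟨x, hx, rfl⟩ := List.mem_map.1 ha
    obtain ⟨y, hy, rfl⟩ := List.mem_map.1 hb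
    have h1 := hjof x (hmK x hx)
    have h2 := hjof y (hmK y hy)
    have h3 := hU x (hmK x hx) y (hmK y hy) (lt_of_le_of_lt (hm.2 x hx y hy) hN2)
    simp only [lab, ofLex_toLex] at hab ⊢
    rw [← hab] at h2 ⊢
    have h4 : |F x (jof fun j => |F x j|) - F y (jof fun j => |F x j|)| < η := by
      have := (dist_le_pi_dist (F x) (F y) (jof fun j => |F x j|)).trans_lt h3
      rwa [Real.dist_eq] at this
    rw [abs_lt] at h4
    rw [decide_eq_decide]
    constructor
    · intro h; rw [abs_of_pos h] at h1
      linarith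
    · intro h; rw [abs_of_pos h] at h2
      linarith
  have hfd : ∀ k ≤ n + 1, ∀ l, IsFace (bv n) k l → ∀ x ∈ l, ∀ y ∈ l, dist x y ≤ 2 := by
    intro k hk l hl x hx y hy
    have h1 := norm_le_of_sum n x (face_hull n k hk l hl x (subset_convexHull ℝ _ hx))
    have h2 := norm_le_of_sum n y (face_hull n k hk l hl y (subset_convexHull ℝ _ hy))
    rw [dist_eq_norm]
    linarith [norm_sub_le x y]
  let Φ : Bool → List (Fin (n + 1) → ℝ) → ZMod 2 := fun s l => A s (l.map lab)
  have hcobΦ : ∀ l, l ≠ [] → cob (Φ true) l = Φ true l + Φ false l := by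
    intro l hl
    simp only [Φ]
    rw [cob_map, cob_A _ _ (by simpa using hl)]
  have hcong : ∀ k ≤ n + 1, ∀ l, IsFace (bv n) k l → ∀ φ ψ : List (Fin (n + 1) → ℝ) → ZMod 2,
      (∀ m, m.length = k → (∀ x ∈ m, x ∈ K) → Compat (m.map lab) → φ m = ψ m) →
      (T^[N]) φ l = (T^[N]) ψ l := by
    intro k hk l hl φ ψ h
    apply T_iter_congr n N φ ψ l (by rw [hl.1]; exact hk) 2 (by norm_num) (hfd k hk l hl)
    intro m hm hN
    obtain ⟨h1, h2⟩ := hcompat k hk l hl m hN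
    exact h m (by rw [hm, hl.1]) h1 h2
  have hface : ∀ k l, IsFace (bv n) k l → IsFace (bv n) (k+1) (bv n k :: l) := by
    intro k l hl
    simpa using IsFace.cons (bv n) k 1 (by simp) l hl
  -- descending steps
  have hstep : ∀ k ≤ n, Sph (bv n) (k + 1) ((T^[N]) (Φ true)) = Sph (bv n) k ((T^[N]) (Φ true)) := by
    intro k hk
    rw [Sph_succ, ← hemi_cob (bv n) k ((T^[N]) (Φ true))]
    apply Sph_congr
    intro l hl
    rw [← Ti_neg, ← Ti_add, ← Ti_cob]
    apply hcong (k+1) (by omega) _ (hface k l hl)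
    intro m hm hmK hmc
    rw [hcobΦ m (by rintro rfl; simp at hm)]
    congr 1
    simp only [Φ]
    have : List.map lab (List.map (fun x => -x) m) = (m.map lab).map flip := by
      rw [List.map_map, List.map_map]
      apply List.map_congr_left
      intro x hx
      exact hflip x (hmK x hx)
    rw [this, A_flip _ _ hmc]
    rfl
  have hall : ∀ k ≤ n + 1, Sph (bv n) k ((T^[N]) (Φ true)) = 1 := by
    intro k
    induction k with
    | zero =>
      intro _
      simp only [Sph]
      rw [Ti_nil]
      simp [Φ, A, alt]
    | succ k ih =>
      intro hk
      rw [hstep k (by omega)]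
      exact ih (by omega)
  have hz : ∀ l, (T^[N]) (fun _ : List (Fin (n + 1) → ℝ) => (0 : ZMod 2)) l = 0 := by
    intro l
    have := Ti_add N (fun _ : List (Fin (n + 1) → ℝ) => (0 : ZMod 2)) (fun _ => 0) l
    simpa using this
  have hz2 : Sph (bv n) n (fun _ => (0 : ZMod 2)) = 0 := by
    have := Sph_add (bv n) n (fun _ => (0 : ZMod 2)) (fun _ => 0)
    simpa using this
  have h0 : Sph (bv n) n ((T^[N]) (Φ true)) = 0 := by
    rw [← hemi_cob, ← hz2]
    apply Sph_congr
    intro l hl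
    rw [← Ti_cob, ← hz (bv n n :: l)]
    apply hcong (n+1) le_rfl _ (hface n l hl)
    intro m hm hmK hmc
    rw [hcobΦ m (by rintro rfl; simp at hm)]
    simp only [Φ]
    rw [A_top _ _ hmc (by simp [hm]), A_top _ _ hmc (by simp [hm])]
    rfl
  rw [hall n (by omega)] at h0
  exact one_ne_zero h0

end BU

end Part1

section Part2
open Filter Topology

namespace PL

/-! ### Restriction of a polynomial to a line -/

/-- The one-variable polynomial `t ↦ f (a + t b)`. -/
def lp {d : ℕ} (f : MvPolynomial (Fin d) ℝ) (a b : Fin d → ℝ) : Polynomial ℝ :=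
  MvPolynomial.aeval (fun i => Polynomial.C (a i) + Polynomial.C (b i) * Polynomial.X) f

lemma lp_eval {d : ℕ} (f : MvPolynomial (Fin d) ℝ) (a b : Fin d → ℝ) (t : ℝ) :
    (lp f a b).eval t = MvPolynomial.eval (a + t • b) f := by
  unfold lp
  induction f using MvPolynomial.induction_on with
  | C r => simp
  | add p q hp hq => simp [hp, hq]
  | mul_X p i hp =>
    rw [map_mul, Polynomial.eval_mul, hp, map_mul]
    congr 1
    simp only [MvPolynomial.aeval_X, Polynomial.eval_add, Polynomial.eval_mul, Polynomial.eval_C,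
      Polynomial.eval_X, MvPolynomial.eval_X, Pi.add_apply, Pi.smul_apply, smul_eq_mul]
    ring

lemma lp_mul {d : ℕ} (f g : MvPolynomial (Fin d) ℝ) (a b : Fin d → ℝ) :
    lp (f * g) a b = lp f a b * lp g a b := by simp [lp]

lemma lp_add {d : ℕ} (f g : MvPolynomial (Fin d) ℝ) (a b : Fin d → ℝ) :
    lp (f + g) a b = lp f a b + lp g a b := by simp [lp]

lemma lp_natDegree {d : ℕ} (f : MvPolynomial (Fin d) ℝ) (a b : Fin d → ℝ) :
    (lp f a b).natDegree ≤ f.totalDegree := by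
  unfold lp
  rw [MvPolynomial.aeval_def, MvPolynomial.eval₂_eq]
  apply Polynomial.natDegree_sum_le_of_forall_le
  intro m hm
  refine (Polynomial.natDegree_mul_le).trans ?_
  have h1 : (algebraMap ℝ (Polynomial ℝ) (MvPolynomial.coeff m f)).natDegree = 0 := by
    rw [Polynomial.algebraMap_eq, Polynomial.natDegree_C]
  rw [h1, zero_add]
  refine (Polynomial.natDegree_prod_le _ _).trans ?_
  refine le_trans ?_ (MvPolynomial.le_totalDegree hm)
  rw [Finsupp.sum]
  apply Finset.sum_le_sum
  intro i _
  refine (Polynomial.natDegree_pow_le).trans ?_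
  have : (Polynomial.C (a i) + Polynomial.C (b i) * Polynomial.X).natDegree ≤ 1 := by
    compute_degree
  nlinarith

def mkLine {d : ℕ} (a b : Fin d → ℝ) : Set (Fin d → ℝ) := {x | ∃ t : ℝ, x = a + t • b}

lemma lp_eq_zero_iff {d : ℕ} (f : MvPolynomial (Fin d) ℝ) (a b : Fin d → ℝ) :
    lp f a b = 0 ↔ mkLine a b ⊆ zeroSet f := by
  constructor
  · rintro h _ ⟨t, rfl⟩
    simp only [zeroSet, Set.mem_ofPred_eq]
    rw [← lp_eval, h]; simp
  · intro h
    apply Polynomial.funext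
    intro t
    rw [lp_eval, Polynomial.eval_zero]
    exact h ⟨t, rfl⟩

/-! ### Ham sandwich -/

def clamp (x : ℝ) : ℝ := max (-1) (min 1 x)

lemma clamp_cont : Continuous clamp := by unfold clamp; fun_prop

lemma clamp_neg (x : ℝ) : clamp (-x) = - clamp x := by
  unfold clamp
  rcases le_total x 1 with h | h <;> rcases le_total (-1) x with h' | h' <;>
  simp [min_def, max_def] <;> split_ifs <;> linarith

lemma clamp_ge (x : ℝ) : -1 ≤ clamp x := le_max_left _ _

lemma clamp_one (x : ℝ) (h : 1 ≤ x) : clamp x = 1 := by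
  unfold clamp; rw [min_eq_left h, max_eq_right]; norm_num

lemma half_of_clamp {α : Type*} (S : Finset α) (g : ℕ → α → ℝ) (g0 : α → ℝ)
    (hlim : ∀ p ∈ S, Tendsto (fun n => g n p) atTop (𝓝 (g0 p))) (δ : ℕ → ℝ)
    (hδ0 : ∀ n, 0 < δ n) (hδ : Tendsto δ atTop (𝓝 0))
    (h0 : ∀ n, ∑ p ∈ S, clamp (g n p / δ n) = 0) :
    2 * (S.filter fun p => 0 < g0 p).card ≤ S.card := by
  have hev : ∀ᶠ n in atTop, ∀ p ∈ S.filter (fun p => 0 < g0 p), 1 ≤ g n p / δ n := by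
    rw [Filter.eventually_all_finset]
    intro p hp
    obtain ⟨hp, hpos⟩ := Finset.mem_filter.1 hp
    have h1 := (hlim p hp).sub hδ
    have h2 := h1.eventually (lt_mem_nhds (show (0:ℝ) < g0 p - 0 by simpa using hpos))
    filter_upwards [h2] with n hn
    rw [le_div_iff₀ (hδ0 n)]; linarith
  obtain ⟨n, hn⟩ := hev.exists
  have h := h0 n
  rw [← Finset.sum_filter_add_sum_filter_not S (fun p => 0 < g0 p)] at h
  have h1 : ∑ p ∈ S.filter (fun p => 0 < g0 p), clamp (g n p / δ n) =
      (S.filter (fun p => 0 < g0 p)).card := by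
    rw [Finset.sum_congr rfl (fun p hp => clamp_one _ (hn p hp))]; simp
  have h2 : -((S.filter (fun p => ¬ 0 < g0 p)).card : ℝ) ≤
      ∑ p ∈ S.filter (fun p => ¬ 0 < g0 p), clamp (g n p / δ n) := by
    have := Finset.card_nsmul_le_sum (S.filter (fun p => ¬ 0 < g0 p))
      (fun p => clamp (g n p / δ n)) (-1) (fun p _ => clamp_ge _)
    simpa using this
  have h3 := Finset.card_filter_add_card_filter_not (s := S) (fun p => 0 < g0 p)
  have h4 : ((S.filter (fun p => 0 < g0 p)).card : ℝ) ≤ (S.filter (fun p => ¬ 0 < g0 p)).card := by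
    linarith
  have h5 : (S.filter (fun p => 0 < g0 p)).card ≤ (S.filter (fun p => ¬ 0 < g0 p)).card := by
    exact_mod_cast h4
  omega

lemma ham_sandwich (d k e : ℕ) (hk : k < e ^ d) (S : Fin k → Finset (Fin d → ℝ)) :
    ∃ f : MvPolynomial (Fin d) ℝ, f ≠ 0 ∧ f.totalDegree ≤ d * e ∧ ∀ i,
      2 * ((S i).filter fun p => 0 < MvPolynomial.eval p f).card ≤ (S i).card ∧
      2 * ((S i).filter fun p => MvPolynomial.eval p f < 0).card ≤ (S i).card := by
  have hcard : Fintype.card (Fin (k + 1)) ≤ Fintype.card (Fin d → Fin e) := by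
    simp; omega
  obtain ⟨ι⟩ := Function.Embedding.nonempty_of_card_le hcard
  let m : Fin (k + 1) → (Fin d →₀ ℕ) := fun j => Finsupp.equivFunOnFinite.symm (fun i => (ι j i : ℕ))
  have hm : Function.Injective m := by
    intro j j' h
    apply ι.injective
    funext i
    have := DFunLike.congr_fun h i
    simp only [m, Finsupp.equivFunOnFinite_symm_apply_apply] at this
    exact Fin.ext this
  let φ : (Fin (k + 1) → ℝ) → MvPolynomial (Fin d) ℝ := fun x =>
    ∑ j, MvPolynomial.monomial (m j) (x j)
  have hφcoeff : ∀ x j, MvPolynomial.coeff (m j) (φ x) = x j := by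
    intro x j
    simp only [φ, MvPolynomial.coeff_sum, MvPolynomial.coeff_monomial]
    rw [Finset.sum_eq_single j]
    · simp
    · intro b _ hb; rw [if_neg]; intro h; exact hb (hm h)
    · simp
  have hφdeg : ∀ x, (φ x).totalDegree ≤ d * e := by
    intro x
    apply MvPolynomial.totalDegree_finsetSum_le
    intro j _
    refine (MvPolynomial.totalDegree_monomial_le _ _).trans ?_
    rw [Finsupp.sum_fintype _ _ (by simp)]
    calc ∑ i, (m j) i ≤ ∑ i : Fin d, e := by
          apply Finset.sum_le_sum; intro i _
          simp only [m, Finsupp.equivFunOnFinite_symm_apply_apply]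
          exact (ι j i).2.le
      _ = d * e := by simp
  have hφeval : ∀ x p, MvPolynomial.eval p (φ x) = ∑ j, x j * MvPolynomial.eval p (MvPolynomial.monomial (m j) 1) := by
    intro x p
    simp [φ, MvPolynomial.eval_monomial]
  have hφcont : ∀ p, Continuous fun x => MvPolynomial.eval p (φ x) := by
    intro p; simp only [hφeval]; fun_prop
  have hφodd : ∀ x p, MvPolynomial.eval p (φ (-x)) = - MvPolynomial.eval p (φ x) := by
    intro x p; simp [hφeval]
  let δ : ℕ → ℝ := fun n => 1 / ((n : ℝ) + 1)
  have hδ0 : ∀ n, 0 < δ n := by intro n; positivity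
  have hδ : Tendsto δ atTop (𝓝 0) := tendsto_one_div_add_atTop_nhds_zero_nat
  have hbu : ∀ n, ∃ x : Fin (k + 1) → ℝ, ∑ i, |x i| = 1 ∧
      ∀ i, ∑ p ∈ S i, clamp (MvPolynomial.eval p (φ x) / δ n) = 0 := by
    intro n
    obtain ⟨x, hx, h⟩ := BU.borsuk_ulam k
      (fun x i => ∑ p ∈ S i, clamp (MvPolynomial.eval p (φ x) / δ n))
      (by
        apply continuous_pi; intro i
        apply continuous_finsetSum; intro p _
        exact clamp_cont.comp ((hφcont p).div_const _))
      (by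
        intro x; funext i
        simp only [Pi.neg_apply, hφodd, neg_div, clamp_neg, Finset.sum_neg_distrib])
    exact ⟨x, hx, fun i => congrFun h i⟩
  choose x hx hx0 using hbu
  have hKc : IsCompact {x : Fin (k + 1) → ℝ | ∑ i, |x i| = 1} := by
    apply (isCompact_closedBall (0 : Fin (k + 1) → ℝ) 1).of_isClosed_subset
    · exact isClosed_eq (by fun_prop) continuous_const
    · intro x hx
      simpa using BU.norm_le_of_sum k x hx
  obtain ⟨y, hy, s, hs, hlim⟩ := hKc.tendsto_subseq hx
  refine ⟨φ y, ?_, hφdeg y, ?_⟩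
  · intro h0
    have : y = 0 := by
      funext j; rw [← hφcoeff y j, h0]; simp
    rw [this] at hy; simp at hy
  · intro i
    have hl : ∀ p, Tendsto (fun n => MvPolynomial.eval p (φ (x (s n)))) atTop
        (𝓝 (MvPolynomial.eval p (φ y))) := fun p => ((hφcont p).tendsto y).comp hlim
    constructor
    · exact half_of_clamp (S i) _ _ (fun p _ => hl p) (fun n => δ (s n)) (fun n => hδ0 _)
        (hδ.comp hs.tendsto_atTop) (fun n => hx0 (s n) i)
    · have := half_of_clamp (S i) _ _ (fun p _ => (hl p).neg) (fun n => δ (s n)) (fun n => hδ0 _)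
        (hδ.comp hs.tendsto_atTop) (fun n => by
          simp only [neg_div, clamp_neg, Finset.sum_neg_distrib, hx0 (s n) i, neg_zero])
      simpa using this

end PL

end Part2

section Part3
open Filter Topology

namespace PL

def sg : Bool → ℝ → Prop
  | true, x => 0 < x
  | false, x => x < 0

lemma part_seq (d : ℕ) (hd : 0 < d) (P : Finset (Fin d → ℝ)) (j : ℕ) :
    ∃ fs : Fin j → MvPolynomial (Fin d) ℝ, (∀ i, fs i ≠ 0) ∧
      (∑ i, (fs i).totalDegree ≤ ∑ i ∈ Finset.range j, d * 2 ^ (i / d + 1)) ∧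
      ∀ σ : Fin j → Bool,
        2 ^ j * (P.filter fun p => ∀ i, sg (σ i) (MvPolynomial.eval p (fs i))).card ≤ P.card := by
  induction j with
  | zero => exact ⟨fun i => i.elim0, fun i => i.elim0, by simp, fun σ => by simp⟩
  | succ j ih =>
    obtain ⟨fs, h1, h2, h3⟩ := ih
    let E : (Fin j → Bool) ≃ Fin (2 ^ j) := Fintype.equivFinOfCardEq (by simp)
    obtain ⟨f, hf0, hfd, hf⟩ := ham_sandwich d (2 ^ j) (2 ^ (j / d + 1)) (by
        rw [← pow_mul]
        apply Nat.pow_lt_pow_right (by norm_num)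
        have := Nat.lt_div_mul_add (a := j) hd
        rw [add_mul]; omega)
      (fun x => P.filter fun p => ∀ i, sg (E.symm x i) (MvPolynomial.eval p (fs i)))
    refine ⟨Fin.snoc fs f, ?_, ?_, ?_⟩
    · intro i
      refine Fin.lastCases ?_ (fun i => ?_) i
      · simpa using hf0
      · simpa using h1 i
    · rw [Fin.sum_univ_castSucc, Finset.sum_range_succ]
      simp only [Fin.snoc_castSucc, Fin.snoc_last]
      exact add_le_add h2 hfd
    · intro σ
      have hh := hf (E (Fin.init σ))
      simp only [Equiv.symm_apply_apply, Finset.filter_filter] at hh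
      have h3' := h3 (Fin.init σ)
      have key : 2 * (P.filter fun p => ∀ i, sg (σ i) (MvPolynomial.eval p
          ((Fin.snoc fs f : Fin (j + 1) → MvPolynomial (Fin d) ℝ) i))).card ≤
          (P.filter fun p => ∀ i, sg (Fin.init σ i) (MvPolynomial.eval p (fs i))).card := by
        cases hσ : σ (Fin.last j) with
        | true =>
          refine le_trans (Nat.mul_le_mul_left 2 (Finset.card_le_card ?_)) hh.1
          intro p hp
          rw [Finset.mem_filter] at hp ⊢
          refine ⟨hp.1, fun i => ?_, ?_⟩
          · simpa [Fin.init] using hp.2 i.castSucc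
          · have := hp.2 (Fin.last j)
            rw [hσ] at this
            simpa [sg] using this
        | false =>
          refine le_trans (Nat.mul_le_mul_left 2 (Finset.card_le_card ?_)) hh.2
          intro p hp
          rw [Finset.mem_filter] at hp ⊢
          refine ⟨hp.1, fun i => ?_, ?_⟩
          · simpa [Fin.init] using hp.2 i.castSucc
          · have := hp.2 (Fin.last j)
            rw [hσ] at this
            simpa [sg] using this
      calc 2 ^ (j + 1) * _ = 2 ^ j * (2 * _) := by rw [pow_succ, mul_assoc]
        _ ≤ 2 ^ j * _ := Nat.mul_le_mul_left _ key
        _ ≤ P.card := h3'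

lemma deg_sum (d : ℕ) (hd : 0 < d) (t : ℕ) :
    ∑ i ∈ Finset.range (d * t), d * 2 ^ (i / d + 1) ≤ 2 * d ^ 2 * 2 ^ t := by
  have : ∑ i ∈ Finset.range (d * t), d * 2 ^ (i / d + 1) + 2 * d ^ 2 = 2 * d ^ 2 * 2 ^ t := by
    induction t with
    | zero => simp
    | succ t ih =>
      rw [Nat.mul_succ, Finset.sum_range_add]
      have : ∀ x ∈ Finset.range d, d * 2 ^ ((d * t + x) / d + 1) = d * 2 ^ (t + 1) := by
        intro x hx
        rw [Nat.mul_add_div hd, Nat.div_eq_of_lt (Finset.mem_range.1 hx), add_zero]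
      rw [Finset.sum_congr rfl this]
      simp only [Finset.sum_const, Finset.card_range, smul_eq_mul]
      rw [pow_succ 2 t]
      linear_combination ih
  omega

/-- sign constancy on an interval without roots -/
lemma sign_const (h : Polynomial ℝ) (t t' : ℝ) (htt : t ≤ t')
    (hno : ∀ x ∈ Set.Icc t t', h.eval x ≠ 0) : 0 < h.eval t ↔ 0 < h.eval t' := by
  have hc : ContinuousOn (fun x => h.eval x) (Set.Icc t t') := h.continuous.continuousOn
  have hl := hno t (Set.left_mem_Icc.2 htt)
  have hr := hno t' (Set.right_mem_Icc.2 htt)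
  constructor
  · intro h0
    by_contra hn
    have : (0 : ℝ) ∈ Set.Icc (h.eval t') (h.eval t) := ⟨not_lt.1 hn, h0.le⟩
    obtain ⟨x, hx, hx0⟩ := intermediate_value_Icc' htt hc this
    exact hno x hx hx0
  · intro h0
    by_contra hn
    have : (0 : ℝ) ∈ Set.Icc (h.eval t) (h.eval t') := ⟨not_lt.1 hn, h0.le⟩
    obtain ⟨x, hx, hx0⟩ := intermediate_value_Icc htt hc this
    exact hno x hx hx0

theorem partition (d : ℕ) (hd : 0 < d) (t : ℕ) (P : Finset (Fin d → ℝ)) :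
    ∃ f : MvPolynomial (Fin d) ℝ, f ≠ 0 ∧ f.totalDegree ≤ 2 * d ^ 2 * 2 ^ t ∧
      ∃ cell : (Fin d → ℝ) → (Fin (d * t) → Bool),
        (∀ σ, 2 ^ (d * t) * (P.filter fun p => p ∉ zeroSet f ∧ cell p = σ).card ≤ P.card) ∧
        ∀ ℓ, IsLine ℓ →
          (Finset.univ.filter fun σ => ∃ p ∈ ℓ, p ∉ zeroSet f ∧ cell p = σ).card ≤
            2 * d ^ 2 * 2 ^ t + 1 := by
  obtain ⟨fs, h1, h2, h3⟩ := part_seq d hd P (d * t)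
  have hdeg : (∏ i, fs i).totalDegree ≤ 2 * d ^ 2 * 2 ^ t :=
    (MvPolynomial.totalDegree_finsetProd _ _).trans (h2.trans (deg_sum d hd t))
  have hz : ∀ p, p ∉ zeroSet (∏ i, fs i) → ∀ i, MvPolynomial.eval p (fs i) ≠ 0 := by
    intro p hp i h0
    apply hp
    simp only [zeroSet, Set.mem_ofPred_eq, map_prod]
    exact Finset.prod_eq_zero (Finset.mem_univ i) h0
  refine ⟨∏ i, fs i, Finset.prod_ne_zero_iff.2 (fun i _ => h1 i), hdeg,
    fun p i => decide (0 < MvPolynomial.eval p (fs i)), ?_, ?_⟩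
  · intro σ
    refine le_trans (Nat.mul_le_mul_left _ (Finset.card_le_card ?_)) (h3 σ)
    intro p hp
    rw [Finset.mem_filter] at hp ⊢
    obtain ⟨hp, hp1, hp2⟩ := hp
    refine ⟨hp, fun i => ?_⟩
    rw [← hp2]
    have h0 := hz p hp1 i
    rcases lt_or_gt_of_ne h0 with h | h
    · have : decide (0 < MvPolynomial.eval p (fs i)) = false := by simpa using h.le
      beta_reduce; rw [this]; exact h
    · have : decide (0 < MvPolynomial.eval p (fs i)) = true := by simpa using h
      beta_reduce; rw [this]; exact h
  · rintro ℓ ⟨a, b, hb, rfl⟩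
    set g := ∏ i, fs i with hg
    set G := lp g a b with hG
    by_cases hG0 : G = 0
    · have hsub := (lp_eq_zero_iff g a b).1 hG0
      rw [Finset.filter_false_of_mem]
      · simp
      · rintro σ - ⟨p, hp, hp1, -⟩
        exact hp1 (hsub hp)
    have hchoice : ∀ σ : Fin (d * t) → Bool, ∃ s : ℝ,
        (∃ p ∈ {x | ∃ t : ℝ, x = a + t • b}, p ∉ zeroSet g ∧
          (fun i => decide (0 < MvPolynomial.eval p (fs i))) = σ) →
        a + s • b ∉ zeroSet g ∧
          (fun i => decide (0 < MvPolynomial.eval (a + s • b) (fs i))) = σ := by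
      intro σ
      by_cases h : ∃ p ∈ {x | ∃ t : ℝ, x = a + t • b}, p ∉ zeroSet g ∧
          (fun i => decide (0 < MvPolynomial.eval p (fs i))) = σ
      · obtain ⟨_, ⟨s, rfl⟩, hp⟩ := h
        exact ⟨s, fun _ => hp⟩
      · exact ⟨0, fun h' => (h h').elim⟩
    choose s hs using hchoice
    let cnt : (Fin (d * t) → Bool) → ℕ := fun σ => (G.roots.toFinset.filter fun x => x < s σ).card
    have hmono : ∀ σ τ, s σ ≤ s τ →
        a + s σ • b ∉ zeroSet g → a + s τ • b ∉ zeroSet g → cnt σ = cnt τ →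
        ∀ i, 0 < MvPolynomial.eval (a + s σ • b) (fs i) ↔
             0 < MvPolynomial.eval (a + s τ • b) (fs i) := by
      intro σ τ hle hσ hτ hc i
      have hsubset : (G.roots.toFinset.filter fun x => x < s σ) ⊆
          (G.roots.toFinset.filter fun x => x < s τ) := by
        intro x hx
        rw [Finset.mem_filter] at hx ⊢
        exact ⟨hx.1, hx.2.trans_le hle⟩
      have heq := Finset.eq_of_subset_of_card_le hsubset hc.ge
      rw [← lp_eval, ← lp_eval]
      apply sign_const _ _ _ hle
      intro x hx hx0
      rw [lp_eval] at hx0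
      have hGx : G.eval x = 0 := by
        rw [hG, lp_eval]
        by_contra hne
        exact hz (a + x • b) hne i hx0
      have hxτ : x < s τ := by
        rcases lt_or_eq_of_le hx.2 with h | h
        · exact h
        · exfalso; apply hτ; rw [← h, zeroSet, Set.mem_ofPred_eq, ← lp_eval]; exact hGx
      have : x ∈ (G.roots.toFinset.filter fun x => x < s σ) := by
        rw [heq, Finset.mem_filter, Multiset.mem_toFinset, Polynomial.mem_roots hG0]
        exact ⟨hGx, hxτ⟩
      have := (Finset.mem_filter.1 this).2
      linarith [hx.1]
    have hcard : (Finset.range (G.natDegree + 1)).card ≤ 2 * d ^ 2 * 2 ^ t + 1 := by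
      rw [Finset.card_range]
      have := lp_natDegree g a b
      rw [← hG] at this
      omega
    refine le_trans (Finset.card_le_card_of_injOn cnt ?_ ?_) hcard
    · intro σ _
      rw [Finset.mem_coe, Finset.mem_range]
      have h4 : cnt σ ≤ G.roots.toFinset.card := Finset.card_filter_le _ _
      have h5 := Multiset.toFinset_card_le G.roots
      have h6 := G.card_roots'
      omega
    · intro σ hσ τ hτ hc
      have hσ' := hs σ (Finset.mem_filter.1 hσ).2
      have hτ' := hs τ (Finset.mem_filter.1 hτ).2
      rw [← hσ'.2, ← hτ'.2]
      funext i
      rw [decide_eq_decide]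
      rcases le_total (s σ) (s τ) with h | h
      · exact hmono σ τ h hσ'.1 hτ'.1 hc i
      · exact (hmono τ σ h hτ'.1 hσ'.1 hc.symm i).symm

end PL

end Part3

section Part4
open Filter Topology

namespace PL

lemma choose_t (d : ℕ) (hd : 2 ≤ d) (β : ℝ) (hβ : (d : ℝ) < (d - 1) * β) (c : ℝ) (hc : 0 < c) :
    ∃ t : ℕ, c < ((2 : ℝ) ^ t) ^ (d - 1) ∧
      2 * ((2 : ℝ) ^ (d * t)) * (c / ((2 : ℝ) ^ t) ^ (d - 1)) ^ β ≤ 1 / 2 := by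
  have hd1 : ((d - 1 : ℕ) : ℝ) = (d : ℝ) - 1 := by rw [Nat.cast_sub (by omega)]; simp
  have e1 : ∀ t : ℕ, 2 * ((2 : ℝ) ^ (d * t)) * (c / ((2 : ℝ) ^ t) ^ (d - 1)) ^ β =
      2 * c ^ β * ((2 : ℝ) ^ ((d : ℝ) - (d - 1) * β)) ^ t := by
    intro t
    rw [Real.div_rpow hc.le (by positivity), ← pow_mul, ← Real.rpow_natCast 2 (d * t),
      ← Real.rpow_natCast 2 (t * (d - 1)), ← Real.rpow_mul (by norm_num),
      ← Real.rpow_natCast _ t, ← Real.rpow_mul (by norm_num), div_eq_mul_inv,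
      ← Real.rpow_neg (by norm_num)]
    push_cast
    rw [hd1]
    have : ((d : ℝ) - (d - 1) * β) * t = d * t + -(t * (d - 1) * β) := by ring
    rw [this, Real.rpow_add (by norm_num)]
    ring
  have h1 : Tendsto (fun t : ℕ => 2 * c ^ β * ((2 : ℝ) ^ ((d : ℝ) - (d - 1) * β)) ^ t) atTop (𝓝 (2 * c ^ β * 0)) := by
    apply Tendsto.const_mul
    apply tendsto_pow_atTop_nhds_zero_of_lt_one (by positivity)
    apply Real.rpow_lt_one_of_one_lt_of_neg (by norm_num)
    linarith
  rw [mul_zero] at h1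
  have h2 := h1.eventually (gt_mem_nhds (show (0 : ℝ) < 1 / 2 by norm_num))
  have h3 := (tendsto_pow_atTop_atTop_of_one_lt (show (1 : ℝ) < 2 by norm_num)).eventually_gt_atTop c
  obtain ⟨t, ht2, ht3⟩ := (h2.and h3).exists
  refine ⟨t, ?_, ?_⟩
  · refine lt_of_lt_of_le ht3 (le_self_pow₀ (one_le_pow₀ (by norm_num)) (by omega))
  · rw [e1]; exact ht2.le

theorem recursion (d : ℕ) (hd : 2 ≤ d) (β : ℝ) (hβ : (d : ℝ) < (d - 1) * β) :
    ∃ D : ℕ, ∀ M : ℝ, 0 ≤ M → ∃ C : ℝ, 0 ≤ C ∧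
      ∀ (L0 : Finset (Set (Fin d → ℝ))), (∀ ℓ ∈ L0, IsLine ℓ) →
      ∀ (U : Finset (Set (Fin d → ℝ)) → (Fin d → ℝ) → Prop) (B : ℝ), 0 ≤ B →
      (∀ L p, U L p → L.Nonempty) →
      (∀ L ⊆ L0, ∀ f : MvPolynomial (Fin d) ℝ, f ≠ 0 → f.totalDegree ≤ D →
        ∀ P : Finset (Fin d → ℝ), (∀ p ∈ P, U L p ∧ p ∈ zeroSet f) →
          (P.card : ℝ) ≤ M * (L.card : ℝ) ^ β * B) →
      (∀ L ⊆ L0, ∀ L' ⊆ L, ∀ P : Finset (Fin d → ℝ),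
        (∀ p ∈ P, U L p ∧ (∀ ℓ ∈ L, p ∈ ℓ → ℓ ∈ L') ∧ ¬ U L' p) →
          (P.card : ℝ) ≤ M * (L.card : ℝ) ^ β * B) →
      ∀ L ⊆ L0, ∀ P : Finset (Fin d → ℝ), (∀ p ∈ P, U L p) →
        (P.card : ℝ) ≤ C * (L.card : ℝ) ^ β * B := by
  have hd0 : 0 < d := by omega
  have hβ0 : 0 < β := by
    have h2 : (2 : ℝ) ≤ d := by exact_mod_cast hd
    by_contra h
    nlinarith
  obtain ⟨t, ht1, ht2⟩ := choose_t d hd β hβ (12 * (d : ℝ) ^ 2) (by positivity)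
  set T : ℝ := (2 : ℝ) ^ t with hT
  refine ⟨2 * d ^ 2 * 2 ^ t, fun M hM => ⟨4 * M + 4 * 2 ^ (d * t) * M, by positivity, ?_⟩⟩
  set C : ℝ := 4 * M + 4 * 2 ^ (d * t) * M with hC
  have hC0 : 0 ≤ C := by positivity
  intro L0 hL0 U B hB H0 H1 H2 L
  induction hn : L.card using Nat.strong_induction_on generalizing L with
  | _ n ih =>
  intro hL P hP
  rcases P.eq_empty_or_nonempty with rfl | ⟨p0, hp0⟩
  · simp; positivity
  have hLne : L.Nonempty := H0 L p0 (hP p0 hp0)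
  have hn1 : 1 ≤ n := by rw [← hn]; exact hLne.card_pos
  obtain ⟨f, hf0, hfd, cell, hcell, hline⟩ := partition d hd0 t P
  let Lσ : (Fin (d * t) → Bool) → Finset (Set (Fin d → ℝ)) := fun σ =>
    L.filter fun ℓ => ∃ p ∈ ℓ, p ∉ zeroSet f ∧ cell p = σ
  let Pσ : (Fin (d * t) → Bool) → Finset (Fin d → ℝ) := fun σ =>
    P.filter fun p => p ∉ zeroSet f ∧ cell p = σ
  have hsum : ∑ σ, (Lσ σ).card ≤ n * (2 * d ^ 2 * 2 ^ t + 1) := by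
    have : ∑ σ, (Lσ σ).card = ∑ ℓ ∈ L, (Finset.univ.filter fun σ => ∃ p ∈ ℓ, p ∉ zeroSet f ∧ cell p = σ).card := by
      simp only [Lσ, Finset.card_filter]
      exact Finset.sum_comm
    rw [this, ← hn]
    have := Finset.sum_le_card_nsmul L _ (2 * d ^ 2 * 2 ^ t + 1) (fun ℓ hℓ => hline ℓ (hL0 ℓ (hL hℓ)))
    simpa using this
  let good : Finset (Fin (d * t) → Bool) := Finset.univ.filter fun σ =>
    ((2 ^ t) ^ (d - 1)) * (Lσ σ).card ≤ 12 * d ^ 2 * n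
  let bad : Finset (Fin (d * t) → Bool) := Finset.univ.filter fun σ =>
    ¬ ((2 ^ t) ^ (d - 1)) * (Lσ σ).card ≤ 12 * d ^ 2 * n
  have hTd : ((2 ^ t) ^ (d - 1)) * 2 ^ t = 2 ^ (d * t) := by
    rw [← pow_succ, ← pow_mul]
    congr 1
    rw [Nat.sub_add_cancel (by omega)]; ring
  have hbad : 4 * bad.card ≤ 2 ^ (d * t) := by
    have h1 : bad.card * (12 * d ^ 2 * n) ≤ ((2 ^ t) ^ (d - 1)) * (n * (2 * d ^ 2 * 2 ^ t + 1)) := by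
      calc bad.card * (12 * d ^ 2 * n) ≤ ∑ σ ∈ bad, ((2 ^ t) ^ (d - 1)) * (Lσ σ).card := by
            have := Finset.card_nsmul_le_sum bad (fun σ => ((2 ^ t) ^ (d - 1)) * (Lσ σ).card) (12 * d ^ 2 * n)
              (fun σ hσ => (not_le.1 (Finset.mem_filter.1 hσ).2).le)
            simpa using this
        _ ≤ ∑ σ, ((2 ^ t) ^ (d - 1)) * (Lσ σ).card :=
            Finset.sum_le_sum_of_subset (Finset.subset_univ _)
        _ = ((2 ^ t) ^ (d - 1)) * ∑ σ, (Lσ σ).card := by rw [Finset.mul_sum]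
        _ ≤ _ := Nat.mul_le_mul_left _ hsum
    have h2 : 2 * d ^ 2 * 2 ^ t + 1 ≤ 3 * d ^ 2 * 2 ^ t := by
      have : 1 ≤ d ^ 2 * 2 ^ t := Nat.one_le_iff_ne_zero.2 (by positivity)
      nlinarith
    have h3 : bad.card * (12 * d ^ 2 * n) ≤ 2 ^ (d * t) * (3 * d ^ 2 * n) := by
      calc _ ≤ _ := h1
        _ ≤ ((2 ^ t) ^ (d - 1)) * (n * (3 * d ^ 2 * 2 ^ t)) :=
          Nat.mul_le_mul_left _ (Nat.mul_le_mul_left _ h2)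
        _ = (((2 ^ t) ^ (d - 1)) * 2 ^ t) * (3 * d ^ 2 * n) := by ring
        _ = _ := by rw [hTd]
    have h4 : 0 < 3 * d ^ 2 * n := by positivity
    have h5 : (4 * bad.card) * (3 * d ^ 2 * n) ≤ 2 ^ (d * t) * (3 * d ^ 2 * n) := by
      calc _ = bad.card * (12 * d ^ 2 * n) := by ring
        _ ≤ _ := h3
    exact Nat.le_of_mul_le_mul_right h5 h4
  have hbadP : 4 * ∑ σ ∈ bad, (Pσ σ).card ≤ P.card := by
    have h1 : ∑ σ ∈ bad, 2 ^ (d * t) * (Pσ σ).card ≤ bad.card * P.card := by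
      have := Finset.sum_le_card_nsmul bad (fun σ => 2 ^ (d * t) * (Pσ σ).card) P.card (fun σ _ => hcell σ)
      simpa using this
    rw [← Finset.mul_sum] at h1
    have h2 : 2 ^ (d * t) * (4 * ∑ σ ∈ bad, (Pσ σ).card) ≤ 2 ^ (d * t) * P.card := by
      calc _ = 4 * (2 ^ (d * t) * ∑ σ ∈ bad, (Pσ σ).card) := by ring
        _ ≤ 4 * (bad.card * P.card) := Nat.mul_le_mul_left _ h1
        _ = (4 * bad.card) * P.card := by ring
        _ ≤ _ := Nat.mul_le_mul_right _ hbad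
    exact Nat.le_of_mul_le_mul_left h2 (by positivity)
  have hPsum : P.card = (P.filter fun p => p ∈ zeroSet f).card + (∑ σ ∈ good, (Pσ σ).card + ∑ σ ∈ bad, (Pσ σ).card) := by
    rw [Finset.sum_filter_add_sum_filter_not, ← Finset.card_filter_add_card_filter_not (s := P) (fun p => p ∈ zeroSet f)]
    congr 1
    rw [Finset.card_eq_sum_card_fiberwise (f := cell) (t := Finset.univ) (by intro x _; simp)]
    simp only [Pσ, Finset.filter_filter]
  have hZ : ((P.filter fun p => p ∈ zeroSet f).card : ℝ) ≤ M * (n : ℝ) ^ β * B := by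
    rw [← hn]
    apply H1 L hL f hf0 hfd
    intro p hp
    obtain ⟨h1, h2⟩ := Finset.mem_filter.1 hp
    exact ⟨hP p h1, h2⟩
  have hTpos : 0 < T ^ (d - 1) := by positivity
  have hgood : ∀ σ ∈ good, ((Pσ σ).card : ℝ) ≤
      C * ((12 * (d : ℝ) ^ 2 / T ^ (d - 1)) ^ β * (n : ℝ) ^ β) * B + M * (n : ℝ) ^ β * B := by
    intro σ hσ
    have hσ' : ((2 ^ t) ^ (d - 1)) * (Lσ σ).card ≤ 12 * d ^ 2 * n := (Finset.mem_filter.1 hσ).2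
    have hσr : T ^ (d - 1) * ((Lσ σ).card : ℝ) ≤ 12 * d ^ 2 * n := by
      rw [hT]; exact_mod_cast hσ'
    have hle : ((Lσ σ).card : ℝ) ≤ 12 * (d : ℝ) ^ 2 / T ^ (d - 1) * n := by
      rw [div_mul_eq_mul_div, le_div_iff₀ hTpos]; linarith
    have hlt : (Lσ σ).card < n := by
      have hq : 12 * (d : ℝ) ^ 2 / T ^ (d - 1) < 1 := by rw [div_lt_one hTpos]; exact ht1
      have hnpos : (0 : ℝ) < n := by exact_mod_cast hn1
      have : ((Lσ σ).card : ℝ) < n := by nlinarith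
      exact_mod_cast this
    have hsub : Lσ σ ⊆ L := Finset.filter_subset _ _
    rw [← Finset.card_filter_add_card_filter_not (s := Pσ σ) (fun p => U (Lσ σ) p)]
    push_cast
    apply add_le_add
    · refine (ih _ hlt (Lσ σ) rfl (hsub.trans hL) _ (fun p hp => (Finset.mem_filter.1 hp).2)).trans ?_
      apply mul_le_mul_of_nonneg_right _ hB
      apply mul_le_mul_of_nonneg_left _ hC0
      rw [← Real.mul_rpow (by positivity) (by positivity)]
      exact Real.rpow_le_rpow (by positivity) hle hβ0.le
    · rw [← hn]
      apply H2 L hL (Lσ σ) hsub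
      intro p hp
      obtain ⟨h1, h2⟩ := Finset.mem_filter.1 hp
      obtain ⟨h3, h4, h5⟩ := Finset.mem_filter.1 h1
      refine ⟨hP p h3, fun ℓ hℓ hpℓ => ?_, h2⟩
      exact Finset.mem_filter.2 ⟨hℓ, p, hpℓ, h4, h5⟩
  have hgoodsum : (∑ σ ∈ good, ((Pσ σ).card : ℝ)) ≤ 2 ^ (d * t) *
      (C * ((12 * (d : ℝ) ^ 2 / T ^ (d - 1)) ^ β * (n : ℝ) ^ β) * B + M * (n : ℝ) ^ β * B) := by
    refine (Finset.sum_le_card_nsmul good _ _ hgood).trans ?_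
    rw [nsmul_eq_mul]
    apply mul_le_mul_of_nonneg_right _ (by positivity)
    have : good.card ≤ 2 ^ (d * t) := by
      refine (Finset.card_le_univ _).trans ?_
      simp
    exact_mod_cast this
  have hPr : (P.card : ℝ) = ((P.filter fun p => p ∈ zeroSet f).card : ℝ) +
      (∑ σ ∈ good, ((Pσ σ).card : ℝ) + ∑ σ ∈ bad, ((Pσ σ).card : ℝ)) := by
    exact_mod_cast hPsum
  have hbr : 4 * ∑ σ ∈ bad, ((Pσ σ).card : ℝ) ≤ P.card := by exact_mod_cast hbadP
  set X : ℝ := (n : ℝ) ^ β * B with hX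
  have hX0 : 0 ≤ X := by positivity
  set κ : ℝ := (12 * (d : ℝ) ^ 2 / T ^ (d - 1)) ^ β with hκ
  have hfin : 2 * ((P.filter fun p => p ∈ zeroSet f).card : ℝ) + 2 * ∑ σ ∈ good, ((Pσ σ).card : ℝ) ≤ C * X := by
    have h1 : ((P.filter fun p => p ∈ zeroSet f).card : ℝ) ≤ M * X := by rw [hX]; linarith
    have h2 : 2 * ∑ σ ∈ good, ((Pσ σ).card : ℝ) ≤ (2 * 2 ^ (d * t) * κ) * (C * X) + 2 * 2 ^ (d * t) * M * X := by
      calc _ ≤ 2 * _ := mul_le_mul_of_nonneg_left hgoodsum (by norm_num)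
        _ = _ := by rw [hX]; ring
    have h3 : (2 * 2 ^ (d * t) * κ) * (C * X) ≤ 1 / 2 * (C * X) :=
      mul_le_mul_of_nonneg_right ht2 (by positivity)
    have h4 : C * X = 4 * M * X + 4 * 2 ^ (d * t) * M * X := by rw [hC]; ring
    linarith
  have : C * (n : ℝ) ^ β * B = C * X := by rw [hX]; ring
  rw [this]
  linarith

end PL

end Part4

section Part5
open Filter Topology

namespace PL

/-! ### Lines -/

/-- number of lines of `L` through `p` -/
def deg {d : ℕ} (L : Finset (Set (Fin d → ℝ))) (p : Fin d → ℝ) : ℕ :=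
  (L.filter fun ℓ => p ∈ ℓ).card

lemma deg_mono {d : ℕ} {L L' : Finset (Set (Fin d → ℝ))} (h : L ⊆ L') (p : Fin d → ℝ) :
    deg L p ≤ deg L' p := Finset.card_le_card (Finset.filter_subset_filter _ h)

lemma deg_le {d : ℕ} (L : Finset (Set (Fin d → ℝ))) (p : Fin d → ℝ) : deg L p ≤ L.card :=
  Finset.card_filter_le _ _

lemma deg_split {d : ℕ} (L : Finset (Set (Fin d → ℝ))) (p : Fin d → ℝ)
    (Q : Set (Fin d → ℝ) → Prop) :
    deg L p = deg (L.filter Q) p + deg (L.filter fun ℓ => ¬ Q ℓ) p := by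
  unfold deg
  rw [← Finset.card_filter_add_card_filter_not (s := L.filter fun ℓ => p ∈ ℓ) Q]
  rw [Finset.filter_filter, Finset.filter_filter, Finset.filter_filter, Finset.filter_filter]
  simp only [and_comm]

lemma mkLine_isLine {d : ℕ} (a b : Fin d → ℝ) (hb : b ≠ 0) : IsLine (mkLine a b) :=
  ⟨a, b, hb, rfl⟩

lemma line_pt {d : ℕ} {ℓ : Set (Fin d → ℝ)} (h : IsLine ℓ) {p : Fin d → ℝ} (hp : p ∈ ℓ) :
    ∃ b, b ≠ 0 ∧ ℓ = mkLine p b := by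
  obtain ⟨a, b, hb, rfl⟩ := h
  obtain ⟨s, rfl⟩ := hp
  refine ⟨b, hb, ?_⟩
  ext x
  constructor
  · rintro ⟨t, rfl⟩; exact ⟨t - s, by module⟩
  · rintro ⟨t, rfl⟩; exact ⟨t + s, by module⟩

lemma mkLine_smul {d : ℕ} (a b : Fin d → ℝ) (c : ℝ) (hc : c ≠ 0) :
    mkLine a (c • b) = mkLine a b := by
  ext x
  constructor
  · rintro ⟨t, rfl⟩; exact ⟨t * c, by module⟩
  · rintro ⟨t, rfl⟩; exact ⟨t / c, by rw [smul_smul, div_mul_cancel₀ _ hc]⟩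

lemma line_two {d : ℕ} {ℓ : Set (Fin d → ℝ)} (h : IsLine ℓ) {p p' : Fin d → ℝ} (hp : p ∈ ℓ)
    (hp' : p' ∈ ℓ) (hne : p ≠ p') : ℓ = mkLine p (p' - p) := by
  obtain ⟨b, hb, rfl⟩ := line_pt h hp
  obtain ⟨t, rfl⟩ := hp'
  have ht : t ≠ 0 := by rintro rfl; simp at hne
  rw [add_sub_cancel_left, mkLine_smul _ _ _ ht]

lemma line_unique {d : ℕ} {ℓ ℓ' : Set (Fin d → ℝ)} (h : IsLine ℓ) (h' : IsLine ℓ')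
    {p p' : Fin d → ℝ} (h1 : p ∈ ℓ) (h2 : p' ∈ ℓ) (h3 : p ∈ ℓ') (h4 : p' ∈ ℓ') (hne : p ≠ p') :
    ℓ = ℓ' := by
  rw [line_two h h1 h2 hne, line_two h' h3 h4 hne]

lemma line_pt_inj {d : ℕ} {a b : Fin d → ℝ} (hb : b ≠ 0) {s t : ℝ}
    (h : a + s • b = a + t • b) : s = t := by
  have h1 : (s - t) • b = 0 := by
    have := add_left_cancel h
    rw [sub_smul, this, sub_self]
  rcases smul_eq_zero.1 h1 with h | h
  · linarith
  · exact (hb h).elim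

lemma lp_count {d : ℕ} (a b : Fin d → ℝ) (h : Polynomial ℝ) (hh : h ≠ 0)
    (P : Finset (Fin d → ℝ)) (hP : ∀ p ∈ P, ∃ t : ℝ, p = a + t • b ∧ h.eval t = 0) :
    P.card ≤ h.natDegree := by
  choose! s hs using hP
  have : P.card ≤ h.roots.toFinset.card := by
    apply Finset.card_le_card_of_injOn s
    · intro p hp
      rw [Finset.mem_coe, Multiset.mem_toFinset, Polynomial.mem_roots hh]
      exact (hs p hp).2
    · intro p hp q hq hpq
      rw [(hs p hp).1, (hs q hq).1, hpq]
  exact this.trans ((Multiset.toFinset_card_le _).trans h.card_roots')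

lemma line_zero_count {d : ℕ} {ℓ : Set (Fin d → ℝ)} (h : IsLine ℓ) (f : MvPolynomial (Fin d) ℝ)
    (hf : ¬ ℓ ⊆ zeroSet f) (P : Finset (Fin d → ℝ)) (hP : ∀ p ∈ P, p ∈ ℓ ∧ p ∈ zeroSet f) :
    P.card ≤ f.totalDegree := by
  obtain ⟨a, b, hb, rfl⟩ := h
  have h0 : lp f a b ≠ 0 := fun h => hf ((lp_eq_zero_iff f a b).1 h)
  refine (lp_count a b _ h0 P ?_).trans (lp_natDegree f a b)
  intro p hp
  obtain ⟨⟨t, rfl⟩, h2⟩ := hP p hp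
  exact ⟨t, rfl, by rw [lp_eval]; exact h2⟩

/-- double counting: every point on at least `ρ` lines, every line with at most `E` points -/
lemma dcount {d : ℕ} (P : Finset (Fin d → ℝ)) (L : Finset (Set (Fin d → ℝ))) (ρ E : ℕ)
    (h1 : ∀ p ∈ P, ρ ≤ deg L p) (h2 : ∀ ℓ ∈ L, (P.filter fun p => p ∈ ℓ).card ≤ E) :
    P.card * ρ ≤ L.card * E :=
  Finset.card_mul_le_card_mul (fun p ℓ => p ∈ ℓ) h1 h2

lemma out_count {d : ℕ} (P : Finset (Fin d → ℝ)) (L : Finset (Set (Fin d → ℝ)))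
    (hL : ∀ ℓ ∈ L, IsLine ℓ) (f : MvPolynomial (Fin d) ℝ) (E ρ : ℕ) (hE : f.totalDegree ≤ E)
    (hP : ∀ p ∈ P, p ∈ zeroSet f ∧ ρ ≤ deg (L.filter fun ℓ => ¬ ℓ ⊆ zeroSet f) p) :
    P.card * ρ ≤ L.card * E := by
  refine (dcount P _ ρ E (fun p hp => (hP p hp).2) ?_).trans
    (Nat.mul_le_mul_right _ (Finset.card_filter_le L _))
  intro ℓ hℓ
  obtain ⟨h1, h2⟩ := Finset.mem_filter.1 hℓ
  refine (line_zero_count (hL ℓ h1) f h2 _ ?_).trans hE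
  intro p hp
  obtain ⟨h3, h4⟩ := Finset.mem_filter.1 hp
  exact ⟨h4, (hP p h3).1⟩

/-- points lying on two lines of a small family -/
lemma two_count {d : ℕ} (P : Finset (Fin d → ℝ)) (L : Finset (Set (Fin d → ℝ)))
    (hL : ∀ ℓ ∈ L, IsLine ℓ) (hP : ∀ p ∈ P, 2 ≤ deg L p) : P.card ≤ L.card ^ 2 := by
  have h : ∀ p ∈ P, ∃ x : Set (Fin d → ℝ) × Set (Fin d → ℝ), x.1 ∈ L ∧ x.2 ∈ L ∧ x.1 ≠ x.2 ∧
      p ∈ x.1 ∧ p ∈ x.2 := by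
    intro p hp
    obtain ⟨a, ha, b, hb, hab⟩ := Finset.one_lt_card.1 (hP p hp)
    obtain ⟨ha1, ha2⟩ := Finset.mem_filter.1 ha
    obtain ⟨hb1, hb2⟩ := Finset.mem_filter.1 hb
    exact ⟨(a, b), ha1, hb1, hab, ha2, hb2⟩
  choose! x hx using h
  rw [sq, ← Finset.card_product]
  apply Finset.card_le_card_of_injOn x
  · intro p hp
    rw [Finset.mem_coe, Finset.mem_product]
    exact ⟨(hx p hp).1, (hx p hp).2.1⟩
  · intro p hp q hq hpq
    by_contra hne
    obtain ⟨h1, h2, h3, h4, h5⟩ := hx p hp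
    obtain ⟨-, -, -, h6, h7⟩ := hx q hq
    rw [← hpq] at h6 h7
    exact h3 (line_unique (hL _ h1) (hL _ h2) h4 h6 h5 h7 hne)

/-! ### Set families with small intersections -/

lemma family {α β : Type*} (P : Finset α) (L : Finset β) (R : α → β → Prop) (t : ℝ) (ht0 : 0 < t)
    (ht : 2 * (L.card : ℝ) < t ^ 2) (h1 : ∀ p ∈ P, t ≤ ((L.filter (R p)).card : ℝ))
    (h2 : ∀ p ∈ P, ∀ p' ∈ P, p ≠ p' → (L.filter fun ℓ => R p ℓ ∧ R p' ℓ).card ≤ 1) :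
    ∑ p ∈ P, ((L.filter (R p)).card : ℝ) ≤ 2 * L.card := by
  rcases P.eq_empty_or_nonempty with rfl | hne
  · simp
  set I : ℝ := ∑ p ∈ P, ((L.filter (R p)).card : ℝ) with hI
  have hcs : I ^ 2 ≤ L.card * (I + (P.card : ℝ) ^ 2) := by
    have e1 : I = ∑ ℓ ∈ L, ((P.filter fun p => R p ℓ).card : ℝ) := by
      rw [hI]
      simp only [Finset.card_filter, Nat.cast_sum]
      exact Finset.sum_comm
    have e2 : ∑ ℓ ∈ L, ((P.filter fun p => R p ℓ).card : ℝ) ^ 2 =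
        ∑ p ∈ P, ∑ p' ∈ P, ((L.filter fun ℓ => R p ℓ ∧ R p' ℓ).card : ℝ) := by
      have : ∀ ℓ ∈ L, ((P.filter fun p => R p ℓ).card : ℝ) ^ 2 =
          ∑ p ∈ P, ∑ p' ∈ P, if R p ℓ ∧ R p' ℓ then (1 : ℝ) else 0 := by
        intro ℓ _
        rw [sq, Finset.card_filter]
        push_cast
        rw [Finset.sum_mul_sum]
        apply Finset.sum_congr rfl; intro p _
        apply Finset.sum_congr rfl; intro p' _
        by_cases h : R p ℓ <;> by_cases h' : R p' ℓ <;> simp [h, h']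
      rw [Finset.sum_congr rfl this, Finset.sum_comm]
      apply Finset.sum_congr rfl; intro p _
      rw [Finset.sum_comm]
      apply Finset.sum_congr rfl; intro p' _
      rw [Finset.card_filter]; push_cast; rfl
    have e3 : ∑ p ∈ P, ∑ p' ∈ P, ((L.filter fun ℓ => R p ℓ ∧ R p' ℓ).card : ℝ) ≤
        I + (P.card : ℝ) ^ 2 := by
      have : ∀ p ∈ P, ∑ p' ∈ P, ((L.filter fun ℓ => R p ℓ ∧ R p' ℓ).card : ℝ) ≤
          ((L.filter (R p)).card : ℝ) + P.card := by
        intro p hp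
        rw [← Finset.add_sum_erase P _ hp]
        simp only [and_self]
        apply add_le_add le_rfl
        calc ∑ p' ∈ P.erase p, ((L.filter fun ℓ => R p ℓ ∧ R p' ℓ).card : ℝ)
            ≤ ∑ p' ∈ P.erase p, (1 : ℝ) := by
              apply Finset.sum_le_sum
              intro p' hp'
              obtain ⟨h3, h4⟩ := Finset.mem_erase.1 hp'
              exact_mod_cast h2 p hp p' h4 (Ne.symm h3)
          _ ≤ P.card := by
              simp only [Finset.sum_const, nsmul_eq_mul, mul_one]
              exact_mod_cast Finset.card_le_card (Finset.erase_subset _ _)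
      refine (Finset.sum_le_sum this).trans ?_
      rw [Finset.sum_add_distrib]
      simp [sq, hI]
    have e4 : (∑ ℓ ∈ L, ((P.filter fun p => R p ℓ).card : ℝ)) ^ 2 ≤
        L.card * ∑ ℓ ∈ L, ((P.filter fun p => R p ℓ).card : ℝ) ^ 2 := sq_sum_le_card_mul_sum_sq
    rw [e1]
    refine e4.trans ?_
    rw [← e1, e2]
    exact mul_le_mul_of_nonneg_left e3 (by positivity)
  have hIt : P.card * t ≤ I := by
    have := Finset.card_nsmul_le_sum P _ t h1
    simpa using this
  have hPpos : (0 : ℝ) < P.card := by exact_mod_cast hne.card_pos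
  have hIpos : 0 < I := lt_of_lt_of_le (by positivity) hIt
  by_contra hcon
  push Not at hcon
  have h3 : (P.card : ℝ) ^ 2 * t ^ 2 ≤ I ^ 2 := by
    rw [← mul_pow]; exact pow_le_pow_left₀ (by positivity) hIt 2
  have h4 : 2 * (L.card : ℝ) * (P.card : ℝ) ^ 2 < I ^ 2 := by
    have : (P.card : ℝ) ^ 2 * (2 * L.card) < (P.card : ℝ) ^ 2 * t ^ 2 :=
      mul_lt_mul_of_pos_left ht (by positivity)
    linarith
  nlinarith

lemma rich_family {d : ℕ} (P : Finset (Fin d → ℝ)) (L : Finset (Set (Fin d → ℝ)))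
    (hL : ∀ ℓ ∈ L, IsLine ℓ) (r : ℕ) (hr : 2 * L.card < r ^ 2) (hP : ∀ p ∈ P, r ≤ deg L p) :
    P.card * r ≤ 2 * L.card := by
  have hr0 : 0 < r := by
    rcases Nat.eq_zero_or_pos r with rfl | h
    · simp at hr
    · exact h
  have := family P L (fun p ℓ => p ∈ ℓ) r (by exact_mod_cast hr0) (by exact_mod_cast hr)
    (fun p hp => by exact_mod_cast hP p hp) (by
      intro p _ p' _ hne
      rw [Finset.card_le_one]
      intro ℓ hℓ ℓ' hℓ'
      obtain ⟨h1, h2, h3⟩ := Finset.mem_filter.1 hℓ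
      obtain ⟨h4, h5, h6⟩ := Finset.mem_filter.1 hℓ'
      exact line_unique (hL _ h1) (hL _ h4) h2 h3 h5 h6 hne)
  have h2 : (P.card : ℝ) * r ≤ ∑ p ∈ P, ((L.filter fun ℓ => p ∈ ℓ).card : ℝ) := by
    have := Finset.card_nsmul_le_sum P (fun p => ((L.filter fun ℓ => p ∈ ℓ).card : ℝ)) r
      (fun p hp => by exact_mod_cast hP p hp)
    simpa using this
  exact_mod_cast h2.trans this

end PL

end Part5

section Part6
open Filter Topology

namespace PL

open MvPolynomial in
/-- The affine linear form `v ⬝ (x - a)`. -/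
def lin {d : ℕ} (v a : Fin d → ℝ) : MvPolynomial (Fin d) ℝ :=
  ∑ i, C (v i) * (X i - C (a i))

lemma lin_eval {d : ℕ} (v a x : Fin d → ℝ) :
    MvPolynomial.eval x (lin v a) = ∑ i, v i * (x i - a i) := by
  simp [lin]

lemma lin_mem {d : ℕ} (v a x : Fin d → ℝ) :
    x ∈ zeroSet (lin v a) ↔ ∑ i, v i * (x i - a i) = 0 := by
  rw [zeroSet, Set.mem_ofPred_eq, lin_eval]

lemma lin_coeff {d : ℕ} (v a : Fin d → ℝ) (j : Fin d) :
    MvPolynomial.coeff (Finsupp.single j 1) (lin v a) = v j := by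
  simp only [lin, MvPolynomial.coeff_sum, MvPolynomial.coeff_C_mul, MvPolynomial.coeff_sub,
    MvPolynomial.coeff_X, MvPolynomial.coeff_C]
  have h : (0 : Fin d →₀ ℕ) ≠ Finsupp.single j 1 := by
    intro h
    have := DFunLike.congr_fun h j
    simp at this
  simp only [h, if_false, sub_zero]
  rw [Finset.sum_eq_single j]
  · simp
  · intro i _ hi
    simp [Finsupp.single_left_inj, hi]
  · simp

lemma lin_deg {d : ℕ} (v a : Fin d → ℝ) (hv : v ≠ 0) : (lin v a).totalDegree = 1 := by
  apply le_antisymm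
  · unfold lin
    apply MvPolynomial.totalDegree_finsetSum_le
    intro i _
    refine (MvPolynomial.totalDegree_mul _ _).trans ?_
    rw [MvPolynomial.totalDegree_C, zero_add]
    refine (MvPolynomial.totalDegree_sub _ _).trans ?_
    simp
  · obtain ⟨j, hj⟩ := Function.ne_iff.1 hv
    have h1 : Finsupp.single j 1 ∈ (lin v a).support := by
      rw [MvPolynomial.mem_support_iff, lin_coeff]; exact hj
    have := MvPolynomial.le_totalDegree h1
    simpa using this

lemma lin_ne {d : ℕ} (v a : Fin d → ℝ) (hv : v ≠ 0) : lin v a ≠ 0 := by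
  intro h
  have := lin_deg v a hv
  rw [h] at this; simp at this

lemma lin_dvd {d : ℕ} (v a : Fin d → ℝ) (hv : v ≠ 0) (f : MvPolynomial (Fin d) ℝ)
    (hf : zeroSet (lin v a) ⊆ zeroSet f) : lin v a ∣ f := by
  obtain ⟨j, hj⟩ := Function.ne_iff.1 hv
  simp only [Pi.zero_apply] at hj
  let g : Fin d → MvPolynomial (Fin d) ℝ := fun i =>
    if i = j then MvPolynomial.X j - MvPolynomial.C (v j)⁻¹ * lin v a else MvPolynomial.X i
  let φ : MvPolynomial (Fin d) ℝ →ₐ[ℝ] MvPolynomial (Fin d) ℝ := MvPolynomial.aeval g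
  have h1 : ∀ f, lin v a ∣ f - φ f := by
    intro f
    induction f using MvPolynomial.induction_on with
    | C r => simp [φ]
    | add p q hp hq =>
      rw [map_add, add_sub_add_comm]; exact dvd_add hp hq
    | mul_X p i hp =>
      rw [map_mul]
      have h2 : lin v a ∣ MvPolynomial.X i - φ (MvPolynomial.X i) := by
        simp only [φ, MvPolynomial.aeval_X, g]
        split_ifs with h
        · subst h; simp
        · simp
      have : p * MvPolynomial.X i - φ p * φ (MvPolynomial.X i) =
        (p - φ p) * MvPolynomial.X i + φ p * (MvPolynomial.X i - φ (MvPolynomial.X i)) := by ring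
      rw [this]
      exact dvd_add (hp.mul_right _) (h2.mul_left _)
  have h2 : φ f = 0 := by
    apply MvPolynomial.funext
    intro x
    have e : MvPolynomial.eval x (φ f) = MvPolynomial.eval (fun i => MvPolynomial.eval x (g i)) f := by
      simp only [φ]
      rw [MvPolynomial.aeval_def, MvPolynomial.eval₂_eq, map_sum, MvPolynomial.eval_eq]
      simp
    rw [e, map_zero]
    apply hf
    rw [lin_mem]
    have hg : ∀ i, MvPolynomial.eval x (g i) =
        x i - if i = j then (v j)⁻¹ * ∑ i, v i * (x i - a i) else 0 := by
      intro i
      simp only [g]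
      split_ifs with h
      · subst h; simp [lin_eval]
      · simp
    simp only [hg]
    have : ∀ i, v i * (x i - (if i = j then (v j)⁻¹ * ∑ i, v i * (x i - a i) else 0) - a i) =
        v i * (x i - a i) - (if i = j then v j * ((v j)⁻¹ * ∑ i, v i * (x i - a i)) else 0) := by
      intro i
      split_ifs with h
      · subst h; ring
      · ring
    simp only [this, Finset.sum_sub_distrib, Finset.sum_ite_eq', Finset.mem_univ, if_true]
    rw [mul_inv_cancel_left₀ hj, sub_self]
  have := h1 f
  rwa [h2, sub_zero] at this

/-! ### Lines in plane curves -/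

lemma line2_eq (a b : Fin 2 → ℝ) (hb : b ≠ 0) :
    mkLine a b = zeroSet (lin ![b 1, -b 0] a) := by
  ext x
  rw [lin_mem, Fin.sum_univ_two]
  simp only [Matrix.cons_val_zero, Matrix.cons_val_one]
  constructor
  · rintro ⟨t, rfl⟩
    simp; ring
  · intro h
    by_cases h0 : b 0 = 0
    · have h1 : b 1 ≠ 0 := by
        intro h1; apply hb; funext i; fin_cases i <;> simp [h0, h1]
      refine ⟨(x 1 - a 1) / b 1, ?_⟩
      funext i; fin_cases i
      · rw [h0] at h
        simp [h1] at h
        simp [h0]; linarith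
      · simp [h1]
    · refine ⟨(x 0 - a 0) / b 0, ?_⟩
      funext i; fin_cases i
      · simp [h0]
      · simp; field_simp; linarith

lemma lines2_count (f : MvPolynomial (Fin 2) ℝ) (hf : f ≠ 0) (L : Finset (Set (Fin 2 → ℝ)))
    (hL : ∀ ℓ ∈ L, IsLine ℓ ∧ ℓ ⊆ zeroSet f) : L.card ≤ f.totalDegree := by
  induction L using Finset.induction_on generalizing f with
  | empty => simp
  | insert ℓ L hℓ ih =>
    obtain ⟨⟨a, b, hb, hab⟩, h2⟩ := hL ℓ (Finset.mem_insert_self _ _)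
    have hab : ℓ = mkLine a b := hab
    have hv : (![b 1, -b 0] : Fin 2 → ℝ) ≠ 0 := by
      intro h
      apply hb
      have e0 := congrFun h 0
      have e1 := congrFun h 1
      simp at e0 e1
      funext i; fin_cases i <;> simp [e0, e1]
    rw [hab, line2_eq a b hb] at h2
    obtain ⟨g, rfl⟩ := lin_dvd _ a hv f h2
    have hg : g ≠ 0 := by rintro rfl; simp at hf
    rw [Finset.card_insert_of_notMem hℓ, MvPolynomial.totalDegree_mul_of_isDomain (lin_ne _ a hv) hg,
      lin_deg _ a hv, add_comm 1]
    apply Nat.succ_le_succ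
    apply ih g hg
    intro m hm
    obtain ⟨h3, h4⟩ := hL m (Finset.mem_insert_of_mem hm)
    refine ⟨h3, ?_⟩
    obtain ⟨a', b', hb', hm'⟩ := h3
    have hm' : m = mkLine a' b' := hm'
    rw [hm'] at h4 ⊢
    rw [← lp_eq_zero_iff] at h4 ⊢
    rw [lp_mul] at h4
    rcases mul_eq_zero.1 h4 with h | h
    · exfalso
      rw [lp_eq_zero_iff, ← line2_eq a b hb] at h
      apply hℓ
      have : ℓ = m := by
        rw [hab, hm']
        have p1 : a' ∈ mkLine a' b' := ⟨0, by simp⟩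
        have p2 : a' + b' ∈ mkLine a' b' := ⟨1, by simp⟩
        exact line_unique (mkLine_isLine a b hb) (mkLine_isLine a' b' hb') (h p1) (h p2) p1 p2
          (by simpa using hb')
      rw [this]; exact hm
    · exact h

/-! ### Planar Szemeredi–Trotter with epsilon loss -/

lemma bound_aux (n r : ℝ) (hn : 1 ≤ n) (hr : 1 ≤ r) (h : r ^ 2 ≤ 4 * n) (β : ℝ) (hβ : 2 ≤ β) :
    n / r ≤ 4 * n ^ β * (1 / r ^ 3) ∧ 1 ≤ 8 * n ^ β * (1 / r ^ 3) := by
  have hn2 : n ^ 2 ≤ n ^ β := by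
    rw [← Real.rpow_natCast]; exact Real.rpow_le_rpow_of_exponent_le hn (by simpa using hβ)
  have h3 : r ^ 3 ≤ 8 * n ^ 2 := by
    have : (r ^ 3) ^ 2 ≤ (8 * n ^ 2) ^ 2 := by
      calc (r ^ 3) ^ 2 = (r ^ 2) ^ 3 := by ring
        _ ≤ (4 * n) ^ 3 := pow_le_pow_left₀ (by positivity) h 3
        _ = 64 * n ^ 3 * 1 := by ring
        _ ≤ 64 * n ^ 3 * n := by gcongr
        _ = _ := by ring
    exact le_of_sq_le_sq this (by positivity)
  constructor
  · rw [mul_one_div, div_le_div_iff₀ (by positivity) (by positivity)]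
    calc n * r ^ 3 = n * r ^ 2 * r := by ring
      _ ≤ n * (4 * n) * r := by gcongr
      _ = 4 * n ^ 2 * r := by ring
      _ ≤ 4 * n ^ β * r := by gcongr
  · rw [mul_one_div, le_div_iff₀ (by positivity)]
    linarith

lemma deg_of_sub {d : ℕ} {L L' : Finset (Set (Fin d → ℝ))} {p : Fin d → ℝ}
    (h : ∀ ℓ ∈ L, p ∈ ℓ → ℓ ∈ L') : deg L p ≤ deg L' p := by
  apply Finset.card_le_card
  intro ℓ hℓ
  obtain ⟨h1, h2⟩ := Finset.mem_filter.1 hℓ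
  exact Finset.mem_filter.2 ⟨h ℓ h1 h2, h2⟩

theorem ST (ε : ℝ) (hε : 0 < ε) : ∃ C : ℝ, 0 ≤ C ∧ ∀ (L : Finset (Set (Fin 2 → ℝ)))
    (P : Finset (Fin 2 → ℝ)) (r : ℕ), 4 ≤ r → (∀ ℓ ∈ L, IsLine ℓ) → (∀ p ∈ P, r ≤ deg L p) →
    (P.card : ℝ) ≤ C * ((L.card : ℝ) ^ (2 + ε) / (r : ℝ) ^ 3 + (L.card : ℝ) / r) := by
  obtain ⟨D, hD⟩ := recursion 2 le_rfl (2 + ε) (by norm_num; exact hε)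
  obtain ⟨C, hC, H⟩ := hD (8 * D + 8 * D ^ 2 + 8) (by positivity)
  refine ⟨C + 2, by positivity, fun L P r hr hL hP => ?_⟩
  have hr0 : (0 : ℝ) < r := by
    have : 0 < r := by omega
    exact_mod_cast this
  by_cases hcase : r ^ 2 ≤ 4 * L.card
  · have key := H L hL (fun L p => r ≤ deg L p ∧ r ^ 2 ≤ 4 * L.card) (1 / (r : ℝ) ^ 3) (by positivity)
      ?_ ?_ ?_ L (Finset.Subset.refl _) P (fun p hp => ⟨hP p hp, hcase⟩)
    · refine key.trans ?_
      have : (0:ℝ) ≤ (L.card : ℝ) ^ (2 + ε) / (r : ℝ) ^ 3 := by positivity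
      have h2 : (0:ℝ) ≤ (L.card : ℝ) / r := by positivity
      calc C * (L.card : ℝ) ^ (2 + ε) * (1 / (r : ℝ) ^ 3) = C * ((L.card : ℝ) ^ (2 + ε) / (r : ℝ) ^ 3) := by ring
        _ ≤ (C + 2) * ((L.card : ℝ) ^ (2 + ε) / (r : ℝ) ^ 3 + (L.card : ℝ) / r) := by nlinarith
    · rintro L p ⟨h, -⟩
      rw [← Finset.card_pos]
      have := deg_le L p
      omega
    · intro L' hL' f hf hfd Q hQ
      rcases Q.eq_empty_or_nonempty with rfl | ⟨q0, hq0⟩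
      · simp; positivity
      have hrn := (hQ q0 hq0).1.2
      have hLl : ∀ ℓ ∈ L', IsLine ℓ := fun ℓ h => hL ℓ (hL' h)
      have hn1 : (1 : ℝ) ≤ L'.card := by
        have : 1 ≤ L'.card := by
          have := deg_le L' q0
          have := (hQ q0 hq0).1.1
          omega
        exact_mod_cast this
      obtain ⟨b1, b2⟩ := bound_aux L'.card r hn1 (by exact_mod_cast (by omega : 1 ≤ r))
        (by exact_mod_cast hrn) (2 + ε) (by linarith)
      rw [← Finset.card_filter_add_card_filter_not (s := Q)
        (fun p => r ≤ 2 * deg (L'.filter fun ℓ => ¬ ℓ ⊆ zeroSet f) p)]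
      have c1 := out_count (Q.filter fun p => r ≤ 2 * deg (L'.filter fun ℓ => ¬ ℓ ⊆ zeroSet f) p)
        L' hLl f D ((r + 1) / 2) hfd (by
          intro p hp
          obtain ⟨h1, h2⟩ := Finset.mem_filter.1 hp
          exact ⟨(hQ p h1).2, by omega⟩)
      have c2 := two_count (Q.filter fun p => ¬ r ≤ 2 * deg (L'.filter fun ℓ => ¬ ℓ ⊆ zeroSet f) p)
        (L'.filter fun ℓ => ℓ ⊆ zeroSet f) (fun ℓ h => hLl ℓ (Finset.mem_filter.1 h).1) (by
          intro p hp
          obtain ⟨h1, h2⟩ := Finset.mem_filter.1 hp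
          have h3 := deg_split L' p (fun ℓ => ℓ ⊆ zeroSet f)
          have h4 := (hQ p h1).1.1
          omega)
      have c3 : (L'.filter fun ℓ => ℓ ⊆ zeroSet f).card ≤ D :=
        (lines2_count f hf _ (fun ℓ h => ⟨hLl ℓ (Finset.mem_filter.1 h).1, (Finset.mem_filter.1 h).2⟩)).trans hfd
      have c4 := c2.trans (Nat.pow_le_pow_left c3 2)
      generalize (Q.filter fun p => r ≤ 2 * deg (L'.filter fun ℓ => ¬ ℓ ⊆ zeroSet f) p).card = x at *
      generalize (Q.filter fun p => ¬ r ≤ 2 * deg (L'.filter fun ℓ => ¬ ℓ ⊆ zeroSet f) p).card = y at *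
      have c5 : x * r ≤ 2 * (L'.card * D) := by
        have : r ≤ 2 * ((r + 1) / 2) := by omega
        calc x * r ≤ x * (2 * ((r + 1) / 2)) := Nat.mul_le_mul_left _ this
          _ = 2 * (x * ((r + 1) / 2)) := by ring
          _ ≤ _ := Nat.mul_le_mul_left _ c1
      have c6 : (x : ℝ) ≤ 2 * D * (L'.card / r) := by
        rw [mul_div_assoc', le_div_iff₀ hr0]
        have : (x : ℝ) * r ≤ 2 * (L'.card * D) := by exact_mod_cast c5
        linarith
      have c7 : (y : ℝ) ≤ D ^ 2 := by exact_mod_cast c4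
      push_cast
      set Z := (L'.card : ℝ) ^ (2 + ε) * (1 / (r : ℝ) ^ 3) with hZ
      have d1 : (L'.card : ℝ) / r ≤ 4 * Z := by rw [hZ]; linarith
      have d2 : 1 ≤ 8 * Z := by rw [hZ]; linarith
      have : (8 * (D : ℝ) + 8 * D ^ 2 + 8) * (L'.card : ℝ) ^ (2 + ε) * (1 / (r : ℝ) ^ 3) = (8 * (D : ℝ) + 8 * D ^ 2 + 8) * Z := by
        rw [hZ]; ring
      rw [this]
      have e1 : 2 * (D : ℝ) * (L'.card / r) ≤ 2 * D * (4 * Z) := mul_le_mul_of_nonneg_left d1 (by positivity)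
      have e2 : (D : ℝ) ^ 2 * 1 ≤ D ^ 2 * (8 * Z) := mul_le_mul_of_nonneg_left d2 (by positivity)
      linarith
    · intro L1 hL1 L' hL' Q hQ
      rcases Q.eq_empty_or_nonempty with rfl | ⟨q0, hq0⟩
      · simp; positivity
      have hLl : ∀ ℓ ∈ L', IsLine ℓ := fun ℓ h => hL ℓ (hL1 (hL' h))
      have hrn := (hQ q0 hq0).1.2
      have hn1 : (1 : ℝ) ≤ L1.card := by
        have : 1 ≤ L1.card := by
          have := deg_le L1 q0
          have := (hQ q0 hq0).1.1
          omega
        exact_mod_cast this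
      obtain ⟨b1, b2⟩ := bound_aux L1.card r hn1 (by exact_mod_cast (by omega : 1 ≤ r))
        (by exact_mod_cast hrn) (2 + ε) (by linarith)
      have c1 : (Q.card : ℝ) ≤ 2 * (L1.card / r) := by
        by_cases hc : r ^ 2 ≤ 4 * L'.card
        · exfalso
          obtain ⟨h1, h2, h3⟩ := hQ q0 hq0
          exact h3 ⟨h1.1.trans (deg_of_sub h2), hc⟩
        · have := rich_family Q L' hLl r (by omega) (fun p hp => (hQ p hp).1.1.trans (deg_of_sub (hQ p hp).2.1))
          have h2 : Q.card * r ≤ 2 * L1.card := this.trans (Nat.mul_le_mul_left _ (Finset.card_le_card hL'))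
          have h3 : (Q.card : ℝ) * r ≤ 2 * L1.card := by exact_mod_cast h2
          rw [mul_div_assoc', le_div_iff₀ hr0]; exact h3
      refine c1.trans ?_
      have : 0 ≤ (L1.card : ℝ) ^ (2 + ε) * (1 / (r : ℝ) ^ 3) := by positivity
      have hDD : (0 : ℝ) ≤ 8 * D + 8 * D ^ 2 := by positivity
      nlinarith
  · have h := rich_family P L hL r (by omega) hP
    have h' : (P.card : ℝ) * r ≤ 2 * L.card := by exact_mod_cast h
    have h2 : (P.card : ℝ) ≤ 2 * (L.card / r) := by
      rw [mul_div_assoc', le_div_iff₀ hr0]; exact h'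
    have : (0:ℝ) ≤ (L.card : ℝ) ^ (2 + ε) / (r : ℝ) ^ 3 := by positivity
    have h3 : (0:ℝ) ≤ (L.card : ℝ) / r := by positivity
    nlinarith

end PL

end Part6

section Part7
open Filter Topology

namespace PL

lemma aeval_deg {d e : ℕ} (h : Fin d → MvPolynomial (Fin e) ℝ) (hh : ∀ i, (h i).totalDegree ≤ 1)
    (f : MvPolynomial (Fin d) ℝ) : (MvPolynomial.aeval h f).totalDegree ≤ f.totalDegree := by
  rw [MvPolynomial.aeval_def, MvPolynomial.eval₂_eq]
  apply MvPolynomial.totalDegree_finsetSum_le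
  intro m hm
  refine (MvPolynomial.totalDegree_mul _ _).trans ?_
  rw [MvPolynomial.algebraMap_eq, MvPolynomial.totalDegree_C, zero_add]
  refine (MvPolynomial.totalDegree_finsetProd _ _).trans ?_
  refine le_trans ?_ (MvPolynomial.le_totalDegree hm)
  rw [Finsupp.sum]
  apply Finset.sum_le_sum
  intro i _
  refine (MvPolynomial.totalDegree_pow _ _).trans ?_
  have := hh i
  nlinarith

lemma aeval_eval {d e : ℕ} (h : Fin d → MvPolynomial (Fin e) ℝ) (f : MvPolynomial (Fin d) ℝ)
    (y : Fin e → ℝ) : MvPolynomial.eval y (MvPolynomial.aeval h f) =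
      MvPolynomial.eval (fun i => MvPolynomial.eval y (h i)) f := by
  rw [MvPolynomial.aeval_def, MvPolynomial.eval₂_eq, map_sum, MvPolynomial.eval_eq]
  simp

/-- image of a family of lines under a linear map -/
def imL {d d' : ℕ} (A : (Fin d → ℝ) →ₗ[ℝ] (Fin d' → ℝ)) (L : Finset (Set (Fin d → ℝ))) :
    Finset (Set (Fin d' → ℝ)) := L.image fun ℓ => A '' ℓ

lemma image_line {d d' : ℕ} (A : (Fin d → ℝ) →ₗ[ℝ] (Fin d' → ℝ)) (a b : Fin d → ℝ) :
    A '' mkLine a b = mkLine (A a) (A b) := by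
  ext x
  constructor
  · rintro ⟨_, ⟨t, rfl⟩, rfl⟩
    exact ⟨t, by simp⟩
  · rintro ⟨t, rfl⟩
    exact ⟨a + t • b, ⟨t, rfl⟩, by simp⟩

lemma image_isLine {d d' : ℕ} (A : (Fin d → ℝ) →ₗ[ℝ] (Fin d' → ℝ)) {ℓ : Set (Fin d → ℝ)}
    (h : IsLine ℓ) (hi : Set.InjOn A ℓ) : IsLine (A '' ℓ) := by
  obtain ⟨a, b, hb, hab⟩ := h
  have hab : ℓ = mkLine a b := hab
  rw [hab, image_line]
  apply mkLine_isLine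
  intro h0
  rw [hab] at hi
  have : a = a + b := hi ⟨0, by simp⟩ ⟨1, by simp⟩ (by simp [h0])
  simp at this
  exact hb this

lemma imL_isLine {d d' : ℕ} (A : (Fin d → ℝ) →ₗ[ℝ] (Fin d' → ℝ)) (L : Finset (Set (Fin d → ℝ)))
    (hL : ∀ ℓ ∈ L, IsLine ℓ) (hb : ∀ ℓ ∈ L, Set.InjOn A ℓ) : ∀ ℓ ∈ imL A L, IsLine ℓ := by
  intro ℓ hℓ
  obtain ⟨m, hm, rfl⟩ := Finset.mem_image.1 hℓ
  exact image_isLine A (hL m hm) (hb m hm)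

lemma imL_card {d d' : ℕ} (A : (Fin d → ℝ) →ₗ[ℝ] (Fin d' → ℝ)) (L : Finset (Set (Fin d → ℝ)))
    (hinj : Set.InjOn (fun ℓ => A '' ℓ) (L : Set (Set (Fin d → ℝ)))) : (imL A L).card = L.card :=
  Finset.card_image_of_injOn hinj

lemma imL_deg {d d' : ℕ} (A : (Fin d → ℝ) →ₗ[ℝ] (Fin d' → ℝ)) (L : Finset (Set (Fin d → ℝ)))
    (hinj : Set.InjOn (fun ℓ => A '' ℓ) (L : Set (Set (Fin d → ℝ)))) (p : Fin d → ℝ) :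
    deg L p ≤ deg (imL A L) (A p) := by
  unfold deg
  apply Finset.card_le_card_of_injOn (fun ℓ => A '' ℓ)
  · intro ℓ hℓ
    obtain ⟨h1, h2⟩ := Finset.mem_filter.1 hℓ
    exact Finset.mem_filter.2 ⟨Finset.mem_image_of_mem _ h1, Set.mem_image_of_mem A h2⟩
  · intro ℓ hℓ m hm h
    exact hinj (Finset.mem_filter.1 hℓ).1 (Finset.mem_filter.1 hm).1 h

/-! ### Planes in 3-space -/

def drop (j : Fin 3) : (Fin 3 → ℝ) →ₗ[ℝ] (Fin 2 → ℝ) :=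
  LinearMap.funLeft ℝ ℝ j.succAbove

lemma drop_apply (j : Fin 3) (x : Fin 3 → ℝ) (k : Fin 2) : drop j x k = x (j.succAbove k) := rfl

lemma drop_inj (v a : Fin 3 → ℝ) (j : Fin 3) (hj : v j ≠ 0) :
    Set.InjOn (drop j) (zeroSet (lin v a)) := by
  intro x hx y hy hxy
  rw [lin_mem, Fin.sum_univ_succAbove _ j] at hx hy
  have h : ∀ k, x (j.succAbove k) = y (j.succAbove k) := fun k => congrFun hxy k
  have h2 : x j = y j := by
    simp only [h] at hx
    have : v j * (x j - a j) = v j * (y j - a j) := by linarith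
    have := mul_left_cancel₀ hj this
    linarith
  funext i
  rcases Fin.eq_self_or_eq_succAbove j i with rfl | ⟨k, rfl⟩
  · exact h2
  · exact h k

lemma image_injOn {d d' : ℕ} (A : (Fin d → ℝ) →ₗ[ℝ] (Fin d' → ℝ)) (F : Set (Fin d → ℝ))
    (hA : Set.InjOn A F) (L : Finset (Set (Fin d → ℝ))) (hF : ∀ ℓ ∈ L, ℓ ⊆ F) :
    Set.InjOn (fun ℓ => A '' ℓ) (L : Set (Set (Fin d → ℝ))) := by
  intro ℓ hℓ m hm h
  exact (hA.image_eq_image_iff (hF ℓ hℓ) (hF m hm)).1 h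

theorem ST_plane (ε : ℝ) (hε : 0 < ε) : ∃ C : ℝ, 0 ≤ C ∧ ∀ (v a : Fin 3 → ℝ)
    (L : Finset (Set (Fin 3 → ℝ)))
    (P : Finset (Fin 3 → ℝ)) (r : ℕ), v ≠ 0 → 4 ≤ r → (∀ ℓ ∈ L, IsLine ℓ) →
    (∀ ℓ ∈ L, ℓ ⊆ zeroSet (lin v a)) → (∀ p ∈ P, r ≤ deg L p) →
    (P.card : ℝ) ≤ C * ((L.card : ℝ) ^ (2 + ε) / (r : ℝ) ^ 3 + (L.card : ℝ) / r) := by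
  obtain ⟨C, hC, H⟩ := ST ε hε
  refine ⟨C, hC, fun v a L P r hv hr hL hF hP => ?_⟩
  obtain ⟨j, hj⟩ := Function.ne_iff.1 hv
  have hinj := drop_inj v a j hj
  have hinjL := image_injOn (drop j) _ hinj L hF
  have hPF : (P : Set (Fin 3 → ℝ)) ⊆ zeroSet (lin v a) := by
    intro p hp
    have h1 := hP p hp
    have : 0 < deg L p := by omega
    obtain ⟨ℓ, hℓ⟩ := Finset.card_pos.1 this
    obtain ⟨h1, h2⟩ := Finset.mem_filter.1 hℓ
    exact hF ℓ h1 h2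
  have := H (imL (drop j) L) (P.image (drop j)) r hr
    (imL_isLine _ L hL (fun ℓ hℓ => hinj.mono (hF ℓ hℓ))) (by
      intro q hq
      obtain ⟨p, hp, rfl⟩ := Finset.mem_image.1 hq
      exact (hP p hp).trans (imL_deg _ L hinjL p))
  rw [Finset.card_image_of_injOn (hinj.mono hPF), imL_card _ L hinjL] at this
  exact this

/-- A polynomial that does not vanish on a plane contains few lines of that plane. -/
lemma lines_plane_count (v a : Fin 3 → ℝ) (hv : v ≠ 0) (g : MvPolynomial (Fin 3) ℝ)
    (hg : ¬ zeroSet (lin v a) ⊆ zeroSet g) (L : Finset (Set (Fin 3 → ℝ)))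
    (hL : ∀ ℓ ∈ L, IsLine ℓ ∧ ℓ ⊆ zeroSet (lin v a) ∧ ℓ ⊆ zeroSet g) : L.card ≤ g.totalDegree := by
  obtain ⟨j, hj⟩ := Function.ne_iff.1 hv
  simp only [Pi.zero_apply] at hj
  have hinj := drop_inj v a j hj
  have hinjL := image_injOn (drop j) _ hinj L (fun ℓ hℓ => (hL ℓ hℓ).2.1)
  let h : Fin 3 → MvPolynomial (Fin 2) ℝ := j.insertNth
    (MvPolynomial.C (a j) - MvPolynomial.C (v j)⁻¹ * lin (fun k => v (j.succAbove k)) (fun k => a (j.succAbove k)))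
    (fun k => MvPolynomial.X k)
  have hdeg : ∀ i, (h i).totalDegree ≤ 1 := by
    intro i
    rcases Fin.eq_self_or_eq_succAbove j i with rfl | ⟨k, rfl⟩
    · simp only [h, Fin.insertNth_apply_same]
      refine (MvPolynomial.totalDegree_sub _ _).trans (max_le (by simp) ?_)
      refine (MvPolynomial.totalDegree_mul _ _).trans ?_
      rw [MvPolynomial.totalDegree_C, zero_add]
      by_cases hz : (fun k => v (i.succAbove k)) = 0
      · rw [hz]; simp [lin]
      · rw [lin_deg _ _ hz]
    · simp [h]
  have hback : ∀ x ∈ zeroSet (lin v a), (fun i => MvPolynomial.eval (drop j x) (h i)) = x := by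
    intro x hx
    rw [lin_mem, Fin.sum_univ_succAbove _ j] at hx
    funext i
    rcases Fin.eq_self_or_eq_succAbove j i with rfl | ⟨k, rfl⟩
    · simp only [h, Fin.insertNth_apply_same, map_sub, MvPolynomial.eval_C, map_mul, lin_eval, drop_apply]
      have : ∑ k, v (i.succAbove k) * (x (i.succAbove k) - a (i.succAbove k)) = - (v i * (x i - a i)) := by
        linarith
      rw [this]
      field_simp
      ring
    · simp [h, drop_apply]
  set g' := MvPolynomial.aeval h g with hg'
  have hg'0 : g' ≠ 0 := by
    intro h0
    apply hg
    intro x hx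
    have := aeval_eval h g (drop j x)
    rw [← hg', h0, map_zero, hback x hx] at this
    exact this.symm
  have := lines2_count g' hg'0 (imL (drop j) L) (by
    intro ℓ hℓ
    refine ⟨imL_isLine _ L (fun ℓ hℓ => (hL ℓ hℓ).1) (fun ℓ hℓ => hinj.mono (hL ℓ hℓ).2.1) ℓ hℓ, ?_⟩
    obtain ⟨m, hm, rfl⟩ := Finset.mem_image.1 hℓ
    rintro _ ⟨x, hx, rfl⟩
    rw [zeroSet, Set.mem_ofPred_eq, hg', aeval_eval, hback x ((hL m hm).2.1 hx)]
    exact (hL m hm).2.2 hx)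
  rw [imL_card _ L hinjL] at this
  exact this.trans (aeval_deg h hdeg g)

end PL

end Part7

section Part8
open Filter Topology

namespace PL

/-! ### Elimination by a dimension count -/

/-- polynomials with degree in the `i`-th variable at most `k i` -/
def box (k : Fin 3 → ℕ) : Submodule ℝ (MvPolynomial (Fin 3) ℝ) :=
  MvPolynomial.restrictSupport ℝ {m | ∀ i, m i ≤ k i}

lemma mem_box (k : Fin 3 → ℕ) (f : MvPolynomial (Fin 3) ℝ) :
    f ∈ box k ↔ ∀ i, f.degreeOf i ≤ k i := by
  unfold box
  rw [MvPolynomial.mem_restrictSupport_iff]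
  simp only [MvPolynomial.degreeOf_le_iff]
  constructor
  · intro h i m hm
    exact h hm i
  · intro h m hm i
    exact h i m hm

lemma box_set (k : Fin 3 → ℕ) : {m : Fin 3 →₀ ℕ | ∀ i, m i ≤ k i} =
    ((Finset.Iic (Finsupp.equivFunOnFinite.symm k) : Finset (Fin 3 →₀ ℕ)) : Set (Fin 3 →₀ ℕ)) := by
  ext m
  simp [Finsupp.le_def]

instance box_fin (k : Fin 3 → ℕ) : FiniteDimensional ℝ (box k) := by
  have : Finite ({m : Fin 3 →₀ ℕ | ∀ i, m i ≤ k i} : Set _) := by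
    rw [box_set]; exact Finset.finite_toSet _
  exact Module.Finite.of_basis (MvPolynomial.basisRestrictSupport ℝ {m : Fin 3 →₀ ℕ | ∀ i, m i ≤ k i})

lemma box_rank (k : Fin 3 → ℕ) : Module.finrank ℝ (box k) = ∏ i, (k i + 1) := by
  rw [box, Module.finrank_eq_nat_card_basis (MvPolynomial.basisRestrictSupport ℝ _), box_set]
  rw [Nat.card_coe_set_eq, Set.ncard_coe_finset, Finsupp.card_Iic]
  rw [Finset.prod_subset (Finset.subset_univ _)]
  · simp
  · intro i _ hi
    simp at hi
    simp [hi]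

lemma map_mul_rank (g : MvPolynomial (Fin 3) ℝ) (hg : g ≠ 0) (W : Submodule ℝ (MvPolynomial (Fin 3) ℝ)) :
    Module.finrank ℝ (W.map (LinearMap.mulLeft ℝ g)) = Module.finrank ℝ W := by
  have hi : Function.Injective (LinearMap.mulLeft ℝ g) := by
    intro x y h
    exact mul_left_cancel₀ hg h
  exact (LinearEquiv.finrank_eq (Submodule.equivMapOfInjective _ hi W)).symm

lemma poly_ineq (x E a0 a1 a2 b0 b1 b2 : ℤ) (h0 : 0 ≤ a0) (h1 : 0 ≤ a1) (h2 : 0 ≤ a2) (h3 : 0 ≤ b0)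
    (h4 : 0 ≤ b1) (h5 : 0 ≤ b2) (k0 : a0 ≤ E) (k1 : a1 ≤ E) (k2 : a2 ≤ E) (k3 : b0 ≤ E)
    (k4 : b1 ≤ E) (k5 : b2 ≤ E) (hx : 6 * E ^ 2 < x) :
    x ^ 3 + (x - a0 - b0) * (x - a1 - b1) * (x - a2 - b2) <
      (x - a0) * (x - a1) * (x - a2) + (x - b0) * (x - b1) * (x - b2) + x ^ 2 := by
  have hE : 0 ≤ E := h0.trans k0
  have m : ∀ a b : ℤ, 0 ≤ a → 0 ≤ b → a ≤ E → b ≤ E → a * b ≤ E ^ 2 := by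
    intro a b ha hb hae hbe
    nlinarith
  have hx0 : 0 < x := by nlinarith [sq_nonneg E]
  have e : (x - a0) * (x - a1) * (x - a2) + (x - b0) * (x - b1) * (x - b2) + x ^ 2 -
    (x ^ 3 + (x - a0 - b0) * (x - a1 - b1) * (x - a2 - b2)) =
    x * (x - (a0 * b1 + a0 * b2 + a1 * b0 + a1 * b2 + a2 * b0 + a2 * b1)) +
      (a0 * a1 * b2 + a0 * b1 * a2 + b0 * a1 * a2 + a0 * b1 * b2 + b0 * a1 * b2 + b0 * b1 * a2) := by
    ring
  have p1 : 0 ≤ (a0 * a1 * b2 + a0 * b1 * a2 + b0 * a1 * a2 + a0 * b1 * b2 + b0 * a1 * b2 + b0 * b1 * a2) := by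
    positivity
  have p2 : 0 < x * (x - (a0 * b1 + a0 * b2 + a1 * b0 + a1 * b2 + a2 * b0 + a2 * b1)) := by
    apply mul_pos hx0
    have := m a0 b1 h0 h4 k0 k4
    have := m a0 b2 h0 h5 k0 k5
    have := m a1 b0 h1 h3 k1 k3
    have := m a1 b2 h1 h5 k1 k5
    have := m a2 b0 h2 h3 k2 k3
    have := m a2 b1 h2 h4 k2 k4
    linarith
  linarith

lemma elim_exists (g h : MvPolynomial (Fin 3) ℝ) (hg : Irreducible g) (hh : h ≠ 0) (hgh : ¬ g ∣ h)
    (E : ℕ) (hgE : g.totalDegree ≤ E) (hhE : h.totalDegree ≤ E) (j : Fin 3) :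
    ∃ R u w : MvPolynomial (Fin 3) ℝ, R ≠ 0 ∧ R = g * u + h * w ∧ R.degreeOf j = 0 ∧
      ∀ i, R.degreeOf i ≤ 6 * E ^ 2 + 2 * E := by
  set K := 6 * E ^ 2 + 2 * E with hK
  have hg0 : g ≠ 0 := hg.ne_zero
  have ha : ∀ i, g.degreeOf i ≤ E := fun i => (MvPolynomial.degreeOf_le_totalDegree _ _).trans hgE
  have hb : ∀ i, h.degreeOf i ≤ E := fun i => (MvPolynomial.degreeOf_le_totalDegree _ _).trans hhE
  let A := (box (fun i => K - g.degreeOf i)).map (LinearMap.mulLeft ℝ g)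
  let B := (box (fun i => K - h.degreeOf i)).map (LinearMap.mulLeft ℝ h)
  let D := (box (fun i => K - g.degreeOf i - h.degreeOf i)).map (LinearMap.mulLeft ℝ (g * h))
  let W := box (fun i => if i = j then 0 else K)
  have hA : Module.finrank ℝ A = ∏ i, (K - g.degreeOf i + 1) := by
    rw [map_mul_rank g hg0, box_rank]
  have hB : Module.finrank ℝ B = ∏ i, (K - h.degreeOf i + 1) := by
    rw [map_mul_rank h hh, box_rank]
  have hD : Module.finrank ℝ D = ∏ i, (K - g.degreeOf i - h.degreeOf i + 1) := by
    rw [map_mul_rank _ (mul_ne_zero hg0 hh), box_rank]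
  have hW : Module.finrank ℝ W = (K + 1) ^ 2 := by
    rw [box_rank]
    fin_cases j <;> simp [Fin.prod_univ_three] <;> ring
  have hAB : A ⊓ B ≤ D := by
    rintro x ⟨⟨u, hu, rfl⟩, ⟨w, hw, hwu⟩⟩
    simp only [LinearMap.mulLeft_apply] at hwu ⊢
    by_cases hu0 : u = 0
    · rw [hu0, mul_zero]; exact zero_mem _
    have hdvd : g ∣ h * w := ⟨u, hwu⟩
    obtain ⟨w', rfl⟩ := (hg.prime.dvd_or_dvd hdvd).resolve_left hgh
    have hu' : u = h * w' := by
      apply mul_left_cancel₀ hg0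
      rw [← hwu]; ring
    have hw'0 : w' ≠ 0 := by
      rintro rfl
      apply hu0; rw [hu', mul_zero]
    refine ⟨w', ?_, ?_⟩
    · have hu : u ∈ box _ := hu
      show w' ∈ box _
      rw [mem_box] at hu ⊢
      intro i
      have := hu i
      rw [hu', MvPolynomial.degreeOf_mul_eq hh hw'0] at this
      have := ha i
      have := hb i
      have : 2 * E ≤ K := by rw [hK]; omega
      omega
    · simp only [LinearMap.mulLeft_apply]
      rw [hu']; ring
  have hAV : A ≤ box (fun _ => K) := by
    rintro _ ⟨u, hu, rfl⟩
    have hu : u ∈ box _ := hu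
    rw [mem_box] at hu ⊢
    intro i
    simp only [LinearMap.mulLeft_apply]
    have := MvPolynomial.degreeOf_mul_le i g u
    have := hu i
    have := ha i
    have : 2 * E ≤ K := by rw [hK]; omega
    omega
  have hBV : B ≤ box (fun _ => K) := by
    rintro _ ⟨u, hu, rfl⟩
    have hu : u ∈ box _ := hu
    rw [mem_box] at hu ⊢
    intro i
    simp only [LinearMap.mulLeft_apply]
    have := MvPolynomial.degreeOf_mul_le i h u
    have := hu i
    have := hb i
    have : 2 * E ≤ K := by rw [hK]; omega
    omega
  have hWV : W ≤ box (fun _ => K) := by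
    intro x hx
    rw [mem_box] at hx ⊢
    intro i
    refine (hx i).trans ?_
    split_ifs <;> omega
  have e1 := Submodule.finrank_sup_add_finrank_inf_eq A B
  have e2 := Submodule.finrank_sup_add_finrank_inf_eq (A ⊔ B) W
  have e3 : Module.finrank ℝ ↥(A ⊓ B) ≤ Module.finrank ℝ D := Submodule.finrank_mono hAB
  have e4 : Module.finrank ℝ ↥(A ⊔ B ⊔ W) ≤ Module.finrank ℝ (box (fun _ => K)) :=
    Submodule.finrank_mono (sup_le (sup_le hAV hBV) hWV)
  rw [box_rank] at e4
  rw [hA, hB] at e1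
  rw [hD] at e3
  rw [hW] at e2
  have key : (K + 1) ^ 3 + ∏ i, (K - g.degreeOf i - h.degreeOf i + 1) <
      ∏ i, (K - g.degreeOf i + 1) + ∏ i, (K - h.degreeOf i + 1) + (K + 1) ^ 2 := by
    have h2 : 2 * E ≤ K := by rw [hK]; omega
    zify
    have z1 : ∀ i, ((K - g.degreeOf i - h.degreeOf i : ℕ) : ℤ) = K - g.degreeOf i - h.degreeOf i := by
      intro i; have := ha i; have := hb i; omega
    have z2 : ∀ i, ((K - g.degreeOf i : ℕ) : ℤ) = K - g.degreeOf i := by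
      intro i; have := ha i; have := hb i; omega
    have z3 : ∀ i, ((K - h.degreeOf i : ℕ) : ℤ) = K - h.degreeOf i := by
      intro i; have := ha i; have := hb i; omega
    simp only [z1, z2, z3, Fin.prod_univ_three]
    have := poly_ineq (K + 1) E (g.degreeOf 0) (g.degreeOf 1) (g.degreeOf 2) (h.degreeOf 0)
      (h.degreeOf 1) (h.degreeOf 2) (by positivity) (by positivity) (by positivity) (by positivity)
      (by positivity) (by positivity) (by exact_mod_cast ha 0) (by exact_mod_cast ha 1)
      (by exact_mod_cast ha 2) (by exact_mod_cast hb 0) (by exact_mod_cast hb 1)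
      (by exact_mod_cast hb 2) (by rw [hK]; push_cast; linarith)
    nlinarith [this]
  have hpos : 0 < Module.finrank ℝ ↥((A ⊔ B) ⊓ W) := by
    simp only [Fin.prod_univ_three] at *
    have : (K+1)*(K+1)*(K+1) = (K+1)^3 := by ring
    omega
  have : Nontrivial ↥((A ⊔ B) ⊓ W) := Module.finrank_pos_iff.1 hpos
  obtain ⟨⟨R, hR⟩, hR0⟩ := exists_ne (0 : ↥((A ⊔ B) ⊓ W))
  obtain ⟨hR1, hR2⟩ := hR
  obtain ⟨_, ⟨u, hu, rfl⟩, _, ⟨w, hw, rfl⟩, hsum⟩ := Submodule.mem_sup.1 hR1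
  have hR2 : R ∈ W := hR2
  rw [mem_box] at hR2
  refine ⟨R, u, w, ?_, hsum.symm, ?_, ?_⟩
  · intro h; apply hR0; ext1; exact h
  · have := hR2 j
    simpa using this
  · intro i
    refine (hR2 i).trans ?_
    split_ifs <;> omega

/-- `g` vanishes on no plane -/
def NP (g : MvPolynomial (Fin 3) ℝ) : Prop :=
  ∀ v a : Fin 3 → ℝ, v ≠ 0 → ¬ zeroSet (lin v a) ⊆ zeroSet g

lemma eval_indep (R : MvPolynomial (Fin 3) ℝ) (j : Fin 3) (hj : R.degreeOf j = 0) (x y : Fin 3 → ℝ)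
    (h : ∀ i, i ≠ j → x i = y i) : MvPolynomial.eval x R = MvPolynomial.eval y R := by
  rw [MvPolynomial.eval_eq, MvPolynomial.eval_eq]
  apply Finset.sum_congr rfl
  intro m hm
  congr 1
  apply Finset.prod_congr rfl
  intro i _
  by_cases hi : i = j
  · subst hi
    have := (MvPolynomial.degreeOf_le_iff.1 hj.le) m hm
    have : m i = 0 := by omega
    rw [this]; simp
  · rw [h i hi]

lemma bez_dir (g h : MvPolynomial (Fin 3) ℝ) (hg : Irreducible g) (hnp : NP g) (hh : h ≠ 0)
    (hgh : ¬ g ∣ h) (E : ℕ) (hgE : g.totalDegree ≤ E) (hhE : h.totalDegree ≤ E) (j : Fin 3)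
    (L : Finset (Set (Fin 3 → ℝ))) (hL : ∀ ℓ ∈ L, IsLine ℓ ∧ ℓ ⊆ zeroSet g ∧ ℓ ⊆ zeroSet h)
    (hinj : ∀ ℓ ∈ L, Set.InjOn (drop j) ℓ) : L.card ≤ E * (3 * (6 * E ^ 2 + 2 * E)) := by
  obtain ⟨R, u, w, hR0, hR, hRj, hRd⟩ := elim_exists g h hg hh hgh E hgE hhE j
  let s : Fin 3 → MvPolynomial (Fin 2) ℝ := j.insertNth 0 (fun k => MvPolynomial.X k)
  have hs : ∀ i, (s i).totalDegree ≤ 1 := by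
    intro i
    rcases Fin.eq_self_or_eq_succAbove j i with rfl | ⟨k, rfl⟩
    · simp [s]
    · simp [s]
  set R' := MvPolynomial.aeval s R with hR'
  have hev : ∀ x, MvPolynomial.eval (drop j x) R' = MvPolynomial.eval x R := by
    intro x
    rw [hR', aeval_eval]
    apply eval_indep R j hRj
    intro i hi
    rcases Fin.eq_self_or_eq_succAbove j i with rfl | ⟨k, rfl⟩
    · exact absurd rfl hi
    · simp [s, drop_apply]
  have hR'0 : R' ≠ 0 := by
    intro h0
    apply hR0
    apply MvPolynomial.funext
    intro x
    rw [← hev, h0, map_zero, map_zero]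
  have hdeg : R'.totalDegree ≤ 3 * (6 * E ^ 2 + 2 * E) := by
    refine (aeval_deg s hs R).trans ?_
    rw [MvPolynomial.totalDegree_eq]
    apply Finset.sup_le
    intro m hm
    rw [Finsupp.card_toMultiset, Finsupp.sum_fintype _ _ (fun _ => rfl), Fin.sum_univ_three]
    have := fun i => (MvPolynomial.degreeOf_le_iff.1 (hRd i)) m hm
    have h0 := this 0
    have h1 := this 1
    have h2 := this 2
    simp only [id]
    omega
  have hcard : (imL (drop j) L).card ≤ 3 * (6 * E ^ 2 + 2 * E) := by
    refine (lines2_count R' hR'0 (imL (drop j) L) ?_).trans hdeg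
    intro ℓ hℓ
    refine ⟨imL_isLine _ L (fun ℓ hℓ => (hL ℓ hℓ).1) hinj ℓ hℓ, ?_⟩
    obtain ⟨m, hm, rfl⟩ := Finset.mem_image.1 hℓ
    rintro _ ⟨x, hx, rfl⟩
    rw [zeroSet, Set.mem_ofPred_eq, hev, hR, map_add, map_mul, map_mul]
    have h1 : MvPolynomial.eval x g = 0 := (hL m hm).2.1 hx
    have h2 : MvPolynomial.eval x h = 0 := (hL m hm).2.2 hx
    rw [h1, h2]; simp
  refine le_trans (Finset.card_le_mul_card_image (f := fun ℓ => drop j '' ℓ) L E ?_)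
    (Nat.mul_le_mul_left _ hcard)
  intro m hm
  have hml : IsLine m := imL_isLine _ L (fun ℓ hℓ => (hL ℓ hℓ).1) hinj m hm
  obtain ⟨a, b, hb, hab⟩ := hml
  have hab : m = mkLine a b := hab
  rw [line2_eq a b hb] at hab
  set v2 : Fin 2 → ℝ := ![b 1, -b 0] with hv2
  let v : Fin 3 → ℝ := j.insertNth 0 v2
  let a' : Fin 3 → ℝ := j.insertNth 0 a
  have hv : v ≠ 0 := by
    intro h0
    apply hb
    have e0 := congrFun h0 (j.succAbove 0)
    have e1 := congrFun h0 (j.succAbove 1)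
    simp [v, hv2] at e0 e1
    funext i; fin_cases i <;> simp [e0, e1]
  refine (lines_plane_count v a' hv g (hnp v a' hv) _ ?_).trans hgE
  intro ℓ hℓ
  obtain ⟨h1, h2⟩ := Finset.mem_filter.1 hℓ
  refine ⟨(hL ℓ h1).1, ?_, (hL ℓ h1).2.1⟩
  intro x hx
  have : drop j x ∈ m := by rw [← h2]; exact Set.mem_image_of_mem _ hx
  rw [hab, lin_mem] at this
  rw [lin_mem, Fin.sum_univ_succAbove _ j]
  simpa [v, a', drop_apply] using this

/-- Bezout-type bound for lines -/
lemma bez (g h : MvPolynomial (Fin 3) ℝ) (hg : Irreducible g) (hnp : NP g) (hh : h ≠ 0)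
    (hgh : ¬ g ∣ h) (E : ℕ) (hgE : g.totalDegree ≤ E) (hhE : h.totalDegree ≤ E)
    (L : Finset (Set (Fin 3 → ℝ))) (hL : ∀ ℓ ∈ L, IsLine ℓ ∧ ℓ ⊆ zeroSet g ∧ ℓ ⊆ zeroSet h) :
    L.card ≤ 2 * (E * (3 * (6 * E ^ 2 + 2 * E))) := by
  have h1 : L ⊆ L.filter (fun ℓ => Set.InjOn (drop 0) ℓ) ∪ L.filter (fun ℓ => Set.InjOn (drop 2) ℓ) := by
    intro ℓ hℓ
    rw [Finset.mem_union, Finset.mem_filter, Finset.mem_filter]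
    obtain ⟨a, b, hb, hab⟩ := (hL ℓ hℓ).1
    have key : ∀ (j : Fin 3) (k : Fin 2), b (j.succAbove k) ≠ 0 → Set.InjOn (drop j) ℓ := by
      intro j k hk
      rw [hab]
      rintro _ ⟨t, rfl⟩ _ ⟨t', rfl⟩ he
      have := congrFun he k
      simp [drop_apply, hk] at this
      rw [this]
    by_cases h0 : b 0 = 0
    · by_cases h1 : b 1 = 0
      · have h2 : b 2 ≠ 0 := by
          intro h2; apply hb; funext i; fin_cases i <;> simp [h0, h1, h2]
        exact Or.inl ⟨hℓ, key 0 1 h2⟩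
      · exact Or.inl ⟨hℓ, key 0 0 h1⟩
    · exact Or.inr ⟨hℓ, key 2 0 h0⟩
  refine (Finset.card_le_card h1).trans ((Finset.card_union_le _ _).trans ?_)
  have a1 := bez_dir g h hg hnp hh hgh E hgE hhE 0 (L.filter (fun ℓ => Set.InjOn (drop 0) ℓ))
    (fun ℓ hℓ => hL ℓ (Finset.mem_filter.1 hℓ).1) (fun ℓ hℓ => (Finset.mem_filter.1 hℓ).2)
  have a2 := bez_dir g h hg hnp hh hgh E hgE hhE 2 (L.filter (fun ℓ => Set.InjOn (drop 2) ℓ))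
    (fun ℓ hℓ => hL ℓ (Finset.mem_filter.1 hℓ).1) (fun ℓ hℓ => (Finset.mem_filter.1 hℓ).2)
  omega

end PL

end Part8

section Part9
open Filter Topology

namespace PL

/-! ### Derivatives -/

lemma pderiv_deg {d : ℕ} (i : Fin d) (f : MvPolynomial (Fin d) ℝ) (h : MvPolynomial.pderiv i f ≠ 0) :
    (MvPolynomial.pderiv i f).totalDegree + 1 ≤ f.totalDegree := by
  obtain ⟨m, hm, he⟩ := Finset.exists_mem_eq_sup _ (MvPolynomial.support_nonempty.2 h)
    (fun m => Multiset.card (Finsupp.toMultiset m))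
  rw [MvPolynomial.totalDegree_eq, he]
  have h1 : m + Finsupp.single i 1 ∈ f.support := by
    rw [MvPolynomial.mem_support_iff, MvPolynomial.coeff_pderiv] at hm
    rw [MvPolynomial.mem_support_iff]
    exact left_ne_zero_of_mul hm
  have := MvPolynomial.le_totalDegree h1
  rw [Finsupp.sum_add_index' (by simp) (by simp)] at this
  rw [Finsupp.card_toMultiset]
  simp only [Finsupp.sum_single_index] at this
  exact this

lemma pderiv_deg_le {d : ℕ} (i : Fin d) (f : MvPolynomial (Fin d) ℝ) :
    (MvPolynomial.pderiv i f).totalDegree ≤ f.totalDegree := by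
  by_cases h : MvPolynomial.pderiv i f = 0
  · rw [h]; simp
  · have := pderiv_deg i f h; omega

lemma pderiv_comm {d : ℕ} (i j : Fin d) (f : MvPolynomial (Fin d) ℝ) :
    MvPolynomial.pderiv i (MvPolynomial.pderiv j f) = MvPolynomial.pderiv j (MvPolynomial.pderiv i f) := by
  by_cases h : i = j
  · subst h; rfl
  ext m
  simp only [MvPolynomial.coeff_pderiv]
  rw [add_right_comm]
  simp [Finsupp.single_apply, h, Ne.symm h]
  ring

lemma exists_pderiv {d : ℕ} (g : MvPolynomial (Fin d) ℝ) (hg : Irreducible g) :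
    ∃ i, MvPolynomial.pderiv i g ≠ 0 ∧ ¬ g ∣ MvPolynomial.pderiv i g := by
  have h1 : ∃ m ∈ g.support, m ≠ 0 := by
    by_contra hcon
    push Not at hcon
    apply hg.not_isUnit
    have h0 : g = MvPolynomial.C (MvPolynomial.coeff 0 g) := by
      ext m
      rw [MvPolynomial.coeff_C]
      split_ifs with h
      · rw [h]
      · by_contra h2
        exact h (hcon m (MvPolynomial.mem_support_iff.2 h2)).symm
    have hc : MvPolynomial.coeff 0 g ≠ 0 := by
      intro h
      rw [h, map_zero] at h0
      exact hg.ne_zero h0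
    rw [h0]
    exact (IsUnit.mk0 _ hc).map MvPolynomial.C
  obtain ⟨m, hm, hm0⟩ := h1
  obtain ⟨i, hi⟩ := Finsupp.ne_iff.1 hm0
  simp only [Finsupp.coe_zero, Pi.zero_apply] at hi
  have hne : MvPolynomial.pderiv i g ≠ 0 := by
    intro h
    have h2 := MvPolynomial.coeff_pderiv (i := i) g (m - Finsupp.single i 1)
    have h3 : m - Finsupp.single i 1 + Finsupp.single i 1 = m := by
      apply tsub_add_cancel_of_le
      rw [Finsupp.single_le_iff]; omega
    rw [h, h3] at h2
    have h4 := MvPolynomial.mem_support_iff.1 hm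
    simp only [MvPolynomial.coeff_zero] at h2
    rcases mul_eq_zero.1 h2.symm with h5 | h5
    · exact h4 h5
    · have := Nat.cast_nonneg (α := ℝ) ((m - Finsupp.single i 1 : Fin d →₀ ℕ) i)
      linarith
  refine ⟨i, hne, ?_⟩
  rintro ⟨q, hq⟩
  have h5 := pderiv_deg i g hne
  have hq0 : q ≠ 0 := by rintro rfl; rw [mul_zero] at hq; exact hne hq
  rw [hq, MvPolynomial.totalDegree_mul_of_isDomain hg.ne_zero hq0] at h5
  omega

lemma lp_deriv {d : ℕ} (f : MvPolynomial (Fin d) ℝ) (a b : Fin d → ℝ) :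
    Polynomial.derivative (lp f a b) =
      ∑ i, Polynomial.C (b i) * lp (MvPolynomial.pderiv i f) a b := by
  induction f using MvPolynomial.induction_on with
  | C r => simp [lp]
  | add p q hp hq =>
    rw [lp_add, map_add, hp, hq, ← Finset.sum_add_distrib]
    apply Finset.sum_congr rfl
    intro i _
    rw [map_add, lp_add]; ring
  | mul_X p k hp =>
    have hX : lp (MvPolynomial.X k) a b = Polynomial.C (a k) + Polynomial.C (b k) * Polynomial.X := by
      simp [lp]
    rw [lp_mul, Polynomial.derivative_mul, hp]
    have h1 : ∀ i, lp (MvPolynomial.pderiv i (p * MvPolynomial.X k)) a b =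
        lp (MvPolynomial.pderiv i p) a b * lp (MvPolynomial.X k) a b +
          lp p a b * (if i = k then 1 else 0) := by
      intro i
      rw [Derivation.leibniz, MvPolynomial.pderiv_X]
      by_cases h : i = k
      · subst h; simp [lp]; ring
      · simp [lp, h, Pi.single_apply, Ne.symm h]; ring
    simp only [h1]
    have h2 : ∀ i, Polynomial.C (b i) * (lp (MvPolynomial.pderiv i p) a b * lp (MvPolynomial.X k) a b +
          lp p a b * (if i = k then 1 else 0)) =
        Polynomial.C (b i) * lp (MvPolynomial.pderiv i p) a b * lp (MvPolynomial.X k) a b +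
          (if i = k then lp p a b * Polynomial.C (b k) else 0) := by
      intro i; split_ifs with h
      · subst h; ring
      · ring
    simp only [h2, Finset.sum_add_distrib, Finset.sum_ite_eq', Finset.mem_univ, if_true]
    rw [Finset.sum_mul]
    congr 2
    rw [hX]; simp

lemma lp_eval0 {d : ℕ} (f : MvPolynomial (Fin d) ℝ) (a b : Fin d → ℝ) :
    (lp f a b).eval 0 = MvPolynomial.eval a f := by
  rw [lp_eval]; simp

/-- first and second order conditions along a line contained in the zero set -/
lemma first_order {d : ℕ} (g : MvPolynomial (Fin d) ℝ) (p b : Fin d → ℝ) (h : mkLine p b ⊆ zeroSet g) :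
    ∑ i, b i * MvPolynomial.eval p (MvPolynomial.pderiv i g) = 0 := by
  have h0 := (lp_eq_zero_iff g p b).2 h
  have h1 := lp_deriv g p b
  rw [h0, map_zero] at h1
  have := congrArg (Polynomial.eval 0) h1
  simpa [Polynomial.eval_finsetSum, lp_eval0] using this.symm

lemma second_order {d : ℕ} (g : MvPolynomial (Fin d) ℝ) (p b : Fin d → ℝ) (h : mkLine p b ⊆ zeroSet g) :
    ∑ i, b i * ∑ j, b j *
      MvPolynomial.eval p (MvPolynomial.pderiv j (MvPolynomial.pderiv i g)) = 0 := by
  have h0 := (lp_eq_zero_iff g p b).2 h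
  have h1 := lp_deriv g p b
  rw [h0, map_zero] at h1
  have h2 := congrArg Polynomial.derivative h1
  rw [map_zero, map_sum] at h2
  have := congrArg (Polynomial.eval 0) h2
  simpa [Polynomial.eval_finsetSum, lp_eval0, lp_deriv] using this.symm

lemma wronsk (A D : Polynomial ℝ) (h : A * Polynomial.derivative D = D * Polynomial.derivative A)
    (t : ℝ) (hD : D.eval t ≠ 0) (hA : A.eval t = 0) : A = 0 := by
  by_contra hA0
  have hD0 : D ≠ 0 := by rintro rfl; simp at hD
  have hA' : Polynomial.derivative A ≠ 0 := by
    intro h0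
    have := Polynomial.derivative_eq_zero.1 h0
    obtain ⟨c, hc⟩ := Polynomial.natDegree_eq_zero.1 this
    rw [← hc] at hA hA0
    simp at hA hA0
    exact hA0 hA
  have hne : D * Polynomial.derivative A ≠ 0 := mul_ne_zero hD0 hA'
  have h1 := Polynomial.rootMultiplicity_mul (x := t) hne
  have h2 := Polynomial.rootMultiplicity_mul (x := t) (h ▸ hne)
  have h3 := Polynomial.derivative_rootMultiplicity_of_root (p := A) (t := t) hA
  have h4 : D.rootMultiplicity t = 0 := Polynomial.rootMultiplicity_eq_zero hD
  have h5 : 0 < A.rootMultiplicity t := (Polynomial.rootMultiplicity_pos hA0).2 hA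
  rw [h] at h2
  omega

/-! ### Vectors in 3-space -/

lemma par_of_cross (u b : Fin 3 → ℝ) (hu : u ≠ 0) (h : ∀ i j, u i * b j = u j * b i) :
    ∃ c : ℝ, b = c • u := by
  obtain ⟨k, hk⟩ := Function.ne_iff.1 hu
  simp only [Pi.zero_apply] at hk
  refine ⟨b k / u k, ?_⟩
  funext i
  simp only [Pi.smul_apply, smul_eq_mul]
  field_simp
  have := h k i
  linarith

lemma cross_zero (N w b1 b2 : Fin 3 → ℝ) (hb1 : b1 ≠ 0)
    (h1 : ∑ i, b1 i * N i = 0) (h2 : ∑ i, b2 i * N i = 0) (h3 : ∑ i, b1 i * w i = 0)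
    (h4 : ∑ i, b2 i * w i = 0) (hnp : ¬ ∃ c : ℝ, b2 = c • b1) (i j : Fin 3) :
    N i * w j = N j * w i := by
  simp only [Fin.sum_univ_three] at h1 h2 h3 h4
  -- u = N × w
  let u : Fin 3 → ℝ := ![N 1 * w 2 - N 2 * w 1, N 2 * w 0 - N 0 * w 2, N 0 * w 1 - N 1 * w 0]
  have hu : u = 0 := by
    by_contra hu
    have key : ∀ b : Fin 3 → ℝ, b 0 * N 0 + b 1 * N 1 + b 2 * N 2 = 0 →
        b 0 * w 0 + b 1 * w 1 + b 2 * w 2 = 0 → ∀ i j, u i * b j = u j * b i := by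
      intro b e1 e2 i j
      have a01 : u 0 * b 1 = u 1 * b 0 := by
        simp [u]; linear_combination w 2 * e1 - N 2 * e2
      have a12 : u 1 * b 2 = u 2 * b 1 := by
        simp [u]; linear_combination w 0 * e1 - N 0 * e2
      have a02 : u 0 * b 2 = u 2 * b 0 := by
        simp [u]; linear_combination - w 1 * e1 + N 1 * e2
      fin_cases i <;> fin_cases j <;> first | rfl | assumption | (symm; assumption)
    obtain ⟨c1, hc1⟩ := par_of_cross u b1 hu (key b1 h1 h3)
    obtain ⟨c2, hc2⟩ := par_of_cross u b2 hu (key b2 h2 h4)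
    have hc10 : c1 ≠ 0 := by rintro rfl; simp at hc1; exact hb1 hc1
    apply hnp
    refine ⟨c2 / c1, ?_⟩
    rw [hc1, smul_smul, div_mul_cancel₀ _ hc10, hc2]
  have e0 := congrFun hu 0
  have e1 := congrFun hu 1
  have e2 := congrFun hu 2
  simp [u] at e0 e1 e2
  fin_cases i <;> fin_cases j <;> simp <;> linarith

/-- three pairwise non-parallel asymptotic directions in the tangent plane -/
lemma three_dirs (N : Fin 3 → ℝ) (H : Fin 3 → Fin 3 → ℝ) (hN : N ≠ 0) (hs : ∀ i j, H i j = H j i)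
    (b1 b2 b3 : Fin 3 → ℝ) (hb1 : b1 ≠ 0) (hb2 : b2 ≠ 0) (hb3 : b3 ≠ 0)
    (h12 : ¬ ∃ c : ℝ, b2 = c • b1) (h13 : ¬ ∃ c : ℝ, b3 = c • b1) (h23 : ¬ ∃ c : ℝ, b3 = c • b2)
    (n1 : ∑ i, b1 i * N i = 0) (n2 : ∑ i, b2 i * N i = 0) (n3 : ∑ i, b3 i * N i = 0)
    (q1 : ∑ i, b1 i * ∑ j, b1 j * H i j = 0) (q2 : ∑ i, b2 i * ∑ j, b2 j * H i j = 0)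
    (q3 : ∑ i, b3 i * ∑ j, b3 j * H i j = 0) (i j : Fin 3) :
    N i * (∑ k, b1 k * H j k) = N j * (∑ k, b1 k * H i k) := by
  have hdep : ∃ y : Fin 3 → ℝ, y ≠ 0 ∧ ∀ k, y 0 * b1 k + y 1 * b2 k + y 2 * b3 k = 0 := by
    let M : Matrix (Fin 3) (Fin 3) ℝ := ![b1, b2, b3]
    have hdet : M.det = 0 := by
      apply Matrix.exists_mulVec_eq_zero_iff.1
      refine ⟨N, hN, ?_⟩
      funext i
      fin_cases i
      · simpa [M, Matrix.mulVec, dotProduct] using n1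
      · simpa [M, Matrix.mulVec, dotProduct] using n2
      · simpa [M, Matrix.mulVec, dotProduct] using n3
    obtain ⟨y, hy, hyM⟩ := Matrix.exists_vecMul_eq_zero_iff.2 hdet
    refine ⟨y, hy, fun k => ?_⟩
    have := congrFun hyM k
    simpa [M, Matrix.vecMul, dotProduct, Fin.sum_univ_three] using this
  obtain ⟨y, hy, hdep⟩ := hdep
  have npar : ∀ (u w : Fin 3 → ℝ) (α β : ℝ), u ≠ 0 → (¬ ∃ c : ℝ, w = c • u) →
      (∀ k, α * u k + β * w k = 0) → α = 0 ∧ β = 0 := by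
    intro u w α β hu huw h
    have hβ : β = 0 := by
      by_contra hβ
      apply huw
      refine ⟨-α / β, ?_⟩
      funext k
      simp only [Pi.smul_apply, smul_eq_mul]
      field_simp
      linarith [h k]
    refine ⟨?_, hβ⟩
    by_contra hα
    apply hu
    funext k
    have := h k
    rw [hβ, zero_mul, add_zero] at this
    exact (mul_eq_zero.1 this).resolve_left hα
  have y0 : y 0 ≠ 0 := by
    intro h
    obtain ⟨e1, e2⟩ := npar b2 b3 (y 1) (y 2) hb2 h23 (fun k => by have := hdep k; rw [h] at this; linarith)
    apply hy; funext i; fin_cases i <;> simp [h, e1, e2]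
  have y1 : y 1 ≠ 0 := by
    intro h
    obtain ⟨e1, e2⟩ := npar b1 b3 (y 0) (y 2) hb1 h13 (fun k => by have := hdep k; rw [h] at this; linarith)
    apply hy; funext i; fin_cases i <;> simp [h, e1, e2]
  apply cross_zero N (fun j => ∑ k, b1 k * H j k) b1 b2 hb1 n1 n2 q1 _ h12 i j
  have key : 2 * (y 0 * y 1) * ∑ i, b2 i * ∑ k, b1 k * H i k = 0 := by
    have e3 : y 2 ^ 2 * (∑ i, b3 i * ∑ j, b3 j * H i j) =
        ∑ i, (y 2 * b3 i) * ∑ j, (y 2 * b3 j) * H i j := by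
      simp only [Finset.mul_sum]
      refine Finset.sum_congr rfl fun i _ => Finset.sum_congr rfl fun j _ => ?_
      ring
    have e4 : ∀ k, y 2 * b3 k = - (y 0 * b1 k + y 1 * b2 k) := fun k => by linarith [hdep k]
    simp only [e4] at e3
    rw [q3, mul_zero] at e3
    simp only [Fin.sum_univ_three] at *
    have s01 := hs 1 0
    have s02 := hs 2 0
    have s12 := hs 2 1
    simp only [s01, s02, s12] at *
    linear_combination -e3 - y 0 ^ 2 * q1 - y 1 ^ 2 * q2
  rcases mul_eq_zero.1 key with h | h
  · exfalso
    have : y 0 * y 1 ≠ 0 := mul_ne_zero y0 y1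
    apply this; linarith
  · exact h

/-! ### Rich points on nonplanar surfaces -/

lemma dir_ne {d : ℕ} {p b1 b2 : Fin d → ℝ} (hb2 : b2 ≠ 0) (h : mkLine p b1 ≠ mkLine p b2) :
    ¬ ∃ c : ℝ, b2 = c • b1 := by
  rintro ⟨c, rfl⟩
  have hc : c ≠ 0 := by rintro rfl; simp at hb2
  exact h (mkLine_smul p b1 c hc).symm

/-- the points of `ℓ` that are regular and lie on at least two/three lines -/
lemma per_line (g : MvPolynomial (Fin 3) ℝ) (hnp : NP g) (E : ℕ)
    (hgE : g.totalDegree ≤ E) (L : Finset (Set (Fin 3 → ℝ)))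
    (hL : ∀ ℓ ∈ L, IsLine ℓ ∧ ℓ ⊆ zeroSet g) (ℓ : Set (Fin 3 → ℝ)) (hℓ : ℓ ∈ L)
    (P : Finset (Fin 3 → ℝ)) (hP : ∀ p ∈ P, p ∈ ℓ ∧ 3 ≤ deg L p ∧
      ∃ i, MvPolynomial.eval p (MvPolynomial.pderiv i g) ≠ 0) : P.card ≤ 2 * E := by
  rcases P.eq_empty_or_nonempty with rfl | ⟨p0, hp0⟩
  · simp
  obtain ⟨b, hb, hℓb⟩ := line_pt (hL ℓ hℓ).1 (hP p0 hp0).1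
  have hℓg : mkLine p0 b ⊆ zeroSet g := hℓb ▸ (hL ℓ hℓ).2
  have hmk : ∀ t : ℝ, mkLine (p0 + t • b) b = mkLine p0 b := by
    intro t
    ext x
    constructor
    · rintro ⟨s, rfl⟩; exact ⟨t + s, by module⟩
    · rintro ⟨s, rfl⟩; exact ⟨s - t, by module⟩
  let N : Fin 3 → Polynomial ℝ := fun i => lp (MvPolynomial.pderiv i g) p0 b
  by_cases htor : ∀ i j, N i * Polynomial.derivative (N j) = N j * Polynomial.derivative (N i)
  · -- torsal line
    obtain ⟨k, hk⟩ := (hP p0 hp0).2.2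
    let v : Fin 3 → ℝ := fun i => MvPolynomial.eval p0 (MvPolynomial.pderiv i g)
    have hv : v ≠ 0 := fun h => hk (congrFun h k)
    have hpar : ∀ i, Polynomial.C (v k) * N i - Polynomial.C (v i) * N k = 0 := by
      intro i
      apply wronsk _ (N k) _ 0
      · simp only [N, lp_eval0]; exact hk
      · simp only [N, Polynomial.eval_sub, Polynomial.eval_mul, Polynomial.eval_C, lp_eval0, v]; ring
      · simp only [Polynomial.derivative_sub, Polynomial.derivative_mul, Polynomial.derivative_C, zero_mul, zero_add]
        have := htor i k
        linear_combination Polynomial.C (v k) * this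
    have hplane : ∀ p ∈ P, ∀ m ∈ L, p ∈ m → m ⊆ zeroSet (lin v p0) := by
      intro p hp m hm hpm
      obtain ⟨hpℓ, _, i1, hi1⟩ := hP p hp
      rw [hℓb] at hpℓ
      obtain ⟨t, rfl⟩ := hpℓ
      have hpt : ∀ i, v k * MvPolynomial.eval (p0 + t • b) (MvPolynomial.pderiv i g) =
          v i * MvPolynomial.eval (p0 + t • b) (MvPolynomial.pderiv k g) := by
        intro i
        have := congrArg (Polynomial.eval t) (hpar i)
        simp only [N, Polynomial.eval_sub, Polynomial.eval_mul, Polynomial.eval_C, lp_eval,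
          Polynomial.eval_zero] at this
        linarith
      have hNk : MvPolynomial.eval (p0 + t • b) (MvPolynomial.pderiv k g) ≠ 0 := by
        intro h0
        have := hpt i1
        rw [h0, mul_zero] at this
        exact (mul_ne_zero hk hi1) this
      obtain ⟨b', hb', hmb⟩ := line_pt (hL m hm).1 hpm
      have f1 := first_order g (p0 + t • b) b' (hmb ▸ (hL m hm).2)
      have f0 := first_order g p0 b hℓg
      have f2 : ∑ i, b' i * v i = 0 := by
        have e : (∑ i, b' i * v i) * MvPolynomial.eval (p0 + t • b) (MvPolynomial.pderiv k g) = 0 := by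
          have : v k * ∑ i, b' i * MvPolynomial.eval (p0 + t • b) (MvPolynomial.pderiv i g) = 0 := by
            rw [f1, mul_zero]
          rw [← this, Finset.mul_sum, Finset.sum_mul]
          apply Finset.sum_congr rfl
          intro i _
          linear_combination - b' i * hpt i
        exact (mul_eq_zero.1 e).resolve_right hNk
      rw [hmb]
      rintro _ ⟨s, rfl⟩
      rw [lin_mem]
      have : ∀ i, v i * ((p0 + t • b + s • b') i - p0 i) = t * (b i * v i) + s * (b' i * v i) := by
        intro i; simp only [Pi.add_apply, Pi.smul_apply, smul_eq_mul]; ring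
      simp only [this, Finset.sum_add_distrib, ← Finset.mul_sum]
      rw [f2]
      have f0' : ∑ i, b i * v i = 0 := f0
      rw [f0']; simp
    -- choose another line through each point
    have hch : ∀ p ∈ P, ∃ m ∈ L, p ∈ m ∧ m ≠ ℓ := by
      intro p hp
      have h3 := (hP p hp).2.1
      unfold deg at h3
      obtain ⟨m, hm, hne⟩ := Finset.exists_mem_ne (by omega : 1 < (L.filter fun ℓ => p ∈ ℓ).card) ℓ
      exact ⟨m, (Finset.mem_filter.1 hm).1, (Finset.mem_filter.1 hm).2, hne⟩
    choose! m hm using hch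
    have hc := lines_plane_count v p0 hv g (hnp v p0 hv) (P.image m) (by
      intro x hx
      obtain ⟨p, hp, rfl⟩ := Finset.mem_image.1 hx
      exact ⟨(hL _ (hm p hp).1).1, hplane p hp _ (hm p hp).1 (hm p hp).2.1, (hL _ (hm p hp).1).2⟩)
    rw [Finset.card_image_of_injOn] at hc
    · omega
    · intro p hp p' hp' he
      by_contra hne
      have he : m p = m p' := he
      apply (hm p hp).2.2
      have h4 := (hm p' hp').2.1
      rw [← he] at h4
      exact line_unique (hL _ (hm p hp).1).1 (hL ℓ hℓ).1 (hm p hp).2.1 h4 (hP p hp).1 (hP p' hp').1 hne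
  · push Not at htor
    obtain ⟨i, j, hij⟩ := htor
    have hne : N i * Polynomial.derivative (N j) - N j * Polynomial.derivative (N i) ≠ 0 := sub_ne_zero.2 hij
    have hdN : ∀ i, (N i).natDegree ≤ E := fun i =>
      (lp_natDegree _ _ _).trans ((pderiv_deg_le i g).trans hgE)
    have hdN' : ∀ i, (Polynomial.derivative (N i)).natDegree ≤ E := fun i =>
      (Polynomial.natDegree_derivative_le _).trans (by have := hdN i; omega)
    have hd : (N i * Polynomial.derivative (N j) - N j * Polynomial.derivative (N i)).natDegree ≤ 2 * E := by
      refine (Polynomial.natDegree_sub_le _ _).trans (max_le ?_ ?_)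
      · refine Polynomial.natDegree_mul_le.trans ?_
        have := hdN i; have := hdN' j; omega
      · refine Polynomial.natDegree_mul_le.trans ?_
        have := hdN j; have := hdN' i; omega
    refine (lp_count p0 b _ hne P ?_).trans hd
    intro p hp
    obtain ⟨hpℓ, h3, i1, hi1⟩ := hP p hp
    have hpℓ' := hpℓ
    rw [hℓb] at hpℓ'
    obtain ⟨t, ht⟩ := hpℓ'
    refine ⟨t, ht, ?_⟩
    have hder : ∀ i, (Polynomial.derivative (N i)).eval t =
        ∑ j, b j * MvPolynomial.eval p (MvPolynomial.pderiv j (MvPolynomial.pderiv i g)) := by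
      intro i
      simp only [N, lp_deriv, Polynomial.eval_finsetSum, Polynomial.eval_mul, Polynomial.eval_C, lp_eval, ← ht]
    have hNe : ∀ i, (N i).eval t = MvPolynomial.eval p (MvPolynomial.pderiv i g) := by
      intro i; simp only [N, lp_eval, ← ht]
    rw [Polynomial.eval_sub, Polynomial.eval_mul, Polynomial.eval_mul, hder, hder, hNe, hNe, sub_eq_zero]
    unfold deg at h3
    have hmem : ℓ ∈ L.filter fun ℓ => p ∈ ℓ := Finset.mem_filter.2 ⟨hℓ, hpℓ⟩
    have hcard := Finset.card_erase_of_mem hmem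
    obtain ⟨m2, hm2, m3, hm3, hm23⟩ := Finset.one_lt_card.1
      (by omega : 1 < ((L.filter fun ℓ => p ∈ ℓ).erase ℓ).card)
    obtain ⟨hm2ℓ, hm2f⟩ := Finset.mem_erase.1 hm2
    obtain ⟨hm3ℓ, hm3f⟩ := Finset.mem_erase.1 hm3
    obtain ⟨hm2L, hpm2⟩ := Finset.mem_filter.1 hm2f
    obtain ⟨hm3L, hpm3⟩ := Finset.mem_filter.1 hm3f
    obtain ⟨b2, hb2, hmb2⟩ := line_pt (hL m2 hm2L).1 hpm2
    obtain ⟨b3, hb3, hmb3⟩ := line_pt (hL m3 hm3L).1 hpm3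
    have hℓp : ℓ = mkLine p b := by rw [hℓb, ht, hmk]
    have g1 : mkLine p b ⊆ zeroSet g := hℓp ▸ (hL ℓ hℓ).2
    have g2 : mkLine p b2 ⊆ zeroSet g := hmb2 ▸ (hL m2 hm2L).2
    have g3 : mkLine p b3 ⊆ zeroSet g := hmb3 ▸ (hL m3 hm3L).2
    exact three_dirs (fun i => MvPolynomial.eval p (MvPolynomial.pderiv i g))
      (fun i j => MvPolynomial.eval p (MvPolynomial.pderiv j (MvPolynomial.pderiv i g)))
      (fun h => hi1 (congrFun h i1)) (fun i j => by rw [pderiv_comm]) b b2 b3 hb hb2 hb3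
      (dir_ne hb2 (by rw [← hℓp, ← hmb2]; exact hm2ℓ.symm))
      (dir_ne hb3 (by rw [← hℓp, ← hmb3]; exact hm3ℓ.symm))
      (dir_ne hb3 (by rw [← hmb2, ← hmb3]; exact hm23))
      (first_order g p b g1) (first_order g p b2 g2) (first_order g p b3 g3)
      (second_order g p b g1) (second_order g p b2 g2) (second_order g p b3 g3) i j

/-- number of rich points on a nonplanar irreducible surface -/
lemma np_count (E : ℕ) : ∃ C : ℕ, ∀ (g : MvPolynomial (Fin 3) ℝ), Irreducible g → NP g →
    g.totalDegree ≤ E → ∀ (L : Finset (Set (Fin 3 → ℝ))) (P : Finset (Fin 3 → ℝ)) (ρ : ℕ), 3 ≤ ρ →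
    (∀ ℓ ∈ L, IsLine ℓ ∧ ℓ ⊆ zeroSet g) → (∀ p ∈ P, ρ ≤ deg L p) → P.card * ρ ≤ C * L.card := by
  set S := 2 * (E * (3 * (6 * E ^ 2 + 2 * E))) with hS
  refine ⟨2 * (S ^ 2 + 3 * E), fun g hg hnp hgE L P ρ hρ hL hP => ?_⟩
  obtain ⟨i0, hi0, hdvd⟩ := exists_pderiv g hg
  obtain ⟨Q, hQ⟩ : ∃ Q : Set (Fin 3 → ℝ) → Prop,
      ∀ ℓ, Q ℓ ↔ ∀ i, ℓ ⊆ zeroSet (MvPolynomial.pderiv i g) := ⟨_, fun _ => Iff.rfl⟩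
  have hsing : (L.filter Q).card ≤ S := by
    apply bez g _ hg hnp hi0 hdvd E hgE ((pderiv_deg_le i0 g).trans hgE)
    intro ℓ hℓ
    obtain ⟨h1, h2⟩ := Finset.mem_filter.1 hℓ
    exact ⟨(hL ℓ h1).1, (hL ℓ h1).2, (hQ ℓ).1 h2 i0⟩
  rw [← Finset.card_filter_add_card_filter_not (s := P) (fun p => ρ ≤ 2 * deg (L.filter Q) p)]
  rw [add_mul]
  have hA : (P.filter fun p => ρ ≤ 2 * deg (L.filter Q) p).card * ρ ≤ S ^ 2 * L.card := by
    rcases (P.filter fun p => ρ ≤ 2 * deg (L.filter Q) p).eq_empty_or_nonempty with h | ⟨p, hp⟩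
    · rw [h]; simp
    have h1 : ρ ≤ L.card := (hP p (Finset.mem_filter.1 hp).1).trans (deg_le L p)
    apply Nat.mul_le_mul _ h1
    refine (two_count _ (L.filter Q) (fun ℓ hℓ => (hL ℓ (Finset.mem_filter.1 hℓ).1).1) ?_).trans
      (Nat.pow_le_pow_left hsing 2)
    intro p hp
    have := (Finset.mem_filter.1 hp).2
    omega
  have hB : (P.filter fun p => ¬ ρ ≤ 2 * deg (L.filter Q) p).card * ((ρ + 1) / 2) ≤ L.card * (3 * E) := by
    refine (dcount _ (L.filter fun ℓ => ¬ Q ℓ) ((ρ + 1) / 2) (3 * E) ?_ ?_).trans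
      (Nat.mul_le_mul_right _ (Finset.card_filter_le L _))
    · intro p hp
      obtain ⟨h1, h2⟩ := Finset.mem_filter.1 hp
      have h3 := hP p h1
      have h4 := deg_split L p Q
      omega
    · intro ℓ hℓ
      obtain ⟨h1, h2⟩ := Finset.mem_filter.1 hℓ
      rw [hQ] at h2
      push Not at h2
      obtain ⟨i1, hi1⟩ := h2
      set P' := (P.filter fun p => ¬ ρ ≤ 2 * deg (L.filter Q) p).filter fun p => p ∈ ℓ with hP'
      rw [← Finset.card_filter_add_card_filter_not (s := P')
        (fun p => p ∈ zeroSet (MvPolynomial.pderiv i1 g))]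
      have a1 := line_zero_count (hL ℓ h1).1 _ hi1 (P'.filter fun p => p ∈ zeroSet (MvPolynomial.pderiv i1 g))
        (by
          intro p hp
          obtain ⟨h3, h4⟩ := Finset.mem_filter.1 hp
          exact ⟨(Finset.mem_filter.1 h3).2, h4⟩)
      have a2 := per_line g hnp E hgE L hL ℓ h1
        (P'.filter fun p => ¬ p ∈ zeroSet (MvPolynomial.pderiv i1 g)) (by
          intro p hp
          obtain ⟨h3, h4⟩ := Finset.mem_filter.1 hp
          obtain ⟨h5, h6⟩ := Finset.mem_filter.1 h3
          exact ⟨h6, hρ.trans (hP p (Finset.mem_filter.1 h5).1), i1, h4⟩)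
      have a3 := (pderiv_deg_le i1 g).trans hgE
      omega
  have hρ2 : ρ ≤ 2 * ((ρ + 1) / 2) := by omega
  have hB' : (P.filter fun p => ¬ ρ ≤ 2 * deg (L.filter Q) p).card * ρ ≤ 2 * (L.card * (3 * E)) :=
    calc _ ≤ (P.filter fun p => ¬ ρ ≤ 2 * deg (L.filter Q) p).card * (2 * ((ρ + 1) / 2)) :=
          Nat.mul_le_mul_left _ hρ2
      _ = 2 * ((P.filter fun p => ¬ ρ ≤ 2 * deg (L.filter Q) p).card * ((ρ + 1) / 2)) := by ring
      _ ≤ _ := Nat.mul_le_mul_left _ hB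
  nlinarith [Nat.zero_le (S ^ 2 * L.card)]

end PL

end Part9

section Part10
open Filter Topology

namespace PL

/-! ### Rich points in 3-space -/

lemma plane_eq_of_sub (v a v' a' : Fin 3 → ℝ) (hv : v ≠ 0) (hv' : v' ≠ 0)
    (h : zeroSet (lin v a) ⊆ zeroSet (lin v' a')) : zeroSet (lin v a) = zeroSet (lin v' a') := by
  obtain ⟨q, hq⟩ := lin_dvd v a hv (lin v' a') h
  have hq0 : q ≠ 0 := by
    rintro rfl; rw [mul_zero] at hq; exact lin_ne v' a' hv' hq
  have hd := MvPolynomial.totalDegree_mul_of_isDomain (lin_ne v a hv) hq0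
  rw [← hq, lin_deg v a hv, lin_deg v' a' hv'] at hd
  have hqd : q.totalDegree = 0 := by omega
  rw [MvPolynomial.totalDegree_eq_zero_iff_eq_C] at hqd
  have hc : MvPolynomial.coeff 0 q ≠ 0 := by
    intro h0; rw [h0, map_zero] at hqd; exact hq0 hqd
  apply Set.Subset.antisymm h
  intro x hx
  have hx : MvPolynomial.eval x (lin v' a') = 0 := hx
  rw [hq, hqd, map_mul, MvPolynomial.eval_C] at hx
  exact (mul_eq_zero.1 hx).resolve_right hc

lemma planes_common (v a v' a' : Fin 3 → ℝ) (hv : v ≠ 0) (hv' : v' ≠ 0)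
    (hne : zeroSet (lin v a) ≠ zeroSet (lin v' a')) (L : Finset (Set (Fin 3 → ℝ)))
    (hL : ∀ ℓ ∈ L, IsLine ℓ) :
    (L.filter fun ℓ => ℓ ⊆ zeroSet (lin v a) ∧ ℓ ⊆ zeroSet (lin v' a')).card ≤ 1 := by
  have := lines_plane_count v a hv (lin v' a') (fun h => hne (plane_eq_of_sub v a v' a' hv hv' h))
    (L.filter fun ℓ => ℓ ⊆ zeroSet (lin v a) ∧ ℓ ⊆ zeroSet (lin v' a')) (by
      intro ℓ hℓ
      obtain ⟨h1, h2, h3⟩ := Finset.mem_filter.1 hℓ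
      exact ⟨hL ℓ h1, h2, h3⟩)
  rwa [lin_deg v' a' hv'] at this

lemma pow_help (ε : ℝ) (hε : 0 < ε) (N n : ℕ) (T : ℝ) (hN : (N : ℝ) ≤ T) (hn : N ≤ n) :
    (N : ℝ) ^ (2 + ε) ≤ N * T * (n : ℝ) ^ ε := by
  rcases Nat.eq_zero_or_pos N with rfl | h0
  · rw [Nat.cast_zero, Real.zero_rpow (by linarith)]; simp
  have hN0 : (0 : ℝ) < N := by exact_mod_cast h0
  have hn' : (N : ℝ) ≤ n := by exact_mod_cast hn
  have hT0 : 0 ≤ T := hN0.le.trans hN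
  rw [Real.rpow_add hN0, Real.rpow_two, sq]
  gcongr

lemma half_le (r : ℕ) : (r : ℝ) / 2 ≤ (((r + 1) / 2 : ℕ) : ℝ) := by
  have : r ≤ 2 * ((r + 1) / 2) := by omega
  have : (r : ℝ) ≤ 2 * (((r + 1) / 2 : ℕ) : ℝ) := by exact_mod_cast this
  linarith

/-- points that are rich inside one plane -/
lemma plane_rich (ε : ℝ) (hε : 0 < ε) : ∃ C : ℝ, 0 ≤ C ∧ ∀ (v a : Fin 3 → ℝ)
    (L : Finset (Set (Fin 3 → ℝ))) (P : Finset (Fin 3 → ℝ)) (r n : ℕ) (T : ℝ), v ≠ 0 → 8 ≤ r →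
    (∀ ℓ ∈ L, IsLine ℓ) → (∀ ℓ ∈ L, ℓ ⊆ zeroSet (lin v a)) → (∀ p ∈ P, r ≤ 2 * deg L p) →
    (L.card : ℝ) ≤ T → L.card ≤ n →
    (P.card : ℝ) ≤ C * L.card * (T * (n : ℝ) ^ ε / (r : ℝ) ^ 3 + 1 / r) := by
  obtain ⟨C, hC, H⟩ := ST_plane ε hε
  refine ⟨8 * C, by positivity, fun v a L P r n T hv hr hL hF hP hT hn => ?_⟩
  have h1 := H v a L P ((r + 1) / 2) hv (by omega) hL hF (fun p hp => by have := hP p hp; omega)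
  have hr0 : (0 : ℝ) < r := by exact_mod_cast (by omega : 0 < r)
  have h2 := half_le r
  have h3 := pow_help ε hε L.card n T hT hn
  have hT0 : 0 ≤ T := le_trans (Nat.cast_nonneg _) hT
  calc (P.card : ℝ) ≤ C * ((L.card : ℝ) ^ (2 + ε) / (((r + 1) / 2 : ℕ) : ℝ) ^ 3 +
        (L.card : ℝ) / (((r + 1) / 2 : ℕ) : ℝ)) := h1
    _ ≤ C * ((L.card * T * (n : ℝ) ^ ε) / ((r : ℝ) / 2) ^ 3 + (L.card : ℝ) / ((r : ℝ) / 2)) := by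
        gcongr
    _ ≤ 8 * C * L.card * (T * (n : ℝ) ^ ε / (r : ℝ) ^ 3 + 1 / r) := by
        have e : 8 * C * L.card * (T * (n : ℝ) ^ ε / (r : ℝ) ^ 3 + 1 / r) -
          C * ((L.card * T * (n : ℝ) ^ ε) / ((r : ℝ) / 2) ^ 3 + (L.card : ℝ) / ((r : ℝ) / 2)) =
          6 * C * L.card / r := by
          field_simp; ring
        have : 0 ≤ 6 * C * L.card / r := by positivity
        linarith

lemma planes_sum (ε : ℝ) (hε : 0 < ε) : ∃ C : ℝ, 0 ≤ C ∧
    ∀ (L : Finset (Set (Fin 3 → ℝ))) (P : Finset (Fin 3 → ℝ)) (r : ℕ) (T : ℝ), 0 ≤ T → 8 ≤ r →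
    (∀ ℓ ∈ L, IsLine ℓ) → (∀ p ∈ P, ∃ v a : Fin 3 → ℝ, v ≠ 0 ∧
      2 * Real.sqrt L.card ≤ ((L.filter fun ℓ => ℓ ⊆ zeroSet (lin v a)).card : ℝ) ∧
      ((L.filter fun ℓ => ℓ ⊆ zeroSet (lin v a)).card : ℝ) ≤ T ∧
      r ≤ 2 * deg (L.filter fun ℓ => ℓ ⊆ zeroSet (lin v a)) p) →
    (P.card : ℝ) ≤ C * (L.card * (T * (L.card : ℝ) ^ ε / (r : ℝ) ^ 3 + 1 / r)) := by
  obtain ⟨C, hC, H⟩ := plane_rich ε hε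
  refine ⟨2 * C, by positivity, fun L P r T hT hr hL hP => ?_⟩
  have hr0 : (0 : ℝ) < r := by exact_mod_cast (by omega : 0 < r)
  rcases Nat.eq_zero_or_pos L.card with h0 | h0
  · have : P = ∅ := by
      apply Finset.eq_empty_of_forall_notMem
      intro p hp
      obtain ⟨v, a, _, _, _, h4⟩ := hP p hp
      have := deg_le (L.filter fun ℓ => ℓ ⊆ zeroSet (lin v a)) p
      have := Finset.card_filter_le L fun ℓ => ℓ ⊆ zeroSet (lin v a)
      omega
    rw [this, h0]; simp
  choose! v a hv h1 h2 h3 using hP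
  let Z : (Fin 3 → ℝ) → Set (Fin 3 → ℝ) := fun p => zeroSet (lin (v p) (a p))
  have hfam := family (P.image Z) L (fun π ℓ => ℓ ⊆ π) (2 * Real.sqrt L.card) (by positivity) (by
      rw [mul_pow, Real.sq_sqrt (by positivity)]
      have : (0 : ℝ) < L.card := by exact_mod_cast h0
      linarith) (by
      intro π hπ
      obtain ⟨p, hp, rfl⟩ := Finset.mem_image.1 hπ
      exact h1 p hp) (by
      intro π hπ π' hπ' hne
      obtain ⟨p, hp, rfl⟩ := Finset.mem_image.1 hπ
      obtain ⟨p', hp', rfl⟩ := Finset.mem_image.1 hπ'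
      exact planes_common _ _ _ _ (hv p hp) (hv p' hp') hne L hL)
  have hsum : (P.card : ℝ) = ∑ π ∈ P.image Z, ((P.filter fun p => Z p = π).card : ℝ) := by
    exact_mod_cast Finset.card_eq_sum_card_image Z P
  set K := T * (L.card : ℝ) ^ ε / (r : ℝ) ^ 3 + 1 / r with hK
  have hK0 : 0 ≤ K := by positivity
  have hbd : ∀ π ∈ P.image Z, ((P.filter fun p => Z p = π).card : ℝ) ≤
      C * ((L.filter fun ℓ => ℓ ⊆ π).card : ℝ) * K := by
    intro π hπ
    obtain ⟨p0, hp0, rfl⟩ := Finset.mem_image.1 hπ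
    refine H (v p0) (a p0) (L.filter fun ℓ => ℓ ⊆ Z p0) _ r L.card T (hv p0 hp0) hr
      (fun ℓ hℓ => hL ℓ (Finset.mem_filter.1 hℓ).1) (fun ℓ hℓ => (Finset.mem_filter.1 hℓ).2) ?_
      (h2 p0 hp0) (Finset.card_filter_le _ _)
    intro p hp
    obtain ⟨hp1, hp2⟩ := Finset.mem_filter.1 hp
    rw [← hp2]
    exact h3 p hp1
  rw [hsum]
  calc _ ≤ ∑ π ∈ P.image Z, C * ((L.filter fun ℓ => ℓ ⊆ π).card : ℝ) * K := Finset.sum_le_sum hbd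
    _ = C * K * ∑ π ∈ P.image Z, ((L.filter fun ℓ => ℓ ⊆ π).card : ℝ) := by
        rw [Finset.mul_sum]; apply Finset.sum_congr rfl; intro π _; ring
    _ ≤ C * K * (2 * L.card) := by gcongr
    _ = _ := by ring

lemma irred_deg {d : ℕ} (g : MvPolynomial (Fin d) ℝ) (hg : Irreducible g) : 1 ≤ g.totalDegree := by
  obtain ⟨i, hi, _⟩ := exists_pderiv g hg
  have := pderiv_deg i g hi
  omega

/-- reduction to irreducible surfaces -/
lemma by_irreducible {d : ℕ} (D : ℕ) (b : ℝ) (hb : 0 ≤ b) (P0 : Finset (Fin d → ℝ))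
    (h : ∀ g : MvPolynomial (Fin d) ℝ, Irreducible g → g.totalDegree ≤ D → ∀ P ⊆ P0,
      (∀ p ∈ P, p ∈ zeroSet g) → (P.card : ℝ) ≤ b) (f : MvPolynomial (Fin d) ℝ) :
    f ≠ 0 → f.totalDegree ≤ D → ∀ P ⊆ P0, (∀ p ∈ P, p ∈ zeroSet f) →
      (P.card : ℝ) ≤ f.totalDegree * b := by
  induction f using WfDvdMonoid.induction_on_irreducible with
  | zero => intro h; exact absurd rfl h
  | unit u hu =>
    intro _ _ P _ hP
    have : P = ∅ := by
      apply Finset.eq_empty_of_forall_notMem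
      intro p hp
      have h1 : MvPolynomial.eval p u = 0 := hP p hp
      exact (hu.map (MvPolynomial.eval p)).ne_zero h1
    rw [this]; simp; positivity
  | mul a i ha hi ih =>
    intro _ hD P hPP hP
    have hdeg := MvPolynomial.totalDegree_mul_of_isDomain hi.ne_zero ha
    have h1 := irred_deg i hi
    rw [hdeg] at hD ⊢
    rw [← Finset.card_filter_add_card_filter_not (s := P) (fun p => p ∈ zeroSet i)]
    have e1 := h i hi (by omega) (P.filter fun p => p ∈ zeroSet i)
      ((Finset.filter_subset _ _).trans hPP) (fun p hp => (Finset.mem_filter.1 hp).2)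
    have e2 := ih ha (by omega) (P.filter fun p => ¬ p ∈ zeroSet i)
      ((Finset.filter_subset _ _).trans hPP) (by
        intro p hp
        obtain ⟨h1, h2⟩ := Finset.mem_filter.1 hp
        have h3 : MvPolynomial.eval p (i * a) = 0 := hP p h1
        rw [map_mul] at h3
        exact (mul_eq_zero.1 h3).resolve_left h2)
    push_cast
    have h1' : (1 : ℝ) ≤ i.totalDegree := by exact_mod_cast h1
    nlinarith

lemma planar_eq (g : MvPolynomial (Fin 3) ℝ) (hg : Irreducible g) (hn : ¬ NP g) :
    ∃ v a : Fin 3 → ℝ, v ≠ 0 ∧ zeroSet g = zeroSet (lin v a) := by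
  unfold NP at hn
  push Not at hn
  obtain ⟨v, a, hv, hsub⟩ := hn
  refine ⟨v, a, hv, ?_⟩
  apply Set.Subset.antisymm _ hsub
  obtain ⟨q, hq⟩ := lin_dvd v a hv g hsub
  have hlu : ¬ IsUnit (lin v a) := by
    intro hu
    have : (lin v a).totalDegree = 0 := by
      obtain ⟨w, hw⟩ := hu.exists_right_inv
      have hl := lin_ne v a hv
      have hw0 : w ≠ 0 := by rintro rfl; simp at hw
      have := MvPolynomial.totalDegree_mul_of_isDomain hl hw0
      rw [hw, MvPolynomial.totalDegree_one] at this
      omega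
    rw [lin_deg v a hv] at this
    omega
  have hqu : IsUnit q := (hg.isUnit_or_isUnit hq).resolve_left hlu
  intro x hx
  have hx : MvPolynomial.eval x g = 0 := hx
  rw [hq, map_mul] at hx
  exact (mul_eq_zero.1 hx).resolve_right (hqu.map (MvPolynomial.eval x)).ne_zero

end PL

end Part10

section Part11
open Filter Topology

namespace PL

lemma pow_split (ε : ℝ) (n : ℝ) (hn : 0 < n) : n ^ (3 / 2 + ε) = Real.sqrt n * n * n ^ ε := by
  rw [Real.rpow_add hn, Real.sqrt_eq_rpow]
  congr 1
  nth_rewrite 3 [← Real.rpow_one n]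
  rw [← Real.rpow_add hn]; norm_num

lemma numX (ε : ℝ) (hε : 0 < ε) (n r : ℕ) (hn : 1 ≤ n) (hr : 1 ≤ r) (hrn : r ^ 2 ≤ 4 * n) :
    (n : ℝ) / r ≤ 2 * ((n : ℝ) ^ (3 / 2 + ε) * (1 / (r : ℝ) ^ 2)) ∧
    (n : ℝ) * (2 * Real.sqrt n * (n : ℝ) ^ ε / (r : ℝ) ^ 3) ≤
      2 * ((n : ℝ) ^ (3 / 2 + ε) * (1 / (r : ℝ) ^ 2)) := by
  have hn0 : (1 : ℝ) ≤ n := by exact_mod_cast hn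
  have hr0 : (1 : ℝ) ≤ r := by exact_mod_cast hr
  have hp : 1 ≤ (n : ℝ) ^ ε := Real.one_le_rpow hn0 hε.le
  have hrs : (r : ℝ) ≤ 2 * Real.sqrt n := by
    have h1 : ((r : ℝ)) ^ 2 ≤ 4 * n := by exact_mod_cast hrn
    have h2 : (2 * Real.sqrt n) ^ 2 = 4 * n := by rw [mul_pow, Real.sq_sqrt (by linarith)]; norm_num
    exact abs_le_of_sq_le_sq' (by rw [h2]; exact h1) (by positivity) |>.2
  rw [pow_split ε n (by linarith)]
  have hs : 0 ≤ Real.sqrt n := Real.sqrt_nonneg _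
  constructor
  · rw [mul_one_div, ← mul_div_assoc, div_le_div_iff₀ (by linarith) (by positivity)]
    have : (r : ℝ) * n ≤ 2 * (Real.sqrt n * n * (n : ℝ) ^ ε) := by
      calc (r : ℝ) * n ≤ 2 * Real.sqrt n * n := by gcongr
        _ ≤ 2 * (Real.sqrt n * n * (n : ℝ) ^ ε) := by
          have : 0 ≤ Real.sqrt n * n := by positivity
          nlinarith
    nlinarith
  · rw [mul_one_div, ← mul_div_assoc, ← mul_div_assoc, div_le_div_iff₀ (by positivity) (by positivity)]
    have h3 : (r : ℝ) ^ 2 ≤ (r : ℝ) ^ 3 := pow_le_pow_right₀ hr0 (by norm_num)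
    have h4 : 0 ≤ (n : ℝ) * (2 * Real.sqrt n * (n : ℝ) ^ ε) := by positivity
    calc (n : ℝ) * (2 * Real.sqrt n * (n : ℝ) ^ ε) * (r : ℝ) ^ 2 ≤
        (n : ℝ) * (2 * Real.sqrt n * (n : ℝ) ^ ε) * (r : ℝ) ^ 3 := by gcongr
      _ = _ := by ring

/-- the class of good points in the 3-dimensional recursion -/
def U3 (r : ℕ) (L : Finset (Set (Fin 3 → ℝ))) (p : Fin 3 → ℝ) : Prop :=
  r ≤ deg L p ∧ r ^ 2 ≤ 4 * L.card ∧ ∀ v a : Fin 3 → ℝ, v ≠ 0 →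
    2 * Real.sqrt L.card ≤ ((L.filter fun ℓ => ℓ ⊆ zeroSet (lin v a)).card : ℝ) →
    2 * deg (L.filter fun ℓ => ℓ ⊆ zeroSet (lin v a)) p < r

lemma le_of_mul_half (x r : ℕ) (c : ℝ) (hr : 1 ≤ r) (h : (x : ℝ) * (((r + 1) / 2 : ℕ) : ℝ) ≤ c) :
    (x : ℝ) ≤ 2 * (c / r) := by
  have hr0 : (0 : ℝ) < r := by exact_mod_cast hr
  have h2 := half_le r
  have : (x : ℝ) * ((r : ℝ) / 2) ≤ c := le_trans (by gcongr) h
  rw [← mul_div_assoc, le_div_iff₀ hr0]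
  linarith

lemma surface3 (ε : ℝ) (hε : 0 < ε) (D : ℕ) : ∃ b : ℝ, 0 ≤ b ∧ ∀ (L : Finset (Set (Fin 3 → ℝ)))
    (r : ℕ), 8 ≤ r → (∀ ℓ ∈ L, IsLine ℓ) → ∀ (g : MvPolynomial (Fin 3) ℝ), Irreducible g →
    g.totalDegree ≤ D → ∀ P : Finset (Fin 3 → ℝ), (∀ p ∈ P, U3 r L p) → (∀ p ∈ P, p ∈ zeroSet g) →
    (P.card : ℝ) ≤ b * ((L.card : ℝ) ^ (3 / 2 + ε) * (1 / (r : ℝ) ^ 2)) := by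
  obtain ⟨C1, hC1⟩ := np_count D
  obtain ⟨C2, hC2, H2⟩ := plane_rich ε hε
  refine ⟨4 * D + 4 * C1 + 4 * C2, by positivity, fun L r hr hL g hg hgD P hU hP => ?_⟩
  set X := (L.card : ℝ) ^ (3 / 2 + ε) * (1 / (r : ℝ) ^ 2) with hX
  have hX0 : 0 ≤ X := by positivity
  rcases P.eq_empty_or_nonempty with rfl | ⟨p0, hp0⟩
  · simp only [Finset.card_empty, Nat.cast_zero]; positivity
  have hrn := (hU p0 hp0).2.1
  have hn : 1 ≤ L.card := by
    have := (hU p0 hp0).1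
    have := deg_le L p0
    omega
  obtain ⟨x1, x2⟩ := numX ε hε L.card r hn (by omega) hrn
  rw [← hX] at x1 x2
  have hr0 : (0 : ℝ) < r := by exact_mod_cast (by omega : 0 < r)
  rw [← Finset.card_filter_add_card_filter_not (s := P)
    (fun p => r ≤ 2 * deg (L.filter fun ℓ => ℓ ⊆ zeroSet g) p)]
  have hout : ((P.filter fun p => ¬ r ≤ 2 * deg (L.filter fun ℓ => ℓ ⊆ zeroSet g) p).card : ℝ) ≤
      4 * D * X := by
    have h1 := out_count (P.filter fun p => ¬ r ≤ 2 * deg (L.filter fun ℓ => ℓ ⊆ zeroSet g) p) L hL g D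
      ((r + 1) / 2) hgD (by
        intro p hp
        obtain ⟨h1, h2⟩ := Finset.mem_filter.1 hp
        refine ⟨hP p h1, ?_⟩
        have h3 := (hU p h1).1
        have h4 := deg_split L p (fun ℓ => ℓ ⊆ zeroSet g)
        omega)
    have h2 := le_of_mul_half _ r (L.card * D) (by omega) (by exact_mod_cast h1)
    have e : 2 * ((L.card * D : ℝ) / r) = 2 * D * ((L.card : ℝ) / r) := by ring
    rw [e] at h2
    nlinarith [Nat.cast_nonneg (α := ℝ) D]
  have hin : ((P.filter fun p => r ≤ 2 * deg (L.filter fun ℓ => ℓ ⊆ zeroSet g) p).card : ℝ) ≤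
      (4 * C1 + 4 * C2) * X := by
    by_cases hnp : NP g
    · have h1 := hC1 g hg hnp hgD (L.filter fun ℓ => ℓ ⊆ zeroSet g)
        (P.filter fun p => r ≤ 2 * deg (L.filter fun ℓ => ℓ ⊆ zeroSet g) p) ((r + 1) / 2) (by omega)
        (fun ℓ hℓ => ⟨hL ℓ (Finset.mem_filter.1 hℓ).1, (Finset.mem_filter.1 hℓ).2⟩)
        (fun p hp => by have := (Finset.mem_filter.1 hp).2; omega)
      have h1' := h1.trans (Nat.mul_le_mul_left C1 (Finset.card_filter_le L _))
      have h2 := le_of_mul_half _ r (C1 * L.card) (by omega) (by exact_mod_cast h1')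
      have e : 2 * ((C1 * L.card : ℝ) / r) = 2 * C1 * ((L.card : ℝ) / r) := by ring
      rw [e] at h2
      have : 0 ≤ C2 * X := by positivity
      nlinarith [Nat.cast_nonneg (α := ℝ) C1]
    · obtain ⟨v, a, hv, hZ⟩ := planar_eq g hg hnp
      by_cases hrich : 2 * Real.sqrt L.card ≤ ((L.filter fun ℓ => ℓ ⊆ zeroSet g).card : ℝ)
      · have : (P.filter fun p => r ≤ 2 * deg (L.filter fun ℓ => ℓ ⊆ zeroSet g) p) = ∅ := by
          apply Finset.eq_empty_of_forall_notMem
          intro p hp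
          obtain ⟨h1, h2⟩ := Finset.mem_filter.1 hp
          have h3 := (hU p h1).2.2 v a hv
          rw [← hZ] at h3
          have := h3 hrich
          omega
        rw [this]; simp; positivity
      · have h1 := H2 v a (L.filter fun ℓ => ℓ ⊆ zeroSet g)
          (P.filter fun p => r ≤ 2 * deg (L.filter fun ℓ => ℓ ⊆ zeroSet g) p) r L.card
          (2 * Real.sqrt L.card) hv hr (fun ℓ hℓ => hL ℓ (Finset.mem_filter.1 hℓ).1)
          (fun ℓ hℓ => hZ ▸ (Finset.mem_filter.1 hℓ).2) (fun p hp => (Finset.mem_filter.1 hp).2)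
          (not_le.1 hrich).le (Finset.card_filter_le _ _)
        have h2 : ((L.filter fun ℓ => ℓ ⊆ zeroSet g).card : ℝ) ≤ L.card := by
          exact_mod_cast Finset.card_filter_le _ _
        calc _ ≤ C2 * ((L.filter fun ℓ => ℓ ⊆ zeroSet g).card : ℝ) *
              (2 * Real.sqrt L.card * (L.card : ℝ) ^ ε / (r : ℝ) ^ 3 + 1 / r) := h1
          _ ≤ C2 * (L.card : ℝ) * (2 * Real.sqrt L.card * (L.card : ℝ) ^ ε / (r : ℝ) ^ 3 + 1 / r) := by
              gcongr
          _ = C2 * (L.card * (2 * Real.sqrt L.card * (L.card : ℝ) ^ ε / (r : ℝ) ^ 3) + L.card / r) := by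
              ring
          _ ≤ C2 * (2 * X + 2 * X) := by gcongr
          _ ≤ _ := by
              have : 0 ≤ 4 * C1 * X := by positivity
              nlinarith
  push_cast
  linarith

theorem rich3_good (ε : ℝ) (hε : 0 < ε) : ∃ C : ℝ, 0 ≤ C ∧ ∀ (L : Finset (Set (Fin 3 → ℝ)))
    (P : Finset (Fin 3 → ℝ)) (r : ℕ), 8 ≤ r → (∀ ℓ ∈ L, IsLine ℓ) → (∀ p ∈ P, U3 r L p) →
    (P.card : ℝ) ≤ C * ((L.card : ℝ) ^ (3 / 2 + ε) * (1 / (r : ℝ) ^ 2)) := by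
  obtain ⟨D, hD⟩ := recursion 3 (by norm_num) (3 / 2 + ε) (by push_cast; linarith)
  obtain ⟨b, hb, Hb⟩ := surface3 ε hε D
  obtain ⟨C1, hC1, H1⟩ := planes_sum ε hε
  obtain ⟨C, hC, H⟩ := hD (D * b + 4 * C1 + 4) (by positivity)
  refine ⟨C, hC, fun L P r hr hL hP => ?_⟩
  have hr0 : (0 : ℝ) < r := by exact_mod_cast (by omega : 0 < r)
  rw [← mul_assoc]
  refine H L hL (U3 r) (1 / (r : ℝ) ^ 2) (by positivity) ?_ ?_ ?_ L (Finset.Subset.refl _) P hP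
  · intro L p h
    have h1 := h.1
    have := deg_le L p
    exact Finset.card_pos.1 (by omega)
  · intro L' hL' f hf hfD P' hP'
    have hX0 : 0 ≤ ((L'.card : ℝ) ^ (3 / 2 + ε) * (1 / (r : ℝ) ^ 2)) := by positivity
    have h1 := by_irreducible D (b * ((L'.card : ℝ) ^ (3 / 2 + ε) * (1 / (r : ℝ) ^ 2))) (by positivity) P'
      (fun g hg hgD Q hQ hQg => Hb L' r hr (fun ℓ hℓ => hL ℓ (hL' hℓ)) g hg hgD Q
        (fun p hp => (hP' p (hQ hp)).1) hQg) f hf hfD P' (Finset.Subset.refl _) (fun p hp => (hP' p hp).2)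
    have h2 : (f.totalDegree : ℝ) ≤ D := by exact_mod_cast hfD
    calc _ ≤ _ := h1
      _ ≤ D * (b * ((L'.card : ℝ) ^ (3 / 2 + ε) * (1 / (r : ℝ) ^ 2))) := by gcongr
      _ ≤ _ := by
        have : 0 ≤ (4 * C1 + 4) * ((L'.card : ℝ) ^ (3 / 2 + ε) * (1 / (r : ℝ) ^ 2)) := by positivity
        nlinarith
  · intro L1 hL1 L2 hL2 P' hP'
    set X := ((L1.card : ℝ) ^ (3 / 2 + ε) * (1 / (r : ℝ) ^ 2)) with hX
    have hX0 : 0 ≤ X := by positivity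
    rw [mul_assoc, ← hX]
    rcases P'.eq_empty_or_nonempty with rfl | ⟨p0, hp0⟩
    · simp only [Finset.card_empty, Nat.cast_zero]; positivity
    have hrn := (hP' p0 hp0).1.2.1
    have hn : 1 ≤ L1.card := by
      have := (hP' p0 hp0).1.1
      have := deg_le L1 p0
      omega
    obtain ⟨x1, x2⟩ := numX ε hε L1.card r hn (by omega) hrn
    rw [← hX] at x1 x2
    have hdeg : ∀ p ∈ P', r ≤ deg L2 p := by
      intro p hp
      refine (hP' p hp).1.1.trans (Finset.card_le_card ?_)
      intro ℓ hℓ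
      obtain ⟨h1, h2⟩ := Finset.mem_filter.1 hℓ
      exact Finset.mem_filter.2 ⟨(hP' p hp).2.1 ℓ h1 h2, h2⟩
    have hL2l : ∀ ℓ ∈ L2, IsLine ℓ := fun ℓ hℓ => hL ℓ (hL1 (hL2 hℓ))
    have hc : L2.card ≤ L1.card := Finset.card_le_card hL2
    have hcR : (L2.card : ℝ) ≤ L1.card := by exact_mod_cast hc
    by_cases hr2 : r ^ 2 ≤ 4 * L2.card
    · have h1 := H1 L2 P' r (2 * Real.sqrt L1.card) (by positivity) hr hL2l (by
        intro p hp
        have h2 := (hP' p hp).2.2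
        have h3 := (hP' p hp).1.2.2
        unfold U3 at h2
        push Not at h2
        obtain ⟨v, a, hv, h4, h5⟩ := h2 (hdeg p hp) hr2
        refine ⟨v, a, hv, h4, ?_, h5⟩
        have hsub : (L2.filter fun ℓ => ℓ ⊆ zeroSet (lin v a)) ⊆ L1.filter fun ℓ => ℓ ⊆ zeroSet (lin v a) :=
          Finset.filter_subset_filter _ hL2
        by_contra hcon
        have h6 : 2 * Real.sqrt L1.card ≤ ((L1.filter fun ℓ => ℓ ⊆ zeroSet (lin v a)).card : ℝ) := by
          refine (not_le.1 hcon).le.trans ?_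
          exact_mod_cast Finset.card_le_card hsub
        have h7 := h3 v a hv h6
        have h8 := deg_mono hsub p
        omega)
      have hpow : (L2.card : ℝ) ^ ε ≤ (L1.card : ℝ) ^ ε := Real.rpow_le_rpow (by positivity) hcR hε.le
      calc (P'.card : ℝ) ≤ _ := h1
        _ ≤ C1 * (L1.card * (2 * Real.sqrt L1.card * (L1.card : ℝ) ^ ε / (r : ℝ) ^ 3 + 1 / r)) := by
            gcongr
        _ = C1 * (L1.card * (2 * Real.sqrt L1.card * (L1.card : ℝ) ^ ε / (r : ℝ) ^ 3) + L1.card / r) := by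
            ring
        _ ≤ C1 * (2 * X + 2 * X) := by gcongr
        _ ≤ _ := by
            have : 0 ≤ (D * b + 4) * X := by positivity
            nlinarith
    · have h1 := rich_family P' L2 hL2l r (by omega) hdeg
      have h2 : (P'.card : ℝ) * r ≤ 2 * L2.card := by exact_mod_cast h1
      have h3 : (P'.card : ℝ) ≤ 2 * (L1.card / r) := by
        rw [← mul_div_assoc, le_div_iff₀ hr0]; linarith
      have : 0 ≤ (D * b + 4 * C1) * X := by positivity
      nlinarith

/-- rich points in 3-space when planes contain few lines -/
theorem rich3 (ε : ℝ) (hε : 0 < ε) : ∃ C : ℝ, 0 ≤ C ∧ ∀ (L : Finset (Set (Fin 3 → ℝ)))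
    (P : Finset (Fin 3 → ℝ)) (r s : ℕ), 8 ≤ r → (∀ ℓ ∈ L, IsLine ℓ) → (∀ p ∈ P, r ≤ deg L p) →
    (∀ v a : Fin 3 → ℝ, v ≠ 0 → (L.filter fun ℓ => ℓ ⊆ zeroSet (lin v a)).card ≤ s) →
    (P.card : ℝ) ≤ C * ((L.card : ℝ) ^ (3 / 2 + ε) / (r : ℝ) ^ 2 +
      L.card * s * (L.card : ℝ) ^ ε / (r : ℝ) ^ 3 + L.card / r) := by
  obtain ⟨C1, hC1, H1⟩ := rich3_good ε hε
  obtain ⟨C2, hC2, H2⟩ := planes_sum ε hε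
  refine ⟨C1 + C2 + 2, by positivity, fun L P r s hr hL hP hs => ?_⟩
  have hr0 : (0 : ℝ) < r := by exact_mod_cast (by omega : 0 < r)
  set x := (L.card : ℝ) ^ (3 / 2 + ε) / (r : ℝ) ^ 2 with hx
  set y := L.card * s * (L.card : ℝ) ^ ε / (r : ℝ) ^ 3 with hy
  set z := (L.card : ℝ) / r with hz
  have hx0 : 0 ≤ x := by positivity
  have hy0 : 0 ≤ y := by positivity
  have hz0 : 0 ≤ z := by positivity
  by_cases hrn : r ^ 2 ≤ 4 * L.card
  · rw [← Finset.card_filter_add_card_filter_not (s := P) (fun p => U3 r L p)]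
    have h1 := H1 L (P.filter fun p => U3 r L p) r hr hL (fun p hp => (Finset.mem_filter.1 hp).2)
    have h2 := H2 L (P.filter fun p => ¬ U3 r L p) r s (by positivity) hr hL (by
      intro p hp
      obtain ⟨h2, h3⟩ := Finset.mem_filter.1 hp
      unfold U3 at h3
      push Not at h3
      obtain ⟨v, a, hv, h4, h5⟩ := h3 (hP p h2) hrn
      exact ⟨v, a, hv, h4, by exact_mod_cast hs v a hv, h5⟩)
    have e1 : (L.card : ℝ) ^ (3 / 2 + ε) * (1 / (r : ℝ) ^ 2) = x := by rw [hx]; ring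
    have e2 : (L.card * (s * (L.card : ℝ) ^ ε / (r : ℝ) ^ 3 + 1 / r) : ℝ) = y + z := by rw [hy, hz]; ring
    rw [e1] at h1
    rw [e2] at h2
    push_cast
    have p1 : 0 ≤ C1 * (y + z) := by positivity
    have p2 : 0 ≤ C2 * x := by positivity
    nlinarith
  · have h1 := rich_family P L hL r (by omega) hP
    have h2 : (P.card : ℝ) * r ≤ 2 * L.card := by exact_mod_cast h1
    have h3 : (P.card : ℝ) ≤ 2 * z := by
      rw [hz, ← mul_div_assoc, le_div_iff₀ hr0]; linarith
    have p1 : 0 ≤ (C1 + C2) * (x + y + z) := by positivity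
    nlinarith

end PL

end Part11

section Part12
open Filter Topology

namespace PL

lemma gen_proj (S : Finset (Submodule ℝ (Fin 4 → ℝ))) (hS : ⊤ ∉ S) :
    ∃ (A : (Fin 4 → ℝ) →ₗ[ℝ] (Fin 3 → ℝ)) (v : Fin 4 → ℝ), Function.Surjective A ∧ A v = 0 ∧
      ∀ W ∈ S, v ∉ W ∧ ∀ x ∈ W, A x = 0 → x = 0 := by
  have hS' : ⊤ ∉ insert (⊥ : Submodule ℝ (Fin 4 → ℝ)) S := by
    rw [Finset.mem_insert, not_or]
    exact ⟨bot_ne_top.symm, hS⟩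
  have h := Subspace.biUnion_ne_univ_of_top_notMem hS'
  obtain ⟨v, hv⟩ := (Set.ne_univ_iff_exists_notMem _).1 h
  simp only [Set.mem_iUnion, not_exists] at hv
  have hv0 : v ≠ 0 := by
    intro h0
    exact hv ⊥ (Finset.mem_insert_self _ _) (by simp [h0])
  have hv1 : ∀ W ∈ S, v ∉ W := fun W hW => hv W (Finset.mem_insert_of_mem hW)
  let N : Submodule ℝ (Fin 4 → ℝ) := Submodule.span ℝ {v}
  have hfr : Module.finrank ℝ ((Fin 4 → ℝ) ⧸ N) = Module.finrank ℝ (Fin 3 → ℝ) := by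
    have h1 := Submodule.finrank_quotient_add_finrank N
    have h2 : Module.finrank ℝ N = 1 := finrank_span_singleton hv0
    simp only [Module.finrank_fin_fun] at h1 ⊢
    omega
  let e := LinearEquiv.ofFinrankEq _ _ hfr
  refine ⟨e.toLinearMap ∘ₗ N.mkQ, v, ?_, ?_, ?_⟩
  · exact e.surjective.comp (Submodule.mkQ_surjective N)
  · have : N.mkQ v = 0 := by
      rw [Submodule.mkQ_apply, Submodule.Quotient.mk_eq_zero]
      exact Submodule.mem_span_singleton_self v
    simp only [LinearMap.comp_apply, this, map_zero]
  · intro W hW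
    refine ⟨hv1 W hW, fun x hx h0 => ?_⟩
    have h1 : N.mkQ x = 0 := by
      have : e (N.mkQ x) = 0 := h0
      exact (LinearEquiv.map_eq_zero_iff e).1 this
    rw [Submodule.mkQ_apply, Submodule.Quotient.mk_eq_zero] at h1
    obtain ⟨t, rfl⟩ := Submodule.mem_span_singleton.1 h1
    by_contra hne
    have ht : t ≠ 0 := by rintro rfl; simp at hne
    exact hv1 W hW ((Submodule.smul_mem_iff W ht).1 hx)

lemma flat_of_dim (W : Submodule ℝ (Fin 4 → ℝ)) (hW : Module.finrank ℝ W = 2) (a : Fin 4 → ℝ) :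
    Is2Flat {x | x - a ∈ W} := by
  let B := Module.finBasisOfFinrankEq ℝ W hW
  have hB : LinearIndependent ℝ ![(B 0 : Fin 4 → ℝ), (B 1 : Fin 4 → ℝ)] := by
    have h1 := B.linearIndependent.map' W.subtype (Submodule.ker_subtype W)
    have h2 : (W.subtype ∘ B) = ![(B 0 : Fin 4 → ℝ), (B 1 : Fin 4 → ℝ)] := by
      funext i
      fin_cases i <;> rfl
    rw [h2] at h1
    exact h1
  refine ⟨a, B 0, B 1, hB, ?_⟩
  ext x
  rw [Set.mem_ofPred_eq, Set.mem_ofPred_eq]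
  constructor
  · intro h
    have h2 := B.sum_repr ⟨x - a, h⟩
    rw [Fin.sum_univ_two] at h2
    have h3 := congrArg Subtype.val h2
    refine ⟨B.repr ⟨x - a, h⟩ 0, B.repr ⟨x - a, h⟩ 1, ?_⟩
    have h4 : (B.repr ⟨x - a, h⟩ 0) • (B 0 : Fin 4 → ℝ) + (B.repr ⟨x - a, h⟩ 1) • (B 1 : Fin 4 → ℝ)
      = x - a := h3
    rw [add_assoc, h4]; abel
  · rintro ⟨t, u, rfl⟩
    have : a + t • (B 0 : Fin 4 → ℝ) + u • (B 1 : Fin 4 → ℝ) - a =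
      t • (B 0 : Fin 4 → ℝ) + u • (B 1 : Fin 4 → ℝ) := by abel
    rw [this]
    exact W.add_mem (W.smul_mem _ (B 0).2) (W.smul_mem _ (B 1).2)

lemma line_in_flat {ℓ : Set (Fin 4 → ℝ)} (h : IsLine ℓ) : ∃ F, Is2Flat F ∧ ℓ ⊆ F := by
  obtain ⟨a, b, hb, rfl⟩ := h
  have h1 : Submodule.span ℝ {b} ≠ ⊤ := by
    intro h
    have h2 : Module.finrank ℝ (Submodule.span ℝ {b}) = 1 := finrank_span_singleton hb
    rw [h, finrank_top] at h2
    simp at h2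
  obtain ⟨c, hc⟩ : ∃ c, c ∉ Submodule.span ℝ {b} := by
    by_contra hcon
    push Not at hcon
    exact h1 (Submodule.eq_top_iff'.2 hcon)
  refine ⟨_, ⟨a, b, c, ?_, rfl⟩, ?_⟩
  · rw [LinearIndependent.pair_iff' hb]
    intro t ht
    exact hc (Submodule.mem_span_singleton.2 ⟨t, ht⟩)
  · rintro x ⟨t, rfl⟩
    exact ⟨t, 0, by simp⟩

lemma s_pos (L : Finset (Set (Fin 4 → ℝ))) (hL : ∀ ℓ ∈ L, IsLine ℓ) (hne : L.Nonempty) (s : ℕ)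
    (hs : ∀ F : Set (Fin 4 → ℝ), Is2Flat F → (L.filter fun ℓ => ℓ ⊆ F).card ≤ s) : 1 ≤ s := by
  obtain ⟨ℓ, hℓ⟩ := hne
  obtain ⟨F, hF, h⟩ := line_in_flat (hL ℓ hℓ)
  exact le_trans (Finset.card_pos.2 ⟨ℓ, Finset.mem_filter.2 ⟨hℓ, h⟩⟩) (hs F hF)

def W3 (a b : Set (Fin 4 → ℝ) → (Fin 4 → ℝ)) (x y z : Set (Fin 4 → ℝ)) :
    Submodule ℝ (Fin 4 → ℝ) :=
  Submodule.span ℝ {b x, b y, b z, a y - a x, a z - a x}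

/-- generic projection from 4-space to 3-space -/
theorem projection (L : Finset (Set (Fin 4 → ℝ))) (hL : ∀ ℓ ∈ L, IsLine ℓ)
    (P : Finset (Fin 4 → ℝ)) (s : ℕ)
    (hs : ∀ F : Set (Fin 4 → ℝ), Is2Flat F → (L.filter fun ℓ => ℓ ⊆ F).card ≤ s) :
    ∃ A : (Fin 4 → ℝ) →ₗ[ℝ] (Fin 3 → ℝ), Set.InjOn A (P : Set (Fin 4 → ℝ)) ∧
      (∀ ℓ ∈ L, Set.InjOn A ℓ) ∧ Set.InjOn (fun ℓ => A '' ℓ) (L : Set (Set (Fin 4 → ℝ))) ∧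
      ∀ u c : Fin 3 → ℝ, u ≠ 0 →
        ((imL A L).filter fun ℓ => ℓ ⊆ zeroSet (lin u c)).card ≤ s := by
  have hL2 : ∀ ℓ ∈ L, ∃ a b : Fin 4 → ℝ, b ≠ 0 ∧ ℓ = mkLine a b := fun ℓ h => hL ℓ h
  choose! a b hb hab using hL2
  let T := (((L ×ˢ L ×ˢ L).image fun t => W3 a b t.1 t.2.1 t.2.2) ∪
    ((P ×ˢ P).image fun t => Submodule.span ℝ {t.1 - t.2})).filter fun W => W ≠ ⊤
  obtain ⟨A, v, hA, hv, hT⟩ := gen_proj T (by simp [T])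
  have hW : ∀ x ∈ L, ∀ y ∈ L, ∀ z ∈ L, W3 a b x y z ≠ ⊤ → W3 a b x y z ∈ T := by
    intro x hx y hy z hz h
    refine Finset.mem_filter.2 ⟨Finset.mem_union_left _ (Finset.mem_image.2 ⟨(x, y, z), ?_, rfl⟩), h⟩
    exact Finset.mem_product.2 ⟨hx, Finset.mem_product.2 ⟨hy, hz⟩⟩
  have hbx : ∀ x y z, b x ∈ W3 a b x y z := fun x y z => Submodule.subset_span (by simp)
  have hby : ∀ x y z, b y ∈ W3 a b x y z := fun x y z => Submodule.subset_span (by simp)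
  have hbz : ∀ x y z, b z ∈ W3 a b x y z := fun x y z => Submodule.subset_span (by simp)
  have hay : ∀ x y z, a y - a x ∈ W3 a b x y z := fun x y z => Submodule.subset_span (by simp)
  have haz : ∀ x y z, a z - a x ∈ W3 a b x y z := fun x y z => Submodule.subset_span (by simp)
  have hW2 : ∀ x y, W3 a b x y y ≠ ⊤ := by
    intro x y h
    have h1 : Module.finrank ℝ (W3 a b x y y) ≤ 3 := by
      have : W3 a b x y y = Submodule.span ℝ (({b x, b y, a y - a x} : Finset (Fin 4 → ℝ)) : Set (Fin 4 → ℝ)) := by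
        unfold W3
        congr 1
        ext t; simp
      rw [this]
      exact (finrank_span_finset_le_card _).trans Finset.card_le_three
    rw [h, finrank_top] at h1
    simp at h1
  have hker : ∀ x ∈ L, ∀ y ∈ L, ∀ w ∈ W3 a b x y y, A w = 0 → w = 0 := by
    intro x hx y hy w hw h0
    exact (hT _ (hW x hx y hy y hy (hW2 x y))).2 w hw h0
  have hsamp : ∀ x ∈ L, ∀ y ∈ L, A '' y ⊆ A '' x → y = x := by
    intro x hx y hy h
    have hmem : ∀ p, p ∈ y → p - a x ∈ W3 a b x y y → p ∈ x := by
      intro p hp hpW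
      have h1 := h (Set.mem_image_of_mem A hp)
      obtain ⟨p', hp', h2⟩ := h1
      rw [hab x hx] at hp' ⊢
      obtain ⟨t, rfl⟩ := hp'
      refine ⟨t, ?_⟩
      have h3 := hker x hx y hy (p - a x - t • b x)
        (Submodule.sub_mem _ hpW (Submodule.smul_mem _ _ (hbx x y y))) (by
          rw [sub_sub, map_sub, h2, sub_self])
      rw [sub_sub, sub_eq_zero] at h3
      exact h3
    have m1 : a y ∈ y := by
      have h9 : a y ∈ mkLine (a y) (b y) := ⟨0, by simp⟩
      rwa [← hab y hy] at h9
    have m2 : a y + b y ∈ y := by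
      have h9 : a y + b y ∈ mkLine (a y) (b y) := ⟨1, by simp⟩
      rwa [← hab y hy] at h9
    refine line_unique (hL y hy) (hL x hx) m1 m2 (hmem _ m1 (hay x y y)) (hmem _ m2 ?_) ?_
    · rw [add_sub_right_comm]
      exact Submodule.add_mem _ (hay x y y) (hby x y y)
    · intro h
      have := hb y hy
      simp at h
      exact this h
  have hinjL : Set.InjOn (fun ℓ => A '' ℓ) (L : Set (Set (Fin 4 → ℝ))) := by
    intro x hx y hy h
    exact (hsamp x hx y hy (le_of_eq h.symm)).symm
  refine ⟨A, ?_, ?_, hinjL, ?_⟩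
  · intro p hp p' hp' h
    have hne : Submodule.span ℝ {p - p'} ≠ (⊤ : Submodule ℝ (Fin 4 → ℝ)) := by
      intro h
      have h2 : Module.finrank ℝ (Submodule.span ℝ {p - p'}) ≤ 1 := by
        have := finrank_span_finset_le_card (R := ℝ) ({p - p'} : Finset (Fin 4 → ℝ))
        rw [Finset.card_singleton, Finset.coe_singleton] at this
        exact this
      rw [h, finrank_top] at h2
      simp at h2
    have h1 := (hT (Submodule.span ℝ {p - p'}) (Finset.mem_filter.2 ⟨Finset.mem_union_right _
      (Finset.mem_image.2 ⟨(p, p'), Finset.mem_product.2 ⟨hp, hp'⟩, rfl⟩), hne⟩)).2 (p - p')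
      (Submodule.mem_span_singleton_self _) (by rw [map_sub, h, sub_self])
    exact sub_eq_zero.1 h1
  · intro x hx p hp p' hp' h
    rw [hab x hx] at hp hp'
    obtain ⟨t, rfl⟩ := hp
    obtain ⟨t', rfl⟩ := hp'
    have h1 := hker x hx x hx ((a x + t • b x) - (a x + t' • b x)) (by
      have : (a x + t • b x) - (a x + t' • b x) = (t - t') • b x := by module
      rw [this]
      exact Submodule.smul_mem _ _ (hbx x x x)) (by rw [map_sub, h, sub_self])
    exact sub_eq_zero.1 h1
  · intro u c hu
    let L' := L.filter fun ℓ => A '' ℓ ⊆ zeroSet (lin u c)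
    have hcard : ((imL A L).filter fun ℓ => ℓ ⊆ zeroSet (lin u c)).card ≤ L'.card := by
      have : ((imL A L).filter fun ℓ => ℓ ⊆ zeroSet (lin u c)) ⊆ L'.image fun ℓ => A '' ℓ := by
        intro ℓ hℓ
        obtain ⟨h1, h2⟩ := Finset.mem_filter.1 hℓ
        obtain ⟨m, hm, rfl⟩ := Finset.mem_image.1 h1
        exact Finset.mem_image_of_mem _ (Finset.mem_filter.2 ⟨hm, h2⟩)
      exact (Finset.card_le_card this).trans Finset.card_image_le
    refine hcard.trans ?_
    rcases Nat.lt_or_ge 1 L'.card with hlt | hle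
    · obtain ⟨x, hx, y, hy, hxy⟩ := Finset.one_lt_card.1 hlt
      let φ : (Fin 4 → ℝ) →ₗ[ℝ] ℝ := (∑ i, u i • LinearMap.proj i) ∘ₗ A
      have hφ : ∀ w, φ w = ∑ i, u i * A w i := by
        intro w
        simp [φ, LinearMap.sum_apply]
      have hφ0 : LinearMap.ker φ ≠ ⊤ := by
        intro h
        obtain ⟨j, hj⟩ := Function.ne_iff.1 hu
        obtain ⟨w, hw⟩ := hA (Pi.single j 1)
        have h1 : w ∈ LinearMap.ker φ := by rw [h]; trivial
        rw [LinearMap.mem_ker, hφ, hw] at h1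
        simp [Pi.single_apply] at h1
        exact hj h1
      have hk3 : Module.finrank ℝ (LinearMap.ker φ) < 4 := by
        have := Submodule.finrank_lt hφ0
        simpa using this
      have hpt : ∀ ℓ ∈ L', ∀ p ∈ ℓ, ∀ ℓ' ∈ L', ∀ p' ∈ ℓ', p - p' ∈ LinearMap.ker φ := by
        intro ℓ hℓ p hp ℓ' hℓ' p' hp'
        have h1 := (Finset.mem_filter.1 hℓ).2 (Set.mem_image_of_mem A hp)
        have h2 := (Finset.mem_filter.1 hℓ').2 (Set.mem_image_of_mem A hp')
        rw [lin_mem] at h1 h2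
        rw [LinearMap.mem_ker, map_sub, hφ, hφ, sub_eq_zero]
        simp only [mul_sub, Finset.sum_sub_distrib] at h1 h2
        linarith
      have ha' : ∀ ℓ ∈ L', a ℓ ∈ ℓ := by
        intro ℓ hℓ
        have := hab ℓ (Finset.mem_filter.1 hℓ).1
        have h9 : a ℓ ∈ mkLine (a ℓ) (b ℓ) := ⟨0, by simp⟩
        rwa [← this] at h9
      have hb' : ∀ ℓ ∈ L', a ℓ + b ℓ ∈ ℓ := by
        intro ℓ hℓ
        have := hab ℓ (Finset.mem_filter.1 hℓ).1
        have h9 : a ℓ + b ℓ ∈ mkLine (a ℓ) (b ℓ) := ⟨1, by simp⟩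
        rwa [← this] at h9
      have hbk : ∀ ℓ ∈ L', b ℓ ∈ LinearMap.ker φ := by
        intro ℓ hℓ
        have := hpt ℓ hℓ _ (hb' ℓ hℓ) ℓ hℓ _ (ha' ℓ hℓ)
        simpa using this
      have hWk : ∀ z ∈ L', W3 a b x y z ≤ LinearMap.ker φ := by
        intro z hz
        unfold W3
        rw [Submodule.span_le]
        intro w hw
        simp only [Set.mem_insert_iff, Set.mem_singleton_iff] at hw
        rcases hw with rfl | rfl | rfl | rfl | rfl
        · exact hbk x hx
        · exact hbk y hy
        · exact hbk z hz
        · exact hpt y hy _ (ha' y hy) x hx _ (ha' x hx)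
        · exact hpt z hz _ (ha' z hz) x hx _ (ha' x hx)
      have hL'L : ∀ z ∈ L', z ∈ L := fun z hz => (Finset.mem_filter.1 hz).1
      have hfin : ∀ z ∈ L', Module.finrank ℝ (W3 a b x y z) ≤ 2 := by
        intro z hz
        have hne : W3 a b x y z ≠ ⊤ := by
          intro h
          exact hφ0 (top_le_iff.1 (h ▸ hWk z hz))
        have hvn := (hT _ (hW x (hL'L x hx) y (hL'L y hy) z (hL'L z hz) hne)).1
        have hvk : v ∈ LinearMap.ker φ := by
          rw [LinearMap.mem_ker, hφ, hv]; simp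
        have hlt : W3 a b x y z < LinearMap.ker φ := by
          refine lt_of_le_of_ne (hWk z hz) ?_
          intro h
          rw [h] at hvn
          exact hvn hvk
        have := Submodule.finrank_lt_finrank_of_lt hlt
        omega
      have hsub : ∀ z, W3 a b x y y ≤ W3 a b x y z := by
        intro z
        conv_lhs => unfold W3
        rw [Submodule.span_le]
        intro w hw
        simp only [Set.mem_insert_iff, Set.mem_singleton_iff] at hw
        rcases hw with rfl | rfl | rfl | rfl | rfl
        · exact hbx x y z
        · exact hby x y z
        · exact hby x y z
        · exact hay x y z
        · exact hay x y z
      have h2 : Module.finrank ℝ (W3 a b x y y) = 2 := by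
        refine le_antisymm (hfin y hy) ?_
        by_contra hcon
        have h1 : Module.finrank ℝ (W3 a b x y y) ≤ Module.finrank ℝ (Submodule.span ℝ {b x}) := by
          rw [finrank_span_singleton (hb x (hL'L x hx))]; omega
        have h3 : Submodule.span ℝ {b x} = W3 a b x y y := by
          apply Submodule.eq_of_le_of_finrank_le _ h1
          rw [Submodule.span_le, Set.singleton_subset_iff]
          exact hbx x y y
        have h4 : ∀ p, p - a x ∈ W3 a b x y y → p ∈ x := by
          intro p hp
          rw [← h3] at hp
          obtain ⟨t, ht⟩ := Submodule.mem_span_singleton.1 hp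
          rw [hab x (hL'L x hx)]
          exact ⟨t, by rw [ht]; abel⟩
        apply hxy
        refine line_unique (hL x (hL'L x hx)) (hL y (hL'L y hy)) (h4 _ (hay x y y)) (h4 (a y + b y) ?_)
          (ha' y hy) (hb' y hy) ?_
        · rw [add_sub_right_comm]
          exact Submodule.add_mem _ (hay x y y) (hby x y y)
        · intro h
          have := hb y (hL'L y hy)
          simp at h
          exact this h
      have heq : ∀ z ∈ L', W3 a b x y y = W3 a b x y z := by
        intro z hz
        apply Submodule.eq_of_le_of_finrank_le (hsub z)
        rw [h2]; exact hfin z hz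
      refine le_trans (Finset.card_le_card ?_) (hs _ (flat_of_dim _ h2 (a x)))
      intro z hz
      refine Finset.mem_filter.2 ⟨hL'L z hz, ?_⟩
      intro p hp
      rw [hab z (hL'L z hz)] at hp
      obtain ⟨t, rfl⟩ := hp
      rw [Set.mem_ofPred_eq, heq z hz, add_sub_right_comm]
      exact Submodule.add_mem _ (haz x y z) (Submodule.smul_mem _ _ (hbz x y z))
    · rcases L.eq_empty_or_nonempty with rfl | hne
      · have : L' = ∅ := by simp [L']
        rw [this]; simp
      · exact hle.trans (s_pos L hL hne s hs)

end PL

end Part12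

section Part13
open Filter Topology

namespace PL

/-- the weight in the bound on rich points in 4-space -/
def B4 (r q s : ℕ) : ℝ :=
  (r : ℝ) ^ (-(5 / 3) : ℝ) + (q : ℝ) ^ (1 / 6 : ℝ) / (r : ℝ) ^ 2 + (s : ℝ) ^ (2 / 3 : ℝ) / (r : ℝ) ^ 3

lemma B4_nonneg (r q s : ℕ) : 0 ≤ B4 r q s := by unfold B4; positivity

lemma num4a (ε : ℝ) (hε : 0 < ε) (n r q s : ℕ) (hn : 1 ≤ n) (hr : 1 ≤ r) (hrn : r ^ 2 ≤ 4 * n) :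
    (n : ℝ) / r ≤ 2 * ((n : ℝ) ^ (4 / 3 + ε) * B4 r q s) := by
  have hn0 : (1 : ℝ) ≤ n := by exact_mod_cast hn
  have hr0 : (0 : ℝ) < r := by exact_mod_cast hr
  have h1 : (r : ℝ) ^ (2 / 3 : ℝ) ≤ 2 * (n : ℝ) ^ (1 / 3 : ℝ) := by
    have h2 : ((r : ℝ) ^ (2 : ℕ)) ^ (1 / 3 : ℝ) ≤ (4 * n : ℝ) ^ (1 / 3 : ℝ) :=
      Real.rpow_le_rpow (by positivity) (by exact_mod_cast hrn) (by norm_num)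
    rw [Real.mul_rpow (by norm_num) (by positivity), ← Real.rpow_natCast, ← Real.rpow_mul hr0.le] at h2
    have h3 : (4 : ℝ) ^ (1 / 3 : ℝ) ≤ 2 := by
      calc (4 : ℝ) ^ (1 / 3 : ℝ) ≤ 4 ^ (1 / 2 : ℝ) :=
            Real.rpow_le_rpow_of_exponent_le (by norm_num) (by norm_num)
        _ = 2 := by
            rw [← Real.sqrt_eq_rpow, show (4 : ℝ) = 2 ^ 2 by norm_num, Real.sqrt_sq (by norm_num)]
    have e : ((2 : ℕ) : ℝ) * (1 / 3) = 2 / 3 := by norm_num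
    rw [e] at h2
    refine h2.trans ?_
    gcongr
  have h4 : (n : ℝ) / r = n * (r : ℝ) ^ (2 / 3 : ℝ) * (r : ℝ) ^ (-(5 / 3) : ℝ) := by
    rw [mul_assoc, ← Real.rpow_add hr0, div_eq_mul_inv, ← Real.rpow_neg_one]; norm_num
  have h5 : (n : ℝ) * (n : ℝ) ^ (1 / 3 : ℝ) ≤ (n : ℝ) ^ (4 / 3 + ε) := by
    rw [← Real.rpow_one_add' (by positivity) (by norm_num)]
    apply Real.rpow_le_rpow_of_exponent_le hn0
    linarith
  have h6 : (r : ℝ) ^ (-(5 / 3) : ℝ) ≤ B4 r q s := by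
    have h7 : 0 ≤ (q : ℝ) ^ (1 / 6 : ℝ) / (r : ℝ) ^ 2 := by positivity
    have h8 : 0 ≤ (s : ℝ) ^ (2 / 3 : ℝ) / (r : ℝ) ^ 3 := by positivity
    unfold B4; linarith
  rw [h4]
  calc n * (r : ℝ) ^ (2 / 3 : ℝ) * (r : ℝ) ^ (-(5 / 3) : ℝ)
      ≤ n * (2 * (n : ℝ) ^ (1 / 3 : ℝ)) * B4 r q s := by gcongr
    _ = 2 * ((n * (n : ℝ) ^ (1 / 3 : ℝ)) * B4 r q s) := by ring
    _ ≤ _ := by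
      have := B4_nonneg r q s
      gcongr

lemma num4b (ε : ℝ) (hε : 0 < ε) (N n r q s : ℕ) (hN : 1 ≤ N) (hNn : N ≤ n) (hq : N ≤ q) :
    (N : ℝ) ^ (3 / 2 + ε) / (r : ℝ) ^ 2 ≤ (n : ℝ) ^ (4 / 3 + ε) * B4 r q s := by
  have hN0 : (0 : ℝ) < N := by exact_mod_cast hN
  have h1 : (N : ℝ) ^ (3 / 2 + ε) ≤ (n : ℝ) ^ (4 / 3 + ε) * (q : ℝ) ^ (1 / 6 : ℝ) := by
    rw [show (3 / 2 + ε) = (4 / 3 + ε) + 1 / 6 by ring, Real.rpow_add hN0]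
    have a1 : (N : ℝ) ≤ n := by exact_mod_cast hNn
    have a2 : (N : ℝ) ≤ q := by exact_mod_cast hq
    gcongr
  have h6 : (q : ℝ) ^ (1 / 6 : ℝ) / (r : ℝ) ^ 2 ≤ B4 r q s := by
    have h7 : 0 ≤ (r : ℝ) ^ (-(5 / 3) : ℝ) := by positivity
    have h8 : 0 ≤ (s : ℝ) ^ (2 / 3 : ℝ) / (r : ℝ) ^ 3 := by positivity
    unfold B4; linarith
  calc _ ≤ (n : ℝ) ^ (4 / 3 + ε) * (q : ℝ) ^ (1 / 6 : ℝ) / (r : ℝ) ^ 2 := by gcongr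
    _ = (n : ℝ) ^ (4 / 3 + ε) * ((q : ℝ) ^ (1 / 6 : ℝ) / (r : ℝ) ^ 2) := by ring
    _ ≤ _ := by gcongr

lemma num4c (ε : ℝ) (hε : 0 < ε) (N n r q s t : ℕ) (hN : 1 ≤ N) (hNn : N ≤ n) (hs : t ≤ s)
    (ht : t ≤ N) :
    (N : ℝ) * t * (N : ℝ) ^ ε / (r : ℝ) ^ 3 ≤ (n : ℝ) ^ (4 / 3 + ε) * B4 r q s := by
  have hN0 : (0 : ℝ) < N := by exact_mod_cast hN
  have hn0 : (0 : ℝ) < n := by exact_mod_cast (by omega : 0 < n)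
  have a1 : (N : ℝ) ≤ n := by exact_mod_cast hNn
  have a2 : (t : ℝ) ≤ s := by exact_mod_cast hs
  have a3 : (t : ℝ) ≤ n := by exact_mod_cast (ht.trans hNn)
  have h1 : (N : ℝ) * t * (N : ℝ) ^ ε ≤ (n : ℝ) ^ (4 / 3 + ε) * (s : ℝ) ^ (2 / 3 : ℝ) := by
    have e1 : (t : ℝ) = (t : ℝ) ^ (1 / 3 : ℝ) * (t : ℝ) ^ (2 / 3 : ℝ) := by
      rw [← Real.rpow_add' (by positivity) (by norm_num)]; norm_num
    have e2 : (n : ℝ) ^ (4 / 3 + ε) = n * (n : ℝ) ^ (1 / 3 : ℝ) * (n : ℝ) ^ ε := by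
      rw [← Real.rpow_one_add' (by positivity) (by norm_num), ← Real.rpow_add hn0]; norm_num
    rw [e2]
    calc (N : ℝ) * t * (N : ℝ) ^ ε = N * ((t : ℝ) ^ (1 / 3 : ℝ) * (t : ℝ) ^ (2 / 3 : ℝ)) * (N : ℝ) ^ ε := by
          rw [← e1]
      _ ≤ n * ((n : ℝ) ^ (1 / 3 : ℝ) * (s : ℝ) ^ (2 / 3 : ℝ)) * (n : ℝ) ^ ε := by gcongr
      _ = _ := by ring
  have h6 : (s : ℝ) ^ (2 / 3 : ℝ) / (r : ℝ) ^ 3 ≤ B4 r q s := by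
    have h7 : 0 ≤ (r : ℝ) ^ (-(5 / 3) : ℝ) := by positivity
    have h8 : 0 ≤ (q : ℝ) ^ (1 / 6 : ℝ) / (r : ℝ) ^ 2 := by positivity
    unfold B4; linarith
  calc _ ≤ (n : ℝ) ^ (4 / 3 + ε) * (s : ℝ) ^ (2 / 3 : ℝ) / (r : ℝ) ^ 3 := by gcongr
    _ = (n : ℝ) ^ (4 / 3 + ε) * ((s : ℝ) ^ (2 / 3 : ℝ) / (r : ℝ) ^ 3) := by ring
    _ ≤ _ := by gcongr

/-- few rich points on few lines in 4-space, by projection -/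
theorem in_surface (ε : ℝ) (hε : 0 < ε) : ∃ C : ℝ, 0 ≤ C ∧ ∀ (L : Finset (Set (Fin 4 → ℝ)))
    (P : Finset (Fin 4 → ℝ)) (n r q s : ℕ), 16 ≤ r → (∀ ℓ ∈ L, IsLine ℓ) → r ^ 2 ≤ 4 * n →
    L.card ≤ n → L.card ≤ q →
    (∀ F : Set (Fin 4 → ℝ), Is2Flat F → (L.filter fun ℓ => ℓ ⊆ F).card ≤ s) →
    (∀ p ∈ P, (r + 1) / 2 ≤ deg L p) →
    (P.card : ℝ) ≤ C * ((n : ℝ) ^ (4 / 3 + ε) * B4 r q s) := by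
  obtain ⟨C, hC, H⟩ := rich3 ε hε
  refine ⟨16 * C, by positivity, fun L P n r q s hr hL hrn hn hq hs hP => ?_⟩
  have hX : 0 ≤ (n : ℝ) ^ (4 / 3 + ε) * B4 r q s := mul_nonneg (by positivity) (B4_nonneg r q s)
  rcases P.eq_empty_or_nonempty with rfl | ⟨p0, hp0⟩
  · simp only [Finset.card_empty, Nat.cast_zero]; positivity
  have hN1 : 1 ≤ L.card := by
    have h1 := hP p0 hp0
    have := deg_le L p0
    omega
  obtain ⟨A, hAP, hAL, hinj, hpl⟩ := projection L hL P s hs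
  have h1 := H (imL A L) (P.image A) ((r + 1) / 2) (min s L.card) (by omega)
    (imL_isLine A L hL hAL) (by
      intro p hp
      obtain ⟨p', hp', rfl⟩ := Finset.mem_image.1 hp
      exact (hP p' hp').trans (imL_deg A L hinj p')) (by
      intro v a hv
      refine le_min (hpl v a hv) ?_
      rw [← imL_card A L hinj]
      exact Finset.card_filter_le _ _)
  rw [Finset.card_image_of_injOn hAP, imL_card A L hinj] at h1
  have hr0 : (0 : ℝ) < r := by exact_mod_cast (by omega : 0 < r)
  have hh := half_le r
  set ρ : ℝ := (((r + 1) / 2 : ℕ) : ℝ) with hρ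
  have hρ0 : 0 < (r : ℝ) / 2 := by positivity
  have b1 := num4b ε hε L.card n r q s hN1 hn hq
  have b2 := num4c ε hε L.card n r q s (min s L.card) hN1 hn (min_le_left _ _) (min_le_right _ _)
  have b3 := num4a ε hε n r q s (by omega) (by omega) hrn
  have hnR : (L.card : ℝ) ≤ n := by exact_mod_cast hn
  set X := (n : ℝ) ^ (4 / 3 + ε) * B4 r q s with hXd
  set t : ℝ := ((min s L.card : ℕ) : ℝ) with ht
  have ht0 : 0 ≤ t := Nat.cast_nonneg _
  have c1 : (L.card : ℝ) ^ (3 / 2 + ε) / ρ ^ 2 ≤ 4 * X := by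
    calc _ ≤ (L.card : ℝ) ^ (3 / 2 + ε) / ((r : ℝ) / 2) ^ 2 := by gcongr
      _ = 4 * ((L.card : ℝ) ^ (3 / 2 + ε) / (r : ℝ) ^ 2) := by field_simp; norm_num
      _ ≤ _ := by gcongr
  have c2 : (L.card : ℝ) * t * (L.card : ℝ) ^ ε / ρ ^ 3 ≤ 8 * X := by
    calc _ ≤ (L.card : ℝ) * t * (L.card : ℝ) ^ ε / ((r : ℝ) / 2) ^ 3 := by gcongr
      _ = 8 * ((L.card : ℝ) * t * (L.card : ℝ) ^ ε / (r : ℝ) ^ 3) := by field_simp; norm_num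
      _ ≤ _ := by gcongr
  have c3 : (L.card : ℝ) / ρ ≤ 4 * X := by
    calc _ ≤ (n : ℝ) / ((r : ℝ) / 2) := by gcongr
      _ = 2 * ((n : ℝ) / r) := by field_simp
      _ ≤ 2 * (2 * X) := by gcongr
      _ = _ := by ring
  calc _ ≤ _ := h1
    _ ≤ C * (4 * X + 8 * X + 4 * X) := by gcongr
    _ = _ := by ring

theorem rich4 (ε : ℝ) (hε : 0 < ε) : ∃ D : ℕ, ∃ C : ℝ, 0 ≤ C ∧ ∀ (L : Finset (Set (Fin 4 → ℝ)))
    (P : Finset (Fin 4 → ℝ)) (r q s : ℕ), 16 ≤ r → (∀ ℓ ∈ L, IsLine ℓ) →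
    (∀ f : MvPolynomial (Fin 4) ℝ, f ≠ 0 → f.totalDegree ≤ D →
                (L.filter fun ℓ => ℓ ⊆ zeroSet f).card ≤ q) →
    (∀ F : Set (Fin 4 → ℝ), Is2Flat F → (L.filter fun ℓ => ℓ ⊆ F).card ≤ s) →
    (∀ p ∈ P, r ≤ deg L p) →
    (P.card : ℝ) ≤ C * (L.card : ℝ) ^ (4 / 3 + ε) * B4 r q s + 2 * ((L.card : ℝ) / r) := by
  obtain ⟨D, hD⟩ := recursion 4 (by norm_num) (4 / 3 + ε) (by push_cast; linarith)
  obtain ⟨C1, hC1, H1⟩ := in_surface ε hε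
  obtain ⟨C, hC, H⟩ := hD (4 * D + C1 + 4) (by positivity)
  refine ⟨D, C, hC, fun L P r q s hr hL hq hs hP => ?_⟩
  have hr0 : (0 : ℝ) < r := by exact_mod_cast (by omega : 0 < r)
  have hB := B4_nonneg r q s
  by_cases hrn : r ^ 2 ≤ 4 * L.card
  · refine le_trans (H L hL (fun L p => r ≤ deg L p ∧ r ^ 2 ≤ 4 * L.card) (B4 r q s) hB ?_ ?_ ?_ L
      (Finset.Subset.refl _) P (fun p hp => ⟨hP p hp, hrn⟩)) (le_add_of_nonneg_right (by positivity))
    · intro L p h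
      have h1 := h.1
      have := deg_le L p
      exact Finset.card_pos.1 (by omega)
    · intro L' hL' f hf hfD P' hP'
      rcases P'.eq_empty_or_nonempty with rfl | ⟨p0, hp0⟩
      · simp only [Finset.card_empty, Nat.cast_zero]; positivity
      have hrn' := (hP' p0 hp0).1.2
      have hn1 : 1 ≤ L'.card := by nlinarith
      have x1 := num4a ε hε L'.card r q s hn1 (by omega) hrn'
      rw [mul_assoc]
      set X := (L'.card : ℝ) ^ (4 / 3 + ε) * B4 r q s with hX
      have hX0 : 0 ≤ X := by positivity
      have hLl : ∀ ℓ ∈ L', IsLine ℓ := fun ℓ hℓ => hL ℓ (hL' hℓ)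
      obtain ⟨Q, hQ⟩ : ∃ Q : (Fin 4 → ℝ) → Prop, ∀ p, Q p ↔
        (r + 1) / 2 ≤ deg (L'.filter fun ℓ => ℓ ⊆ zeroSet f) p := ⟨_, fun _ => Iff.rfl⟩
      rw [← Finset.card_filter_add_card_filter_not (s := P') Q]
      have a1 := H1 (L'.filter fun ℓ => ℓ ⊆ zeroSet f) (P'.filter Q) L'.card r q s hr
        (fun ℓ hℓ => hLl ℓ (Finset.mem_filter.1 hℓ).1) hrn' (Finset.card_filter_le _ _)
        ((Finset.card_le_card (Finset.filter_subset_filter _ hL')).trans (hq f hf hfD))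
        (fun F hF => (Finset.card_le_card (Finset.filter_subset_filter _
          ((Finset.filter_subset _ _).trans hL'))).trans (hs F hF))
        (fun p hp => (hQ p).1 (Finset.mem_filter.1 hp).2)
      have a2 := out_count (P'.filter fun p => ¬ Q p) L' hLl f D ((r + 1) / 2) hfD (by
        intro p hp
        obtain ⟨h1, h2⟩ := Finset.mem_filter.1 hp
        rw [hQ] at h2
        refine ⟨(hP' p h1).2, ?_⟩
        have h3 := (hP' p h1).1.1
        rw [deg_split L' p (fun ℓ => ℓ ⊆ zeroSet f)] at h3
        omega)
      have a3 := le_of_mul_half (P'.filter fun p => ¬ Q p).card r (L'.card * D) (by omega) (by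
        exact_mod_cast a2)
      have a4 : (L'.card * D : ℝ) / r ≤ D * (2 * X) := by
        rw [show (L'.card * D : ℝ) / r = D * (L'.card / r) by ring]
        gcongr
      push_cast
      nlinarith
    · intro L1 hL1 L2 hL2 P' hP'
      rcases P'.eq_empty_or_nonempty with rfl | ⟨p0, hp0⟩
      · simp only [Finset.card_empty, Nat.cast_zero]; positivity
      have hrn' := (hP' p0 hp0).1.2
      have hn1 : 1 ≤ L1.card := by nlinarith
      have x1 := num4a ε hε L1.card r q s hn1 (by omega) hrn'
      rw [mul_assoc]
      set X := (L1.card : ℝ) ^ (4 / 3 + ε) * B4 r q s with hX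
      have hX0 : 0 ≤ X := by positivity
      have hdeg : ∀ p ∈ P', r ≤ deg L2 p := by
        intro p hp
        refine (hP' p hp).1.1.trans (Finset.card_le_card ?_)
        intro ℓ hℓ
        obtain ⟨h1, h2⟩ := Finset.mem_filter.1 hℓ
        exact Finset.mem_filter.2 ⟨(hP' p hp).2.1 ℓ h1 h2, h2⟩
      have hr2 : ¬ r ^ 2 ≤ 4 * L2.card := fun h => (hP' p0 hp0).2.2 ⟨hdeg p0 hp0, h⟩
      have h1 := rich_family P' L2 (fun ℓ hℓ => hL ℓ (hL1 (hL2 hℓ))) r (by omega) hdeg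
      have hc : L2.card ≤ L1.card := Finset.card_le_card hL2
      have h2 : (P'.card : ℝ) * r ≤ 2 * L1.card := by exact_mod_cast h1.trans (by omega)
      have h3 : (P'.card : ℝ) ≤ 2 * (L1.card / r) := by
        rw [← mul_div_assoc, le_div_iff₀ hr0]; linarith
      have : 0 ≤ (4 * D + C1) * X := by positivity
      nlinarith
  · have h1 := rich_family P L hL r (by omega) hP
    have h2 : (P.card : ℝ) * r ≤ 2 * L.card := by exact_mod_cast h1
    have h3 : (P.card : ℝ) ≤ 2 * (L.card / r) := by
      rw [← mul_div_assoc, le_div_iff₀ hr0]; linarith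
    have : 0 ≤ C * (L.card : ℝ) ^ (4 / 3 + ε) * B4 r q s := by positivity
    linarith

end PL

end Part13

section Part14
open Filter Topology

namespace PL

lemma inc_sum {d : ℕ} (P : Finset (Fin d → ℝ)) (L : Finset (Set (Fin d → ℝ))) :
    Incidences P L = ∑ p ∈ P, deg L p := by
  unfold Incidences deg
  rw [Finset.card_filter, Finset.sum_product]
  apply Finset.sum_congr rfl
  intro p _
  rw [Finset.card_filter]

lemma inc_trivial {d : ℕ} (P : Finset (Fin d → ℝ)) (L : Finset (Set (Fin d → ℝ)))
    (hL : ∀ ℓ ∈ L, IsLine ℓ) : Incidences P L ≤ L.card + P.card ^ 2 := by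
  rcases P.eq_empty_or_nonempty with rfl | ⟨p0, hp0⟩
  · simp [Incidences]
  have hch : ∀ ℓ : Set (Fin d → ℝ), ∃ p ∈ P, (∃ p' ∈ P, p' ∈ ℓ) → p ∈ ℓ := by
    intro ℓ
    by_cases h : ∃ p' ∈ P, p' ∈ ℓ
    · obtain ⟨p', h1, h2⟩ := h
      exact ⟨p', h1, fun _ => h2⟩
    · exact ⟨p0, hp0, fun h' => absurd h' h⟩
  choose c hcP hc using hch
  unfold Incidences
  rw [← Finset.card_filter_add_card_filter_not (s := (P ×ˢ L).filter fun pc => pc.1 ∈ pc.2)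
    (fun x => x.1 = c x.2)]
  apply Nat.add_le_add
  · apply Finset.card_le_card_of_injOn (fun x => x.2)
    · intro x hx
      obtain ⟨h1, h2⟩ := Finset.mem_filter.1 hx
      exact (Finset.mem_product.1 (Finset.mem_filter.1 h1).1).2
    · intro x hx y hy h
      have h1 := (Finset.mem_filter.1 hx).2
      have h2 := (Finset.mem_filter.1 hy).2
      have h : x.2 = y.2 := h
      ext1
      · rw [h1, h2, h]
      · exact h
  · rw [sq, ← Finset.card_product]
    apply Finset.card_le_card_of_injOn (fun x => (x.1, c x.2))
    · intro x hx
      obtain ⟨h1, h2⟩ := Finset.mem_filter.1 hx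
      exact Finset.mem_product.2 ⟨(Finset.mem_product.1 (Finset.mem_filter.1 h1).1).1, hcP _⟩
    · intro x hx y hy h
      obtain ⟨h1, h2⟩ := Finset.mem_filter.1 hx
      obtain ⟨h3, h4⟩ := Finset.mem_filter.1 hy
      obtain ⟨h5, h6⟩ := Finset.mem_filter.1 h1
      obtain ⟨h7, h8⟩ := Finset.mem_filter.1 h3
      obtain ⟨h9, h10⟩ := Finset.mem_product.1 h5
      obtain ⟨h11, h12⟩ := Finset.mem_product.1 h7
      have e1 : x.1 = y.1 := (Prod.mk.inj h).1
      have e2 : c x.2 = c y.2 := (Prod.mk.inj h).2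
      ext1
      · exact e1
      · refine line_unique (hL _ h10) (hL _ h12) h6 (hc x.2 ⟨x.1, h9, h6⟩) ?_ ?_ h2
        · rw [e1]; exact h8
        · rw [e2]; exact hc y.2 ⟨y.1, h11, h8⟩

lemma dyadic {α : Type*} (P : Finset α) (f : α → ℕ) (n : ℕ) (hf : ∀ p ∈ P, f p ≤ n) :
    ∑ p ∈ P, f p ≤ 16 * P.card + ∑ k ∈ (Finset.range (Nat.log 2 n + 1)).filter (fun k => 4 ≤ k),
      2 * (2 ^ k * (P.filter fun p => 2 ^ k ≤ f p).card) := by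
  have h1 : ∀ p ∈ P, f p ≤ 16 + ∑ k ∈ (Finset.range (Nat.log 2 n + 1)).filter (fun k => 4 ≤ k),
      if 2 ^ k ≤ f p then 2 * 2 ^ k else 0 := by
    intro p hp
    rcases Nat.lt_or_ge (f p) 16 with h | h
    · omega
    · set k := Nat.log 2 (f p) with hk
      have hk1 : 2 ^ k ≤ f p := Nat.pow_log_le_self 2 (by omega)
      have hk2 : f p < 2 ^ (k + 1) := Nat.lt_pow_succ_log_self (by norm_num) _
      have hk4 : 4 ≤ k := by
        rw [hk]
        exact Nat.le_log_of_pow_le (by norm_num) (by omega)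
      have hkn : k ≤ Nat.log 2 n := Nat.log_mono_right (hf p hp)
      have := Finset.single_le_sum (f := fun k => if 2 ^ k ≤ f p then 2 * 2 ^ k else 0)
        (s := (Finset.range (Nat.log 2 n + 1)).filter (fun k => 4 ≤ k)) (fun i _ => Nat.zero_le _)
        (a := k) (Finset.mem_filter.2 ⟨Finset.mem_range.2 (by omega), hk4⟩)
      simp only [hk1, if_true] at this
      rw [pow_succ] at hk2
      omega
  refine (Finset.sum_le_sum h1).trans ?_
  rw [Finset.sum_add_distrib, Finset.sum_const, smul_eq_mul, mul_comm, Finset.sum_comm]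
  gcongr with k hk
  rw [← Finset.sum_filter, Finset.sum_const, smul_eq_mul]
  apply le_of_eq
  ring

lemma geo (x m T θ : ℝ) (hx : 0 ≤ x) (hm : x ≤ m) (hT : x ≤ T) (h0 : 0 ≤ θ) (h1 : θ ≤ 1) :
    x ≤ m ^ (1 - θ) * T ^ θ := by
  have e : x = x ^ (1 - θ) * x ^ θ := by
    rw [← Real.rpow_add' hx (by norm_num)]; norm_num
  rw [e]
  have : 0 ≤ 1 - θ := by linarith
  have hm0 : 0 ≤ m := hx.trans hm
  gcongr

lemma gterm (x m K n r w e θ η : ℝ) (hx : 0 ≤ x) (hm : x ≤ m) (hK : 1 ≤ K) (hn : 1 ≤ n) (hr : 0 < r)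
    (hw : 0 ≤ w) (h0 : 0 ≤ θ) (h1 : θ ≤ 1) (he : e * θ = 1) (hη : 0 ≤ η)
    (hT : x ≤ K * n ^ (4 / 3 + η) * (w * r ^ (-e))) :
    r * x ≤ K * n ^ η * (m ^ (1 - θ) * n ^ (4 / 3 * θ) * w ^ θ) := by
  have hg := geo x m _ θ hx hm hT h0 h1
  have hm0 : 0 ≤ m := hx.trans hm
  rw [Real.mul_rpow (by positivity) (by positivity), Real.mul_rpow (by positivity) (by positivity),
    Real.mul_rpow (by positivity) (by positivity), ← Real.rpow_mul hr.le,
    ← Real.rpow_mul (by positivity)] at hg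
  have e1 : -e * θ = -1 := by linarith
  rw [e1, Real.rpow_neg_one] at hg
  have hKθ : K ^ θ ≤ K := by
    calc K ^ θ ≤ K ^ (1 : ℝ) := Real.rpow_le_rpow_of_exponent_le hK h1
      _ = K := Real.rpow_one K
  have hnθ : n ^ ((4 / 3 + η) * θ) ≤ n ^ (4 / 3 * θ) * n ^ η := by
    rw [← Real.rpow_add (by linarith)]
    apply Real.rpow_le_rpow_of_exponent_le hn
    nlinarith
  calc r * x ≤ r * (m ^ (1 - θ) * (K ^ θ * n ^ ((4 / 3 + η) * θ) * (w ^ θ * r⁻¹))) := by gcongr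
    _ = m ^ (1 - θ) * (K ^ θ * n ^ ((4 / 3 + η) * θ) * w ^ θ) := by field_simp
    _ ≤ m ^ (1 - θ) * (K * (n ^ (4 / 3 * θ) * n ^ η) * w ^ θ) := by gcongr
    _ = _ := by ring

lemma scale (η C : ℝ) (hη : 0 < η) (hC : 0 ≤ C) (x m n r q s : ℕ) (hn : 1 ≤ n) (hnm : n ≤ m ^ 2)
    (hr : 1 ≤ r) (hm : x ≤ m)
    (hx : (x : ℝ) ≤ C * (n : ℝ) ^ (4 / 3 + η) * B4 r q s + 2 * ((n : ℝ) / r)) :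
    (r : ℝ) * x ≤ (4 * C + 8) * (n : ℝ) ^ η * ((m : ℝ) ^ ((2 : ℝ) / 5) * (n : ℝ) ^ ((4 : ℝ) / 5)
        + (m : ℝ) ^ ((1 : ℝ) / 2) * (n : ℝ) ^ ((2 : ℝ) / 3) * (q : ℝ) ^ ((1 : ℝ) / 12)
        + (m : ℝ) ^ ((2 : ℝ) / 3) * (n : ℝ) ^ ((4 : ℝ) / 9) * (s : ℝ) ^ ((2 : ℝ) / 9)) := by
  have hn0 : (1 : ℝ) ≤ n := by exact_mod_cast hn
  have hr0 : (0 : ℝ) < r := by exact_mod_cast hr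
  have hmR : (x : ℝ) ≤ m := by exact_mod_cast hm
  have hx0 : (0 : ℝ) ≤ x := Nat.cast_nonneg _
  have hnη : 1 ≤ (n : ℝ) ^ η := Real.one_le_rpow hn0 hη.le
  set Y1 := (m : ℝ) ^ ((2 : ℝ) / 5) * (n : ℝ) ^ ((4 : ℝ) / 5) with hY1
  set Y2 := (m : ℝ) ^ ((1 : ℝ) / 2) * (n : ℝ) ^ ((2 : ℝ) / 3) * (q : ℝ) ^ ((1 : ℝ) / 12) with hY2
  set Y3 := (m : ℝ) ^ ((2 : ℝ) / 3) * (n : ℝ) ^ ((4 : ℝ) / 9) * (s : ℝ) ^ ((2 : ℝ) / 9) with hY3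
  have hY1' : 0 ≤ Y1 := by positivity
  have hY2' : 0 ≤ Y2 := by positivity
  have hY3' : 0 ≤ Y3 := by positivity
  set K := 4 * C + 8 with hK
  have hK0 : 1 ≤ K := by linarith
  set Z := (n : ℝ) ^ (4 / 3 + η) with hZ
  have hZ0 : 0 ≤ Z := by positivity
  have hKn : 0 ≤ K * (n : ℝ) ^ η := by positivity
  have f1 : 0 ≤ K * (n : ℝ) ^ η * Y1 := by positivity
  have f2 : 0 ≤ K * (n : ℝ) ^ η * Y2 := by positivity
  have f3 : 0 ≤ K * (n : ℝ) ^ η * Y3 := by positivity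
  unfold B4 at hx
  set b1 := (r : ℝ) ^ (-(5 / 3) : ℝ) with hb1
  set b2 := (q : ℝ) ^ (1 / 6 : ℝ) / (r : ℝ) ^ 2 with hb2
  set b3 := (s : ℝ) ^ (2 / 3 : ℝ) / (r : ℝ) ^ 3 with hb3
  have g1 : 0 ≤ b1 := by positivity
  have g2 : 0 ≤ b2 := by positivity
  have g3 : 0 ≤ b3 := by positivity
  rw [mul_add, mul_add]
  by_cases t1 : (x : ℝ) ≤ K * Z * (1 * b1)
  · have := gterm x m K n r 1 (5 / 3) (3 / 5) η hx0 hmR hK0 hn0 hr0 (by norm_num) (by norm_num)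
      (by norm_num) (by norm_num) hη.le t1
    rw [Real.one_rpow, mul_one, show (1 - 3 / 5 : ℝ) = 2 / 5 by norm_num,
      show (4 / 3 * (3 / 5) : ℝ) = 4 / 5 by norm_num] at this
    linarith
  by_cases t2 : (x : ℝ) ≤ K * Z * b2
  · have t2' : (x : ℝ) ≤ K * Z * ((q : ℝ) ^ (1 / 6 : ℝ) * (r : ℝ) ^ (-2 : ℝ)) := by
      rw [Real.rpow_neg hr0.le, Real.rpow_two, ← div_eq_mul_inv]; exact t2
    have := gterm x m K n r ((q : ℝ) ^ (1 / 6 : ℝ)) 2 (1 / 2) η hx0 hmR hK0 hn0 hr0 (by positivity)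
      (by norm_num) (by norm_num) (by norm_num) hη.le t2'
    rw [← Real.rpow_mul (by positivity), show (1 - 1 / 2 : ℝ) = 1 / 2 by norm_num,
      show (4 / 3 * (1 / 2) : ℝ) = 2 / 3 by norm_num, show (1 / 6 * (1 / 2) : ℝ) = 1 / 12 by norm_num]
      at this
    linarith
  by_cases t3 : (x : ℝ) ≤ K * Z * b3
  · have t3' : (x : ℝ) ≤ K * Z * ((s : ℝ) ^ (2 / 3 : ℝ) * (r : ℝ) ^ (-3 : ℝ)) := by
      have e3 : (r : ℝ) ^ (3 : ℝ) = (r : ℝ) ^ 3 := by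
        rw [← Real.rpow_natCast]; norm_num
      rw [Real.rpow_neg hr0.le, e3, ← div_eq_mul_inv]
      exact t3
    have := gterm x m K n r ((s : ℝ) ^ (2 / 3 : ℝ)) 3 (1 / 3) η hx0 hmR hK0 hn0 hr0 (by positivity)
      (by norm_num) (by norm_num) (by norm_num) hη.le t3'
    rw [← Real.rpow_mul (by positivity), show (1 - 1 / 3 : ℝ) = 2 / 3 by norm_num,
      show (4 / 3 * (1 / 3) : ℝ) = 4 / 9 by norm_num, show (2 / 3 * (1 / 3) : ℝ) = 2 / 9 by norm_num]
      at this
    linarith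
  have hlast : (x : ℝ) ≤ 8 * ((n : ℝ) / r) := by
    have p1 : 0 ≤ Z * b1 := by positivity
    have p2 : 0 ≤ Z * b2 := by positivity
    have p3 : 0 ≤ Z * b3 := by positivity
    rw [hK] at t1 t2 t3
    nlinarith
  have h8 : (r : ℝ) * x ≤ 8 * n := by
    calc (r : ℝ) * x ≤ r * (8 * ((n : ℝ) / r)) := by gcongr
      _ = 8 * n := by field_simp
  have hnY : (n : ℝ) ≤ Y1 := by
    have e : (n : ℝ) = (n : ℝ) ^ (1 / 5 : ℝ) * (n : ℝ) ^ ((4 : ℝ) / 5) := by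
      rw [← Real.rpow_add (by linarith)]; norm_num
    have h1 : (n : ℝ) ≤ (m : ℝ) ^ 2 := by exact_mod_cast hnm
    have h2 : (n : ℝ) ^ (1 / 5 : ℝ) ≤ (m : ℝ) ^ ((2 : ℝ) / 5) := by
      calc (n : ℝ) ^ (1 / 5 : ℝ) ≤ ((m : ℝ) ^ 2) ^ (1 / 5 : ℝ) :=
            Real.rpow_le_rpow (by linarith) h1 (by norm_num)
        _ = _ := by
            rw [← Real.rpow_natCast, ← Real.rpow_mul (by positivity)]; norm_num
    calc (n : ℝ) = (n : ℝ) ^ (1 / 5 : ℝ) * (n : ℝ) ^ ((4 : ℝ) / 5) := e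
      _ ≤ _ := by rw [hY1]; gcongr
  have h9 : 8 * Y1 ≤ K * (n : ℝ) ^ η * Y1 := by
    have : 8 ≤ K * (n : ℝ) ^ η := by nlinarith
    gcongr
  linarith

lemma log_count (η : ℝ) (hη : 0 < η) (n : ℕ) (hn : 1 ≤ n) :
    ((Nat.log 2 n + 1 : ℕ) : ℝ) ≤ (2 / η + 1) * (n : ℝ) ^ η := by
  have hn0 : (1 : ℝ) ≤ n := by exact_mod_cast hn
  have h1 : (2 : ℝ) ^ (Nat.log 2 n) ≤ n := by
    exact_mod_cast Nat.pow_log_le_self 2 (by omega)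
  have h2 := Real.log_le_log (by positivity) h1
  rw [Real.log_pow] at h2
  have h3 := Real.log_le_rpow_div (by linarith : (0 : ℝ) ≤ n) hη
  have h4 := Real.log_two_gt_d9
  have h5 : 1 ≤ (n : ℝ) ^ η := Real.one_le_rpow hn0 hη.le
  have h6 : (0 : ℝ) ≤ (Nat.log 2 n : ℝ) := Nat.cast_nonneg _
  have h7 : (Nat.log 2 n : ℝ) ≤ 2 * ((n : ℝ) ^ η / η) := by nlinarith
  push_cast
  have e : 2 * ((n : ℝ) ^ η / η) = 2 / η * (n : ℝ) ^ η := by ring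
  linarith

theorem main4 (ε : ℝ) (hε : 0 < ε) : ∃ (cε : ℕ) (Aε : ℝ), 0 < Aε ∧
          ∀ (P : Finset (Fin 4 → ℝ)) (L : Finset (Set (Fin 4 → ℝ))) (q s : ℕ),
            (∀ ℓ ∈ L, IsLine ℓ) →
            (∀ f : MvPolynomial (Fin 4) ℝ, f ≠ 0 → f.totalDegree ≤ cε →
                (L.filter fun ℓ => ℓ ⊆ zeroSet f).card ≤ q) →
            (∀ F : Set (Fin 4 → ℝ), Is2Flat F →
                (L.filter fun ℓ => ℓ ⊆ F).card ≤ s) →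
            (Incidences P L : ℝ) ≤
              Aε * ((P.card : ℝ) ^ ((2 : ℝ) / 5 + ε) * (L.card : ℝ) ^ ((4 : ℝ) / 5)
                    + (P.card : ℝ) ^ ((1 : ℝ) / 2 + ε) * (L.card : ℝ) ^ ((2 : ℝ) / 3)
                        * (q : ℝ) ^ ((1 : ℝ) / 12)
                    + (P.card : ℝ) ^ ((2 : ℝ) / 3 + ε) * (L.card : ℝ) ^ ((4 : ℝ) / 9)
                        * (s : ℝ) ^ ((2 : ℝ) / 9))
              + 16 * ((P.card : ℝ) + (L.card : ℝ)) := by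
  have hη : 0 < ε / 4 := by positivity
  obtain ⟨D, C, hC, H⟩ := rich4 (ε / 4) hη
  refine ⟨D, (2 / (ε / 4) + 1) * (2 * (4 * C + 8)), by positivity, fun P L q s hL hq hs => ?_⟩
  set η := ε / 4 with hηd
  rcases Nat.lt_or_ge (P.card ^ 2) L.card with hlt | hge
  · have h1 := inc_trivial P L hL
    have h2 : (Incidences P L : ℝ) ≤ 2 * L.card := by exact_mod_cast (by omega : Incidences P L ≤ 2 * L.card)
    have h3 : (0 : ℝ) ≤ P.card := Nat.cast_nonneg _
    have h4 : (0 : ℝ) ≤ L.card := Nat.cast_nonneg _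
    refine le_trans ?_ (le_add_of_nonneg_left (by positivity))
    linarith
  rcases Nat.eq_zero_or_pos L.card with hz | hn
  · rw [Finset.card_eq_zero] at hz
    have : Incidences P L = 0 := by rw [hz]; simp [Incidences]
    rw [this, Nat.cast_zero]
    positivity
  have hm : 0 < P.card := by
    rcases Nat.eq_zero_or_pos P.card with h | h
    · rw [h] at hge; simp at hge; simp [hge] at hn
    · exact h
  have hm0 : (0 : ℝ) < P.card := by exact_mod_cast hm
  have hn0 : (1 : ℝ) ≤ L.card := by exact_mod_cast hn
  have h1 := dyadic P (deg L) L.card (fun p _ => deg_le L p)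
  rw [← inc_sum] at h1
  set m := P.card with hmd
  set n := L.card with hnd
  set Y := ((m : ℝ) ^ ((2 : ℝ) / 5) * (n : ℝ) ^ ((4 : ℝ) / 5)
        + (m : ℝ) ^ ((1 : ℝ) / 2) * (n : ℝ) ^ ((2 : ℝ) / 3) * (q : ℝ) ^ ((1 : ℝ) / 12)
        + (m : ℝ) ^ ((2 : ℝ) / 3) * (n : ℝ) ^ ((4 : ℝ) / 9) * (s : ℝ) ^ ((2 : ℝ) / 9)) with hY
  have hY0 : 0 ≤ Y := by positivity
  have h2 : ∀ k ∈ (Finset.range (Nat.log 2 n + 1)).filter (fun k => 4 ≤ k),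
      (2 * (2 ^ k * ((P.filter fun p => 2 ^ k ≤ deg L p).card : ℝ))) ≤
        2 * (4 * C + 8) * (n : ℝ) ^ η * Y := by
    intro k hk
    have hk4 := (Finset.mem_filter.1 hk).2
    have h16 : 16 ≤ 2 ^ k := by
      calc 16 = 2 ^ 4 := by norm_num
        _ ≤ 2 ^ k := Nat.pow_le_pow_right (by norm_num) hk4
    have a1 := H L (P.filter fun p => 2 ^ k ≤ deg L p) (2 ^ k) q s h16 hL hq hs
      (fun p hp => (Finset.mem_filter.1 hp).2)
    have a2 := scale η C hη hC _ m n (2 ^ k) q s hn hge (by omega) (Finset.card_filter_le _ _) a1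
    push_cast at a2
    rw [← hY] at a2
    linarith
  have h3 : (Incidences P L : ℝ) ≤ 16 * m + ∑ k ∈ (Finset.range (Nat.log 2 n + 1)).filter (fun k => 4 ≤ k),
      (2 * (2 ^ k * ((P.filter fun p => 2 ^ k ≤ deg L p).card : ℝ))) := by exact_mod_cast h1
  have h4 := Finset.sum_le_card_nsmul _ _ _ h2
  rw [nsmul_eq_mul] at h4
  have h5 : ((((Finset.range (Nat.log 2 n + 1)).filter (fun k => 4 ≤ k)).card : ℕ) : ℝ) ≤
      (2 / η + 1) * (n : ℝ) ^ η := by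
    refine le_trans ?_ (log_count η hη n hn)
    have := Finset.card_filter_le (Finset.range (Nat.log 2 n + 1)) (fun k => 4 ≤ k)
    rw [Finset.card_range] at this
    exact_mod_cast this
  have h6 : (n : ℝ) ^ η * (n : ℝ) ^ η ≤ (m : ℝ) ^ ε := by
    have b1 : (n : ℝ) ≤ (m : ℝ) ^ 2 := by exact_mod_cast hge
    have b2 : (n : ℝ) ^ η ≤ (m : ℝ) ^ (2 * η) := by
      rw [Real.rpow_mul hm0.le, Real.rpow_two]
      exact Real.rpow_le_rpow (by positivity) b1 hη.le
    calc _ ≤ (m : ℝ) ^ (2 * η) * (m : ℝ) ^ (2 * η) := by gcongr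
      _ = _ := by rw [← Real.rpow_add hm0, hηd]; ring_nf
  have e : (m : ℝ) ^ ((2 : ℝ) / 5 + ε) * (n : ℝ) ^ ((4 : ℝ) / 5)
                    + (m : ℝ) ^ ((1 : ℝ) / 2 + ε) * (n : ℝ) ^ ((2 : ℝ) / 3)
                        * (q : ℝ) ^ ((1 : ℝ) / 12)
                    + (m : ℝ) ^ ((2 : ℝ) / 3 + ε) * (n : ℝ) ^ ((4 : ℝ) / 9)
                        * (s : ℝ) ^ ((2 : ℝ) / 9) = (m : ℝ) ^ ε * Y := by
    rw [Real.rpow_add hm0, Real.rpow_add hm0, Real.rpow_add hm0, hY]; ring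
  rw [e]
  calc (Incidences P L : ℝ) ≤ _ := h3
    _ ≤ 16 * m + (2 / η + 1) * (n : ℝ) ^ η * (2 * (4 * C + 8) * (n : ℝ) ^ η * Y) := by
        refine add_le_add le_rfl (h4.trans ?_)
        gcongr
    _ = 16 * m + (2 / η + 1) * (2 * (4 * C + 8)) * (((n : ℝ) ^ η * (n : ℝ) ^ η) * Y) := by ring
    _ ≤ 16 * m + (2 / η + 1) * (2 * (4 * C + 8)) * ((m : ℝ) ^ ε * Y) := by gcongr
    _ ≤ _ := by linarith

end PL

end Part14

/-- **Point–line incidences in `ℝ⁴` (Sharir–Solomon, SoCG'14 version).** There is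
an absolute constant `A` such that for each `ε > 0` there exist an integer `c_ε`
and a constant `A_ε` such that the following holds. Let `P` be a set of `m`
distinct points and `L` a set of `n` distinct lines in `ℝ⁴`, and let `q, s ≤ n` be
such that (i) the zero set of any nonzero polynomial of degree at most `c_ε`
contains at most `q` lines of `L`, and (ii) no 2-plane contains more than `s`
lines of `L`. Then
`I(P,L) ≤ A_ε (m^{2/5+ε} n^{4/5} + m^{1/2+ε} n^{2/3} q^{1/12}
              + m^{2/3+ε} n^{4/9} s^{2/9}) + A (m + n)`. -/
theorem lines_in_R4 :
    ∃ A : ℝ, 0 < A ∧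
      ∀ ε : ℝ, 0 < ε →
        ∃ (cε : ℕ) (Aε : ℝ), 0 < Aε ∧
          ∀ (P : Finset (Fin 4 → ℝ)) (L : Finset (Set (Fin 4 → ℝ))) (q s : ℕ),
            (∀ ℓ ∈ L, IsLine ℓ) →
            q ≤ L.card → s ≤ L.card →
            (∀ f : MvPolynomial (Fin 4) ℝ, f ≠ 0 → f.totalDegree ≤ cε →
                (L.filter fun ℓ => ℓ ⊆ zeroSet f).card ≤ q) →
            (∀ F : Set (Fin 4 → ℝ), Is2Flat F →
                (L.filter fun ℓ => ℓ ⊆ F).card ≤ s) →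
            (Incidences P L : ℝ) ≤
              Aε * ((P.card : ℝ) ^ ((2 : ℝ) / 5 + ε) * (L.card : ℝ) ^ ((4 : ℝ) / 5)
                    + (P.card : ℝ) ^ ((1 : ℝ) / 2 + ε) * (L.card : ℝ) ^ ((2 : ℝ) / 3)
                        * (q : ℝ) ^ ((1 : ℝ) / 12)
                    + (P.card : ℝ) ^ ((2 : ℝ) / 3 + ε) * (L.card : ℝ) ^ ((4 : ℝ) / 9)
                        * (s : ℝ) ^ ((2 : ℝ) / 9))
              + A * ((P.card : ℝ) + (L.card : ℝ)) := by
  refine ⟨16, by norm_num, fun ε hε => ?_⟩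
  obtain ⟨c, A, hA, H⟩ := PL.main4 ε hε
  exact ⟨c, A, hA, fun P L q s hL _ _ hq hs => H P L q s hL hq hs⟩
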